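/- Let Ω ⊆ ℂⁿ be a pseudoconvex open set and let φ: Ω → ℝ be a C², nonnegative, plurisubharmonic function satisfying i∂∂̄φ ≥ δβ for some δ > 0, and set E = {z ∈ Ω : φ(z) = 0}. Let u be a smooth function with compact support in Ω and let K be a compact subset of Ω. Then there exists a constant C > 0 such that for every k ≥ 1, sup_{z ∈ E ∩ K} |u(z) − P_k(u)(z)| ≤ C/√k. -/

import Mathlib

open MeasureTheory Complex Metric Set
open scoped ComplexConjugate

noncomputable section

/-- `ℂⁿ` with the Euclidean norm. -/
abbrev Cn (n : ℕ) := EuclideanSpace ℂ (Fin n)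

variable {n : ℕ}

instance : MeasurableSpace (Cn n) := borel _
instance : BorelSpace (Cn n) := ⟨rfl⟩

/-- The Levi form of `φ` at `z` applied to `w`:
`L_φ(z; w) = ¼ (D²φ(z)[w,w] + D²φ(z)[iw,iw])` where `D²φ` is the second real Fréchet
derivative. -/
def LeviForm (φ : Cn n → ℝ) (z w : Cn n) : ℝ :=
  (1 / 4) * (fderiv ℝ (fderiv ℝ φ) z w w +
    fderiv ℝ (fderiv ℝ φ) z (Complex.I • w) (Complex.I • w))

/-- `Ω` is pseudoconvex: it admits a `C²` exhaustion function with nonnegative Levi form. -/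
def Pseudoconvex (Ω : Set (Cn n)) : Prop :=
  ∃ ρ : Cn n → ℝ, ContDiffOn ℝ 2 ρ Ω ∧
    (∀ c : ℝ, IsCompact {z ∈ Ω | ρ z ≤ c}) ∧
    ∀ z ∈ Ω, ∀ w : Cn n, 0 ≤ LeviForm ρ z w

/-- The `j`-th standard basis vector of `ℂⁿ`. -/
def e (n : ℕ) (j : Fin n) : Cn n := EuclideanSpace.single j (1 : ℂ)

/-- The components of `∂̄v`: `(∂̄v)_j = ½(∂v/∂x_j + i ∂v/∂y_j)`. -/
def dbar (v : Cn n → ℂ) (z : Cn n) (j : Fin n) : ℂ :=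
  (1 / 2) * (fderiv ℝ v z (e n j) + Complex.I * fderiv ℝ v z (Complex.I • e n j))

/-- The pointwise squared norm `|f(z)|² = Σ_j |f_j(z)|²` of a `(0,1)`-form. -/
def formNormSq (f : Cn n → Fin n → ℂ) (z : Cn n) : ℝ := ∑ j, ‖f z j‖ ^ 2

/-- A `(0,1)`-form `f` is smooth on `Ω` if each component is. -/
def SmoothFormOn (Ω : Set (Cn n)) (f : Cn n → Fin n → ℂ) : Prop :=
  ∀ j, ContDiffOn ℝ (⊤ : ℕ∞) (fun z => f z j) Ω

/-- A `(0,1)`-form `f` is `∂̄`-closed on `Ω` if `(∂̄f_j)_k = (∂̄f_k)_j` on `Ω`. -/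
def DbarClosedOn (Ω : Set (Cn n)) (f : Cn n → Fin n → ℂ) : Prop :=
  ∀ z ∈ Ω, ∀ j k : Fin n, dbar (fun w => f w j) z k = dbar (fun w => f w k) z j

/-- `v` belongs to the weighted space `L²(Ω, e^{-w})`. -/
def MemL2 (Ω : Set (Cn n)) (w : Cn n → ℝ) (v : Cn n → ℂ) : Prop :=
  AEStronglyMeasurable v (volume.restrict Ω) ∧
  IntegrableOn (fun z => ‖v z‖ ^ 2 * Real.exp (-w z)) Ω volume

/-- `v` is orthogonal to every holomorphic function in `L²(Ω, e^{-w})`. -/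
def OrthToHolo (Ω : Set (Cn n)) (w : Cn n → ℝ) (v : Cn n → ℂ) : Prop :=
  ∀ h : Cn n → ℂ, DifferentiableOn ℂ h Ω → MemL2 Ω w h →
    ∫ z in Ω, v z * conj (h z) * (Real.exp (-w z) : ℂ) = 0

/-- `ψ` is a test function on `Ω`. -/
def IsTestOn (Ω : Set (Cn n)) (ψ : Cn n → ℂ) : Prop :=
  ContDiff ℝ (⊤ : ℕ∞) ψ ∧ HasCompactSupport ψ ∧ tsupport ψ ⊆ Ω

/-- `∂̄v = f` on `Ω` in the sense of distributions. -/
def DbarEqOn (Ω : Set (Cn n)) (v : Cn n → ℂ) (f : Cn n → Fin n → ℂ) : Prop :=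
  ∀ ψ : Cn n → ℂ, IsTestOn Ω ψ → ∀ j : Fin n,
    ∫ z in Ω, v z * dbar ψ z j = -∫ z in Ω, f z j * ψ z

/-- `v` is the `L²(Ω, e^{-w})`-minimal solution of `∂̄v = f`: it solves the equation in the
sense of distributions and is orthogonal to all holomorphic functions in `L²(Ω, e^{-w})`. -/
def MinimalSolution (Ω : Set (Cn n)) (w : Cn n → ℝ) (f : Cn n → Fin n → ℂ) (v : Cn n → ℂ) :
    Prop :=
  MemL2 Ω w v ∧ DbarEqOn Ω v f ∧ OrthToHolo Ω w v

/-- The first order operator `½(D_w + s D_{iw})`; for `s = i` it is `∂̄` and for `s = -i` it is `∂`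
in the direction `w`. -/
def wirt (s : ℂ) (v : Cn n → ℂ) (w z : Cn n) : ℂ :=
  (1 / 2) * (fderiv ℝ v z w + s * fderiv ℝ v z (Complex.I • w))

theorem dbar_eq_wirt (v : Cn n → ℂ) (z : Cn n) (j : Fin n) : dbar v z j = wirt I v (e n j) z := rfl

/-- `f` is `C²` with compact support contained in `Ω`. -/
structure IsTest (Ω : Set (Cn n)) (f : Cn n → ℂ) : Prop where
  contDiff : ContDiff ℝ 2 f
  compact : HasCompactSupport f
  subset : tsupport f ⊆ Ω

section wirt

variable {s : ℂ} {f g : Cn n → ℂ} {w z : Cn n}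

theorem wirt_add (hf : DifferentiableAt ℝ f z) (hg : DifferentiableAt ℝ g z) :
    wirt s (fun x => f x + g x) w z = wirt s f w z + wirt s g w z := by
  simp only [wirt]
  rw [fderiv_fun_add hf hg]
  simp only [add_apply]
  ring

theorem wirt_sub (hf : DifferentiableAt ℝ f z) (hg : DifferentiableAt ℝ g z) :
    wirt s (fun x => f x - g x) w z = wirt s f w z - wirt s g w z := by
  simp only [wirt]
  rw [fderiv_fun_sub hf hg]
  simp only [sub_apply]
  ring

theorem wirt_mul (hf : DifferentiableAt ℝ f z) (hg : DifferentiableAt ℝ g z) :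
    wirt s (fun x => f x * g x) w z = f z * wirt s g w z + wirt s f w z * g z := by
  simp only [wirt]
  rw [fderiv_fun_mul hf hg]
  simp only [add_apply, smul_apply, smul_eq_mul]
  ring

theorem wirt_conj (hf : DifferentiableAt ℝ f z) :
    wirt s (fun x => conj (f x)) w z = conj (wirt (conj s) f w z) := by
  have h : HasFDerivAt (fun x => conj (f x)) ((conjCLE : ℂ →L[ℝ] ℂ).comp (fderiv ℝ f z)) z :=
    (conjCLE : ℂ →L[ℝ] ℂ).hasFDerivAt.comp z hf.hasFDerivAt
  have h2 : conj (2 : ℂ) = 2 := map_ofNat _ 2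
  simp only [wirt, h.fderiv]
  simp [h2]

theorem wirt_cexp (hf : DifferentiableAt ℝ f z) :
    wirt s (fun x => cexp (f x)) w z = cexp (f z) * wirt s f w z := by
  simp only [wirt]
  rw [hf.hasFDerivAt.cexp.fderiv]
  simp only [smul_apply, smul_eq_mul]
  ring

theorem wirt_congr (h : f =ᶠ[nhds z] g) : wirt s f w z = wirt s g w z := by
  simp only [wirt, h.fderiv_eq]

theorem wirt_eq_zero_of_notMem (h : z ∉ tsupport f) : wirt s f w z = 0 := by
  simp [wirt, fderiv_of_notMem_tsupport (𝕜 := ℝ) h]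

theorem tsupport_wirt_subset : tsupport (wirt s f w) ⊆ tsupport f := by
  refine closure_minimal (fun z hz => ?_) (isClosed_tsupport f)
  by_contra h
  exact hz (wirt_eq_zero_of_notMem h)

theorem HasCompactSupport.wirt (h : HasCompactSupport f) : HasCompactSupport (wirt s f w) :=
  IsCompact.of_isClosed_subset h (isClosed_tsupport _) tsupport_wirt_subset

theorem ContDiffAt.wirt {m k : WithTop ℕ∞} (h : ContDiffAt ℝ k f z) (hm : m + 1 ≤ k) :
    ContDiffAt ℝ m (wirt s f w) z := by
  have h1 : ContDiffAt ℝ m (fderiv ℝ f) z := h.fderiv_right hm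
  unfold _root_.wirt
  exact contDiffAt_const.mul ((h1.clm_apply contDiffAt_const).add
    (contDiffAt_const.mul (h1.clm_apply contDiffAt_const)))

theorem ContDiff.wirt {m k : WithTop ℕ∞} (h : ContDiff ℝ k f) (hm : m + 1 ≤ k) :
    ContDiff ℝ m (wirt s f w) :=
  contDiff_iff_contDiffAt.2 fun _ => h.contDiffAt.wirt hm

theorem ContDiff.continuous_wirt {k : WithTop ℕ∞} (h : ContDiff ℝ k f) (hk : 1 ≤ k) :
    Continuous (_root_.wirt s f w) :=
  (ContDiff.wirt (m := 0) h (by simpa using hk)).continuous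

theorem fderiv_wirt {t : ℂ} {w' : Cn n} (h : ContDiffAt ℝ 2 f z) :
    fderiv ℝ (wirt t f w') z w =
      (1 / 2) * (fderiv ℝ (fderiv ℝ f) z w w' + t * fderiv ℝ (fderiv ℝ f) z w (I • w')) := by
  have h1 : DifferentiableAt ℝ (fderiv ℝ f) z :=
    (h.fderiv_right (m := 1) (by norm_num)).differentiableAt (by norm_num)
  have h2 : HasFDerivAt (wirt t f w') ((1 / 2 : ℂ) • ((fderiv ℝ (fderiv ℝ f) z).flip w' +
      t • (fderiv ℝ (fderiv ℝ f) z).flip (I • w'))) z := by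
    unfold wirt
    have ha (v : Cn n) : HasFDerivAt (fun x => fderiv ℝ f x v)
        ((fderiv ℝ (fderiv ℝ f) z).flip v) z := by
      have := h1.hasFDerivAt.clm_apply (hasFDerivAt_const v z)
      simpa using this
    exact ((ha w').add ((ha (I • w')).const_mul t)).const_mul (1 / 2 : ℂ)
  rw [h2.fderiv]
  simp only [smul_apply, add_apply, ContinuousLinearMap.flip_apply, smul_eq_mul]

theorem wirt_comm {t : ℂ} {w' : Cn n} (h : ContDiffAt ℝ 2 f z) :
    wirt s (wirt t f w') w z = wirt t (wirt s f w) w' z := by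
  have hs : IsSymmSndFDerivAt ℝ f z := h.isSymmSndFDerivAt (by simp)
  rw [wirt, wirt, fderiv_wirt h, fderiv_wirt h, fderiv_wirt h, fderiv_wirt h]
  rw [hs.eq w w', hs.eq w (I • w'), hs.eq (I • w) w', hs.eq (I • w) (I • w')]
  ring

theorem wirt_smul_left (c : ℂ) (hf : DifferentiableAt ℝ f z) :
    wirt s (fun x => c * f x) w z = c * wirt s f w z := by
  simp only [wirt]
  rw [fderiv_const_mul hf]
  simp only [smul_apply, smul_eq_mul]
  ring

theorem wirt_fun_sum {ι : Type*} (A : Finset ι) {F : ι → Cn n → ℂ}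
    (hF : ∀ i ∈ A, DifferentiableAt ℝ (F i) z) :
    wirt s (fun x => ∑ i ∈ A, F i x) w z = ∑ i ∈ A, wirt s (F i) w z := by
  simp only [wirt]
  rw [fderiv_fun_sum hF]
  simp only [sum_apply, Finset.mul_sum, Finset.sum_add_distrib, mul_add]

theorem continuous_mul_of_tsupport {Ω : Set (Cn n)} (hΩ : IsOpen Ω) (hf : ContinuousOn f Ω)
    (hg : Continuous g) (hs : tsupport g ⊆ Ω) : Continuous (fun z => f z * g z) := by
  refine continuous_of_tsupport fun x hx => ?_
  have : x ∈ Ω := hs (tsupport_mul_subset_right hx)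
  exact (hf.continuousAt (hΩ.mem_nhds this)).mul hg.continuousAt

theorem contDiff_mul_of_tsupport {Ω : Set (Cn n)} {m : WithTop ℕ∞} (hΩ : IsOpen Ω)
    (hf : ContDiffOn ℝ m f Ω)
    (hg : ContDiff ℝ m g) (hs : tsupport g ⊆ Ω) : ContDiff ℝ m (fun z => f z * g z) := by
  refine contDiff_iff_contDiffAt.2 fun x => ?_
  by_cases hx : x ∈ tsupport g
  · exact (hf.contDiffAt (hΩ.mem_nhds (hs hx))).mul hg.contDiffAt
  · have h0 : (fun z => f z * g z) =ᶠ[nhds x] fun _ => 0 := by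
      filter_upwards [notMem_tsupport_iff_eventuallyEq.1 hx] with z hz
      simp [hz]
    exact contDiffAt_const.congr_of_eventuallyEq h0

/-- Integration by parts on an open set. -/
theorem integral_mul_wirt {Ω : Set (Cn n)} (hΩ : IsOpen Ω) (hf : ContDiffOn ℝ 1 f Ω)
    (hg : ContDiff ℝ 1 g) (hgc : HasCompactSupport g) (hs : tsupport g ⊆ Ω) :
    ∫ z, f z * wirt s g w z = - ∫ z, wirt s f w z * g z := by
  have hfd : ContinuousOn (fderiv ℝ f) Ω := hf.continuousOn_fderiv_of_isOpen hΩ le_rfl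
  have hgd : Continuous (fderiv ℝ g) := hg.continuous_fderiv (by norm_num)
  have hI1 (v : Cn n) : Integrable (fun x => fderiv ℝ f x v * g x) :=
    (continuous_mul_of_tsupport hΩ (hfd.clm_apply continuousOn_const) hg.continuous hs)
      |>.integrable_of_hasCompactSupport hgc.mul_left
  have hsv (v : Cn n) : tsupport (fun x => fderiv ℝ g x v) ⊆ tsupport g :=
    tsupport_fderiv_apply_subset ℝ v
  have hI2 (v : Cn n) : Integrable (fun x => f x * fderiv ℝ g x v) :=
    (continuous_mul_of_tsupport hΩ hf.continuousOn (hgd.clm_apply continuous_const)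
      ((hsv v).trans hs)).integrable_of_hasCompactSupport
      (HasCompactSupport.mul_left (hgc.fderiv_apply ℝ v))
  have hI3 : Integrable (fun x => f x * g x) :=
    (continuous_mul_of_tsupport hΩ hf.continuousOn hg.continuous hs)
      |>.integrable_of_hasCompactSupport hgc.mul_left
  have key (v : Cn n) : ∫ x, f x * fderiv ℝ g x v = - ∫ x, fderiv ℝ f x v * g x :=
    integral_mul_fderiv_eq_neg_fderiv_mul_of_integrable (hI1 v) (hI2 v) hI3
      (fun x hx => (hf.contDiffAt (hΩ.mem_nhds (hs hx))).differentiableAt (by norm_num))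
      (fun x _ => (hg.differentiable (by norm_num)).differentiableAt)
  have e1 : ∀ z, f z * wirt s g w z =
      (1 / 2) * (f z * fderiv ℝ g z w) + (s / 2) * (f z * fderiv ℝ g z (I • w)) := by
    intro z; simp only [wirt]; ring
  have e2 : ∀ z, wirt s f w z * g z =
      (1 / 2) * (fderiv ℝ f z w * g z) + (s / 2) * (fderiv ℝ f z (I • w) * g z) := by
    intro z; simp only [wirt]; ring
  simp_rw [e1, e2]
  rw [integral_add ((hI2 _).const_mul _) ((hI2 _).const_mul _),
    integral_add ((hI1 _).const_mul _) ((hI1 _).const_mul _),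
    integral_const_mul, integral_const_mul, integral_const_mul, integral_const_mul, key, key]
  ring

end wirt

namespace IsTest

variable {Ω : Set (Cn n)} {f : Cn n → ℂ}

theorem continuous (h : IsTest Ω f) : Continuous f := h.contDiff.continuous

theorem differentiable (h : IsTest Ω f) : Differentiable ℝ f :=
  h.contDiff.differentiable (by norm_num)

theorem conjugate (h : IsTest Ω f) : IsTest Ω (fun z => conj (f z)) where
  contDiff := (conjCLE : ℂ →L[ℝ] ℂ).contDiff.comp h.contDiff
  compact := h.compact.comp_left (g := fun x : ℂ => (starRingEnd ℂ) x) (by simp)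
  subset := by
    have : tsupport (fun z => (starRingEnd ℂ) (f z)) = tsupport f := by
      simp [tsupport, Function.support]
    rw [this]; exact h.subset

theorem mul_left {g : Cn n → ℂ} (hΩ : IsOpen Ω) (hg : ContDiffOn ℝ 2 g Ω) (h : IsTest Ω f) :
    IsTest Ω (fun z => g z * f z) where
  contDiff := contDiff_mul_of_tsupport hΩ hg h.contDiff h.subset
  compact := h.compact.mul_left
  subset := (tsupport_mul_subset_right).trans h.subset

theorem add {g : Cn n → ℂ} (h : IsTest Ω f) (hg : IsTest Ω g) :
    IsTest Ω (fun z => f z + g z) where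
  contDiff := h.contDiff.add hg.contDiff
  compact := h.compact.add hg.compact
  subset := (tsupport_add f g).trans (union_subset h.subset hg.subset)

theorem const_mul (c : ℂ) (h : IsTest Ω f) : IsTest Ω (fun z => c * f z) where
  contDiff := contDiff_const.mul h.contDiff
  compact := h.compact.mul_left
  subset := (tsupport_mul_subset_right).trans h.subset

theorem zero : IsTest Ω (fun _ => 0) where
  contDiff := contDiff_const
  compact := HasCompactSupport.zero
  subset := by simp [tsupport]

theorem continuous_wirt {s : ℂ} {w : Cn n} (h : IsTest Ω f) : Continuous (wirt s f w) :=
  h.contDiff.continuous_wirt (by norm_num)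

theorem compact_wirt {s : ℂ} {w : Cn n} (h : IsTest Ω f) : HasCompactSupport (wirt s f w) :=
  h.compact.wirt

theorem tsupport_wirt {s : ℂ} {w : Cn n} (h : IsTest Ω f) : tsupport (wirt s f w) ⊆ Ω :=
  tsupport_wirt_subset.trans h.subset

end IsTest

theorem wirt_I_smul (f : Cn n → ℂ) (c : ℂ) (w z : Cn n) :
    wirt I f (c • w) z = conj c * wirt I f w z := by
  have h1 : c • w = c.re • w + c.im • (I • w) := by
    ext j
    simp only [PiLp.smul_apply, PiLp.add_apply, smul_eq_mul, real_smul]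
    linear_combination -(w j) * (re_add_im c)
  have h2 : I • c • w = c.re • (I • w) - c.im • w := by
    ext j
    simp only [PiLp.smul_apply, PiLp.sub_apply, smul_eq_mul, real_smul]
    linear_combination -I * (w j) * (re_add_im c) + c.im * (w j) * I_mul_I
  rw [wirt, wirt, h2, h1, map_add, map_sub, map_smul (fderiv ℝ f z) c.re,
    map_smul (fderiv ℝ f z) c.im, map_smul (fderiv ℝ f z) c.re, map_smul (fderiv ℝ f z) c.im]
  simp only [real_smul]
  have : conj c = c.re - c.im * I := by
    apply Complex.ext <;> simp
  rw [this]
  linear_combination ((1 / 2) * c.im * (fderiv ℝ f z) (I • w)) * (I_mul_I)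

theorem wirt_negI_smul (f : Cn n → ℂ) (c : ℂ) (w z : Cn n) :
    wirt (-I) f (c • w) z = c * wirt (-I) f w z := by
  have h1 : c • w = c.re • w + c.im • (I • w) := by
    ext j
    simp only [PiLp.smul_apply, PiLp.add_apply, smul_eq_mul, real_smul]
    linear_combination -(w j) * (re_add_im c)
  have h2 : I • c • w = c.re • (I • w) - c.im • w := by
    ext j
    simp only [PiLp.smul_apply, PiLp.sub_apply, smul_eq_mul, real_smul]
    linear_combination -I * (w j) * (re_add_im c) + c.im * (w j) * I_mul_I
  rw [wirt, wirt, h2, h1, map_add, map_sub, map_smul (fderiv ℝ f z) c.re,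
    map_smul (fderiv ℝ f z) c.im, map_smul (fderiv ℝ f z) c.re, map_smul (fderiv ℝ f z) c.im]
  simp only [real_smul]
  linear_combination (1 / 2) * (fderiv ℝ f z w - I * fderiv ℝ f z (I • w)) * (re_add_im c) +
    ((1 / 2) * c.im * (fderiv ℝ f z) (I • w)) * (I_mul_I)

theorem wirt_sum_dir {ι : Type*} (A : Finset ι) (s : ℂ) (f : Cn n → ℂ) (w : ι → Cn n) (z : Cn n) :
    wirt s f (∑ i ∈ A, w i) z = ∑ i ∈ A, wirt s f (w i) z := by
  simp only [wirt, Finset.smul_sum, map_sum, Finset.mul_sum, ← Finset.sum_add_distrib]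

theorem eq_sum_e (w : Cn n) : w = ∑ j, w j • e n j := by
  ext k
  simp [e, Pi.single_apply]

theorem ContDiffAt.ofReal_comp {m : WithTop ℕ∞} {φ : Cn n → ℝ} {z : Cn n} (h : ContDiffAt ℝ m φ z) :
    ContDiffAt ℝ m (fun x => (φ x : ℂ)) z :=
  ofRealCLM.contDiff.contDiffAt.comp z h

theorem ContDiff.ofReal_comp {m : WithTop ℕ∞} {φ : Cn n → ℝ} (h : ContDiff ℝ m φ) :
    ContDiff ℝ m (fun x => (φ x : ℂ)) :=
  ofRealCLM.contDiff.comp h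

theorem ContDiffOn.ofReal_comp {m : WithTop ℕ∞} {φ : Cn n → ℝ} {Ω : Set (Cn n)}
    (h : ContDiffOn ℝ m φ Ω) : ContDiffOn ℝ m (fun x => (φ x : ℂ)) Ω :=
  ofRealCLM.contDiff.comp_contDiffOn h

theorem fderiv_ofReal_comp {φ : Cn n → ℝ} {z : Cn n} (h : DifferentiableAt ℝ φ z) (w : Cn n) :
    fderiv ℝ (fun x => (φ x : ℂ)) z w = (fderiv ℝ φ z w : ℂ) := by
  have : HasFDerivAt (fun x => (φ x : ℂ)) (ofRealCLM.comp (fderiv ℝ φ z)) z :=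
    ofRealCLM.hasFDerivAt.comp z h.hasFDerivAt
  rw [this.fderiv]; simp

theorem fderiv_fderiv_ofReal_comp {φ : Cn n → ℝ} {z : Cn n} (h : ContDiffAt ℝ 2 φ z)
    (v w : Cn n) : fderiv ℝ (fderiv ℝ (fun x => (φ x : ℂ))) z v w =
      (fderiv ℝ (fderiv ℝ φ) z v w : ℂ) := by
  have h1 : DifferentiableAt ℝ (fderiv ℝ φ) z :=
    (h.fderiv_right (m := 1) (by norm_num)).differentiableAt (by norm_num)
  have h2 : fderiv ℝ (fun x => (φ x : ℂ)) =ᶠ[nhds z] fun x => ofRealCLM.comp (fderiv ℝ φ x) := by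
    filter_upwards [h.eventually (by simp)] with x hx
    ext w
    rw [fderiv_ofReal_comp (hx.differentiableAt (by norm_num))]; simp
  have h3 : HasFDerivAt (fun x => ofRealCLM.comp (fderiv ℝ φ x))
      ((ContinuousLinearMap.compL ℝ (Cn n) ℝ ℂ ofRealCLM).comp (fderiv ℝ (fderiv ℝ φ) z)) z :=
    (ContinuousLinearMap.compL ℝ (Cn n) ℝ ℂ ofRealCLM).hasFDerivAt.comp z h1.hasFDerivAt
  rw [h2.fderiv_eq, h3.fderiv]
  simp

/-- The Levi form is the Hermitian form with coefficients `∂_k ∂̄_j φ`. -/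
theorem leviForm_eq_sum {φ : Cn n → ℝ} {z : Cn n} (h : ContDiffAt ℝ 2 φ z) (w : Cn n) :
    (LeviForm φ z w : ℂ) = ∑ j, ∑ k, conj (w j) * w k *
      wirt I (wirt (-I) (fun x => (φ x : ℂ)) (e n k)) (e n j) z := by
  have hc := h.ofReal_comp
  have h1 : (LeviForm φ z w : ℂ) = wirt I (wirt (-I) (fun x => (φ x : ℂ)) w) w z := by
    have hs : IsSymmSndFDerivAt ℝ (fun x => (φ x : ℂ)) z := hc.isSymmSndFDerivAt (by simp)
    rw [wirt, fderiv_wirt hc, fderiv_wirt hc, LeviForm]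
    push_cast
    rw [← fderiv_fderiv_ofReal_comp h, ← fderiv_fderiv_ofReal_comp h, hs.eq (I • w) w]
    linear_combination (1 / 4) * (fderiv ℝ (fderiv ℝ fun x ↦ (φ x : ℂ)) z) (I • w) (I • w) * I_mul_I
  have h2 : wirt (-I) (fun x => (φ x : ℂ)) w =
      fun x => ∑ k, w k * wirt (-I) (fun x => (φ x : ℂ)) (e n k) x := by
    ext x
    conv_lhs => rw [eq_sum_e w]
    rw [wirt_sum_dir]
    simp_rw [wirt_negI_smul]
  have hd (k : Fin n) : DifferentiableAt ℝ (wirt (-I) (fun x => (φ x : ℂ)) (e n k)) z :=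
    (ContDiffAt.wirt (m := 1) hc (by norm_num)).differentiableAt (by norm_num)
  rw [h1]
  conv_lhs => rw [h2]
  nth_rewrite 2 [eq_sum_e w]
  rw [wirt_sum_dir]
  refine Finset.sum_congr rfl fun j _ => ?_
  rw [wirt_I_smul, wirt_fun_sum _ (fun k _ => (hd k).const_mul _), Finset.mul_sum]
  refine Finset.sum_congr rfl fun k _ => ?_
  rw [wirt_smul_left _ (hd k)]
  ring

/-- The formal weighted derivative `e^φ ∂_w (e^{-φ} f)`. -/
def wderiv (φ : Cn n → ℝ) (f : Cn n → ℂ) (w z : Cn n) : ℂ :=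
  wirt (-I) f w z - wirt (-I) (fun x => (φ x : ℂ)) w z * f z

section KMH

variable {φ : Cn n → ℝ}

theorem tsupport_wderiv {f : Cn n → ℂ} {w : Cn n} : tsupport (wderiv φ f w) ⊆ tsupport f := by
  refine closure_minimal (fun z hz => ?_) (isClosed_tsupport f)
  by_contra h
  exact hz (by simp [wderiv, wirt_eq_zero_of_notMem h, image_eq_zero_of_notMem_tsupport h])

theorem compact_wderiv {f : Cn n → ℂ} {w : Cn n} (h : HasCompactSupport f) :
    HasCompactSupport (wderiv φ f w) :=
  IsCompact.of_isClosed_subset h (isClosed_tsupport _) tsupport_wderiv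

theorem contDiff_wderiv {m k : WithTop ℕ∞} {f : Cn n → ℂ} {w : Cn n} (hφ : ContDiff ℝ k φ)
    (h : ContDiff ℝ k f) (hm : m + 1 ≤ k) : ContDiff ℝ m (wderiv φ f w) :=
  (h.wirt hm).sub ((hφ.ofReal_comp.wirt hm).mul (h.of_le (le_self_add.trans hm)))

theorem wirt_weight {s : ℂ} {z : Cn n} (hφ : DifferentiableAt ℝ φ z) (w : Cn n) :
    wirt s (fun x => (Real.exp (-φ x) : ℂ)) w z =
      -(Real.exp (-φ z) : ℂ) * wirt s (fun x => (φ x : ℂ)) w z := by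
  have hd : DifferentiableAt ℝ (fun x => (φ x : ℂ)) z := ofRealCLM.differentiableAt.comp z hφ
  have : (fun x => (Real.exp (-φ x) : ℂ)) = fun x => cexp ((-1) * (φ x : ℂ)) := by
    ext x; push_cast; congr 1; ring
  rw [this, wirt_cexp (hd.const_mul _), wirt_smul_left _ hd]
  push_cast
  rw [neg_one_mul]; ring

theorem wirt_mul_weight {f : Cn n → ℂ} {z : Cn n} (hφ : DifferentiableAt ℝ φ z)
    (hf : DifferentiableAt ℝ f z) (w : Cn n) :
    wirt (-I) (fun x => f x * (Real.exp (-φ x) : ℂ)) w z =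
      wderiv φ f w z * (Real.exp (-φ z) : ℂ) := by
  have hd : DifferentiableAt ℝ (fun x => (Real.exp (-φ x) : ℂ)) z :=
    ofRealCLM.differentiableAt.comp z hφ.neg.exp
  rw [wirt_mul hf hd, wirt_weight hφ, wderiv]
  ring

theorem integral_wderiv_mul_conj (hφ : ContDiff ℝ 1 φ) {f g : Cn n → ℂ} (hf : ContDiff ℝ 1 f)
    (hg : ContDiff ℝ 1 g) (hgc : HasCompactSupport g) (w : Cn n) :
    ∫ z, wderiv φ f w z * conj (g z) * (Real.exp (-φ z) : ℂ) =
      - ∫ z, f z * conj (wirt I g w z) * (Real.exp (-φ z) : ℂ) := by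
  have hW : ContDiff ℝ 1 (fun x => (Real.exp (-φ x) : ℂ)) := (hφ.neg.exp).ofReal_comp
  have hgc' : HasCompactSupport (fun z => conj (g z)) :=
    hgc.comp_left (g := fun x : ℂ => conj x) (by simp)
  have hg' : ContDiff ℝ 1 (fun z => conj (g z)) := (conjCLE : ℂ →L[ℝ] ℂ).contDiff.comp hg
  have := integral_mul_wirt (s := -I) (w := w) isOpen_univ (hf.mul hW).contDiffOn hg' hgc'
    (subset_univ _)
  have e1 (z : Cn n) : wderiv φ f w z * conj (g z) * (Real.exp (-φ z) : ℂ) =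
      wirt (-I) (fun x => f x * (Real.exp (-φ x) : ℂ)) w z * conj (g z) := by
    rw [wirt_mul_weight (hφ.differentiable (by norm_num) z) (hf.differentiable (by norm_num) z)]
    ring
  have e2 (z : Cn n) : f z * conj (wirt I g w z) * (Real.exp (-φ z) : ℂ) =
      f z * (Real.exp (-φ z) : ℂ) * wirt (-I) (fun z => conj (g z)) w z := by
    rw [wirt_conj (hg.differentiable (by norm_num) z)]
    simp only [map_neg, conj_I, neg_neg]
    ring
  simp_rw [e1, e2]
  rw [this, neg_neg]

theorem integrable_weight {f : Cn n → ℂ} (hφ : Continuous φ) (hf : Continuous f)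
    (hc : HasCompactSupport f) : Integrable (fun z => f z * (Real.exp (-φ z) : ℂ)) :=
  (hf.mul (by fun_prop)).integrable_of_hasCompactSupport hc.mul_right

theorem integral_wderiv_wderiv (hφ : ContDiff ℝ 2 φ) {f g : Cn n → ℂ} (hf : ContDiff ℝ 2 f)
    (hg : ContDiff ℝ 2 g) (hfc : HasCompactSupport f) (hgc : HasCompactSupport g) (v w : Cn n) :
    ∫ z, wderiv φ f v z * conj (wderiv φ g w z) * (Real.exp (-φ z) : ℂ) =
      ∫ z, (wirt I f w z * conj (wirt I g v z) + f z * conj (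
        wirt I (wirt (-I) (fun x => (φ x : ℂ)) w) v z * g z)) * (Real.exp (-φ z) : ℂ) := by
  have hφ1 : ContDiff ℝ 1 φ := hφ.of_le (by norm_num)
  have hf1 : ContDiff ℝ 1 f := hf.of_le (by norm_num)
  have hg1 : ContDiff ℝ 1 g := hg.of_le (by norm_num)
  have hDg : ContDiff ℝ 1 (wderiv φ g w) := contDiff_wderiv hφ hg (by norm_num)
  have hBg : ContDiff ℝ 1 (wirt I g v) := hg.wirt (by norm_num)
  have hBf : Continuous (wirt I f w) := hf.continuous_wirt (by norm_num)
  have hP : ContDiff ℝ 1 (wirt (-I) (fun x => (φ x : ℂ)) w) := hφ.ofReal_comp.wirt (by norm_num)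
  have hPP : Continuous (wirt I (wirt (-I) (fun x => (φ x : ℂ)) w) v) :=
    hP.continuous_wirt (by norm_num)
  have hDB : Continuous (wderiv φ (wirt I g v) w) :=
    (contDiff_wderiv (m := 0) hφ1 hBg (by norm_num)).continuous
  rw [integral_wderiv_mul_conj hφ1 hf1 hDg (compact_wderiv hgc)]
  have comm (z : Cn n) : wirt I (wderiv φ g w) v z = wderiv φ (wirt I g v) w z -
      wirt I (wirt (-I) (fun x => (φ x : ℂ)) w) v z * g z := by
    have d1 : DifferentiableAt ℝ (wirt (-I) g w) z :=
      ((hg.wirt (m := 1) (by norm_num)).differentiable (by norm_num)) z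
    have d2 := hP.differentiable (by norm_num) z
    have d3 := hg.differentiable (by norm_num) z
    unfold wderiv
    rw [wirt_sub d1 (d2.fun_mul d3), wirt_mul d2 d3, wirt_comm hg.contDiffAt]
    ring
  have key : ∫ z, f z * conj (wderiv φ (wirt I g v) w z) * (Real.exp (-φ z) : ℂ) =
      - ∫ z, wirt I f w z * conj (wirt I g v z) * (Real.exp (-φ z) : ℂ) := by
    have h := congrArg conj (integral_wderiv_mul_conj hφ1 hBg hf1 hfc w)
    rw [map_neg, ← integral_conj, ← integral_conj] at h
    have e1 (z : Cn n) : f z * conj (wderiv φ (wirt I g v) w z) * (Real.exp (-φ z) : ℂ) =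
        conj (wderiv φ (wirt I g v) w z * conj (f z) * (Real.exp (-φ z) : ℂ)) := by
      simp only [map_mul, conj_conj, conj_ofReal]; ring
    have e2 (z : Cn n) : wirt I f w z * conj (wirt I g v z) * (Real.exp (-φ z) : ℂ) =
        conj (wirt I g v z * conj (wirt I f w z) * (Real.exp (-φ z) : ℂ)) := by
      simp only [map_mul, conj_conj, conj_ofReal]; ring
    simp_rw [e1, e2]
    exact h
  have hcc := continuous_conj
  have i1 : Integrable fun z => f z * conj (wderiv φ (wirt I g v) w z) * (Real.exp (-φ z) : ℂ) :=
    integrable_weight hφ.continuous (hf.continuous.mul (hcc.comp hDB)) hfc.mul_right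
  have i2 : Integrable fun z => f z * conj (wirt I (wirt (-I) (fun x => (φ x : ℂ)) w) v z * g z) *
      (Real.exp (-φ z) : ℂ) :=
    integrable_weight hφ.continuous
      (hf.continuous.mul (hcc.comp (hPP.mul hg.continuous))) hfc.mul_right
  have i3 : Integrable fun z => wirt I f w z * conj (wirt I g v z) * (Real.exp (-φ z) : ℂ) :=
    integrable_weight hφ.continuous
      (hBf.mul (hcc.comp hBg.continuous)) hfc.wirt.mul_right
  simp_rw [comm, add_mul]
  rw [integral_add i3 i2, ← neg_eq_iff_eq_neg.mpr key, ← sub_eq_neg_add, ← neg_sub,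
    ← integral_sub i1 i2]
  congr 1
  refine integral_congr_ae (Filter.Eventually.of_forall fun z => ?_)
  simp only [map_sub]
  ring

theorem sum_mul_conj_swap (a : Fin n → Fin n → ℂ) :
    (∑ j, ∑ k, a j k * conj (a k j)).re =
      ∑ j, ∑ k, ‖a j k‖ ^ 2 - 1 / 2 * ∑ j, ∑ k, ‖a j k - a k j‖ ^ 2 := by
  have h1 : ∑ j, ∑ k, ‖a k j‖ ^ 2 = ∑ j, ∑ k, ‖a j k‖ ^ 2 := Finset.sum_comm
  have h2 (j k : Fin n) : ‖a j k - a k j‖ ^ 2 =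
      ‖a j k‖ ^ 2 + ‖a k j‖ ^ 2 - 2 * (a j k * conj (a k j)).re := by
    rw [Complex.sq_norm, Complex.sq_norm, Complex.sq_norm, normSq_sub]
  simp_rw [h2, Finset.sum_sub_distrib, Finset.sum_add_distrib, h1, ← Finset.mul_sum, re_sum]
  ring

/-- The Kohn–Morrey–Hörmander inequality for compactly supported `(0,1)`-forms. -/
theorem kohn_morrey (hφ : ContDiff ℝ 2 φ) {α : Fin n → Cn n → ℂ} (hα : ∀ j, ContDiff ℝ 2 (α j))
    (hc : ∀ j, HasCompactSupport (α j)) :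
    ∫ z, LeviForm φ z (WithLp.toLp 2 fun j => α j z) * Real.exp (-φ z) ≤
      (∫ z, ‖∑ j, wderiv φ (α j) (e n j) z‖ ^ 2 * Real.exp (-φ z)) +
        ∫ z, (1 / 2 * ∑ j, ∑ k, ‖wirt I (α k) (e n j) z - wirt I (α j) (e n k) z‖ ^ 2) *
          Real.exp (-φ z) := by
  have hBc (j k : Fin n) : Continuous (wirt I (α j) (e n k)) := (hα j).continuous_wirt (by norm_num)
  have hDc (j : Fin n) : Continuous (wderiv φ (α j) (e n j)) :=
    (contDiff_wderiv (m := 1) hφ (hα j) (by norm_num)).continuous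
  have hPP (j k : Fin n) : Continuous (wirt I (wirt (-I) (fun x => (φ x : ℂ)) (e n k)) (e n j)) :=
    (hφ.ofReal_comp.wirt (m := 1) (by norm_num)).continuous_wirt (by norm_num)
  have hcc := continuous_conj
  have iA (j k : Fin n) : Integrable fun z =>
      wderiv φ (α j) (e n j) z * conj (wderiv φ (α k) (e n k) z) * (Real.exp (-φ z) : ℂ) :=
    integrable_weight hφ.continuous ((hDc j).mul (hcc.comp (hDc k)))
      (compact_wderiv (hc j)).mul_right
  have iB (j k : Fin n) : Integrable fun z =>
      wirt I (α j) (e n k) z * conj (wirt I (α k) (e n j) z) * (Real.exp (-φ z) : ℂ) :=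
    integrable_weight hφ.continuous ((hBc j k).mul (hcc.comp (hBc k j))) (hc j).wirt.mul_right
  have iC (j k : Fin n) : Integrable fun z => α j z * conj (
        wirt I (wirt (-I) (fun x => (φ x : ℂ)) (e n k)) (e n j) z * α k z) *
        (Real.exp (-φ z) : ℂ) :=
    integrable_weight hφ.continuous
      ((hα j).continuous.mul (hcc.comp ((hPP j k).mul (hα k).continuous))) (hc j).mul_right
  have hsum : ∫ z, (∑ j, ∑ k, wderiv φ (α j) (e n j) z * conj (wderiv φ (α k) (e n k) z)) *
        (Real.exp (-φ z) : ℂ) =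
      (∫ z, (∑ j, ∑ k, wirt I (α j) (e n k) z * conj (wirt I (α k) (e n j) z)) *
        (Real.exp (-φ z) : ℂ)) + ∫ z, (∑ j, ∑ k, α j z * conj (
        wirt I (wirt (-I) (fun x => (φ x : ℂ)) (e n k)) (e n j) z * α k z)) *
        (Real.exp (-φ z) : ℂ) := by
    simp_rw [Finset.sum_mul]
    rw [integral_finsetSum _ fun j _ => integrable_finsetSum _ fun k _ => iA j k,
      integral_finsetSum _ fun j _ => integrable_finsetSum _ fun k _ => iB j k,
      integral_finsetSum _ fun j _ => integrable_finsetSum _ fun k _ => iC j k,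
      ← Finset.sum_add_distrib]
    refine Finset.sum_congr rfl fun j _ => ?_
    rw [integral_finsetSum _ fun k _ => iA j k, integral_finsetSum _ fun k _ => iB j k,
      integral_finsetSum _ fun k _ => iC j k, ← Finset.sum_add_distrib]
    refine Finset.sum_congr rfl fun k _ => ?_
    rw [integral_wderiv_wderiv hφ (hα j) (hα k) (hc j) (hc k), ← integral_add (iB j k) (iC j k)]
    simp_rw [add_mul]
  have e1 : ∀ z, (∑ j, ∑ k, wderiv φ (α j) (e n j) z * conj (wderiv φ (α k) (e n k) z)) *
        (Real.exp (-φ z) : ℂ) =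
      ((‖∑ j, wderiv φ (α j) (e n j) z‖ ^ 2 * Real.exp (-φ z) : ℝ) : ℂ) := by
    intro z
    rw [← Finset.sum_mul_sum, ← map_sum, mul_conj, normSq_eq_norm_sq]
    push_cast; ring
  have e3 : ∀ z, (∑ j, ∑ k, α j z * conj (
        wirt I (wirt (-I) (fun x => (φ x : ℂ)) (e n k)) (e n j) z * α k z)) *
        (Real.exp (-φ z) : ℂ) =
      ((LeviForm φ z (WithLp.toLp 2 fun j => α j z) * Real.exp (-φ z) : ℝ) : ℂ) := by
    intro z
    have := congrArg conj (leviForm_eq_sum (z := z) hφ.contDiffAt (WithLp.toLp 2 fun j => α j z))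
    rw [conj_ofReal] at this
    rw [ofReal_mul, this]
    simp only [map_sum, map_mul, conj_conj]
    congr 1
    refine Finset.sum_congr rfl fun j _ => Finset.sum_congr rfl fun k _ => by ring
  have h := congrArg re hsum
  simp_rw [e1, e3] at h
  rw [integral_complex_ofReal, integral_complex_ofReal, add_re, ofReal_re, ofReal_re] at h
  rw [h]
  have iBs : Integrable fun z =>
      (∑ j, ∑ k, wirt I (α j) (e n k) z * conj (wirt I (α k) (e n j) z)) *
        (Real.exp (-φ z) : ℂ) := by
    simp_rw [Finset.sum_mul]
    exact integrable_finsetSum _ fun j _ => integrable_finsetSum _ fun k _ => iB j k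
  have h5 : (∫ z, (∑ j, ∑ k, wirt I (α j) (e n k) z * conj (wirt I (α k) (e n j) z)) *
        (Real.exp (-φ z) : ℂ)).re = ∫ z, ((∑ j, ∑ k, wirt I (α j) (e n k) z *
          conj (wirt I (α k) (e n j) z)) * (Real.exp (-φ z) : ℂ)).re := by
    exact (integral_re (𝕜 := ℂ) iBs).symm
  have i6 : Integrable fun z => (1 / 2 * ∑ j, ∑ k,
      ‖wirt I (α k) (e n j) z - wirt I (α j) (e n k) z‖ ^ 2) * Real.exp (-φ z) := by
    have hexp : Continuous fun z => Real.exp (-φ z) := by have := hφ.continuous; fun_prop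
    simp_rw [Finset.mul_sum, Finset.sum_mul]
    refine integrable_finsetSum _ fun j _ => integrable_finsetSum _ fun k _ => ?_
    refine Continuous.integrable_of_hasCompactSupport ?_ ?_
    · exact (continuous_const.mul (((hBc k j).sub (hBc j k)).norm.pow 2)).mul hexp
    · refine HasCompactSupport.mul_right (HasCompactSupport.mul_left ?_)
      exact ((hc k).wirt.sub (hc j).wirt).comp_left (g := fun x : ℂ => ‖x‖ ^ 2) (by simp)
  have h7 : 0 ≤ ∫ z, (((∑ j, ∑ k, wirt I (α j) (e n k) z *
          conj (wirt I (α k) (e n j) z)) * (Real.exp (-φ z) : ℂ)).re + (1 / 2 * ∑ j, ∑ k,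
      ‖wirt I (α k) (e n j) z - wirt I (α j) (e n k) z‖ ^ 2) * Real.exp (-φ z)) := by
    refine integral_nonneg fun z => ?_
    simp only [Pi.zero_apply]
    rw [re_mul_ofReal, ← add_mul, sum_mul_conj_swap fun j k => wirt I (α j) (e n k) z]
    refine mul_nonneg ?_ (Real.exp_nonneg _)
    have : ∑ j, ∑ k, ‖wirt I (α k) (e n j) z - wirt I (α j) (e n k) z‖ ^ 2 =
      ∑ j, ∑ k, ‖wirt I (α j) (e n k) z - wirt I (α k) (e n j) z‖ ^ 2 := by
      simp_rw [norm_sub_rev]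
    rw [this]
    simp only [sub_add_cancel]
    positivity
  have iBs' : Integrable fun z => ((∑ j, ∑ k, wirt I (α j) (e n k) z *
      conj (wirt I (α k) (e n j) z)) * (Real.exp (-φ z) : ℂ)).re := iBs.re
  rw [integral_add iBs' i6] at h7
  rw [h5]
  linarith [h7]

end KMH

section Mollifier

open Filter Topology
open scoped ENNReal

/-- A radial smooth bump supported in the closed ball of radius `ε`. -/
def radialBump (ε : ℝ) (x : Cn n) : ℝ := Real.smoothTransition (1 - ‖x‖ ^ 2 / ε ^ 2)

/-- The normalised radial bump. -/
def mollifier (ε : ℝ) (x : Cn n) : ℝ := (∫ y : Cn n, radialBump ε y)⁻¹ * radialBump ε x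

theorem contDiff_radialBump (ε : ℝ) {m : ℕ∞} : ContDiff ℝ m (radialBump ε : Cn n → ℝ) :=
  Real.smoothTransition.contDiff.comp
    (contDiff_const.sub ((contDiff_norm_sq ℂ).div_const _))

theorem radialBump_nonneg (ε : ℝ) (x : Cn n) : 0 ≤ radialBump ε x :=
  Real.smoothTransition.nonneg _

theorem radialBump_eq_zero {ε : ℝ} (hε : 0 < ε) {x : Cn n} (hx : ε ≤ ‖x‖) :
    radialBump ε x = 0 := by
  refine Real.smoothTransition.zero_of_nonpos ?_
  rw [sub_nonpos, one_le_div (by positivity)]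
  gcongr

theorem hasCompactSupport_radialBump {ε : ℝ} (hε : 0 < ε) :
    HasCompactSupport (radialBump ε : Cn n → ℝ) := by
  refine HasCompactSupport.intro (isCompact_closedBall 0 ε) fun x hx => ?_
  refine radialBump_eq_zero hε ?_
  rw [mem_closedBall_zero_iff, not_le] at hx
  exact hx.le

theorem integral_radialBump_pos {ε : ℝ} (hε : 0 < ε) : 0 < ∫ y : Cn n, radialBump ε y := by
  have hc : Continuous (radialBump ε : Cn n → ℝ) := (contDiff_radialBump ε (m := 0)).continuous
  refine hc.integral_pos_of_hasCompactSupport_nonneg_nonzero (hasCompactSupport_radialBump hε)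
    (radialBump_nonneg ε) (x := 0) ?_
  simp [radialBump, Real.smoothTransition.one]

theorem contDiff_mollifier (ε : ℝ) {m : ℕ∞} : ContDiff ℝ m (mollifier ε : Cn n → ℝ) :=
  contDiff_const.mul (contDiff_radialBump ε)

theorem continuous_mollifier (ε : ℝ) : Continuous (mollifier ε : Cn n → ℝ) :=
  (contDiff_mollifier ε (m := 0)).continuous

theorem mollifier_nonneg {ε : ℝ} (hε : 0 < ε) (x : Cn n) : 0 ≤ mollifier ε x :=
  mul_nonneg (inv_nonneg.2 (integral_radialBump_pos hε).le) (radialBump_nonneg ε x)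

theorem mollifier_eq_zero {ε : ℝ} (hε : 0 < ε) {x : Cn n} (hx : ε ≤ ‖x‖) :
    mollifier ε x = 0 := by
  rw [mollifier, radialBump_eq_zero hε hx, mul_zero]

theorem hasCompactSupport_mollifier {ε : ℝ} (hε : 0 < ε) :
    HasCompactSupport (mollifier ε : Cn n → ℝ) :=
  (hasCompactSupport_radialBump hε).mul_left

theorem integral_mollifier {ε : ℝ} (hε : 0 < ε) : ∫ x : Cn n, mollifier ε x = 1 := by
  simp only [mollifier]
  rw [integral_const_mul, inv_mul_cancel₀ (integral_radialBump_pos hε).ne']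

theorem integrable_mollifier {ε : ℝ} (hε : 0 < ε) : Integrable (mollifier ε : Cn n → ℝ) :=
  (continuous_mollifier ε).integrable_of_hasCompactSupport (hasCompactSupport_mollifier hε)

theorem mollifier_congr {ε : ℝ} {x y : Cn n} (h : ‖x‖ = ‖y‖) : mollifier ε x = mollifier ε y := by
  simp only [mollifier, radialBump, h]

/-- The mollifier as a complex-valued function. -/
def cmollifier (ε : ℝ) (x : Cn n) : ℂ := (mollifier ε x : ℂ)

theorem contDiff_cmollifier (ε : ℝ) {m : ℕ∞} : ContDiff ℝ m (cmollifier ε : Cn n → ℂ) :=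
  ofRealCLM.contDiff.comp (contDiff_mollifier ε)

theorem hasCompactSupport_cmollifier {ε : ℝ} (hε : 0 < ε) :
    HasCompactSupport (cmollifier ε : Cn n → ℂ) :=
  (hasCompactSupport_mollifier hε).comp_left (g := fun x : ℝ => (x : ℂ)) rfl

/-- Regularisation by convolution with the mollifier. -/
def regularize (ε : ℝ) (f : Cn n → ℂ) (x : Cn n) : ℂ := ∫ t, f t * cmollifier ε (x - t)

theorem regularize_eq_convolution (ε : ℝ) (f : Cn n → ℂ) :
    regularize ε f = convolution f (cmollifier ε) (ContinuousLinearMap.mul ℝ ℂ) volume := rfl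

variable {ε : ℝ} {f : Cn n → ℂ}

theorem contDiff_regularize (hε : 0 < ε) (hf : LocallyIntegrable f) :
    ContDiff ℝ 2 (regularize ε f) := by
  rw [regularize_eq_convolution]
  exact HasCompactSupport.contDiff_convolution_right (n := 2) _ (hasCompactSupport_cmollifier hε) hf
    (contDiff_cmollifier ε)

theorem integrable_mul_comp_sub {g : Cn n → ℂ} (hf : LocallyIntegrable f) (hg : Continuous g)
    (hgc : HasCompactSupport g) (x : Cn n) : Integrable fun t => f t * g (x - t) :=
  HasCompactSupport.convolutionExists_right (ContinuousLinearMap.mul ℝ ℂ) hgc hf hg x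


theorem wirt_regularize (hε : 0 < ε) (hf : LocallyIntegrable f) (s : ℂ) (w x : Cn n) :
    wirt s (regularize ε f) w x = ∫ t, f t * wirt s (cmollifier ε) w (x - t) := by
  have hd := (hasCompactSupport_cmollifier hε).hasFDerivAt_convolution_right
    (ContinuousLinearMap.mul ℝ ℂ) hf (contDiff_cmollifier ε (m := 1)) x
  have hdc : Continuous (fderiv ℝ (cmollifier ε : Cn n → ℂ)) :=
    (contDiff_cmollifier ε (m := 1)).continuous_fderiv (by norm_num)
  have hsc : HasCompactSupport (fderiv ℝ (cmollifier ε : Cn n → ℂ)) :=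
    (hasCompactSupport_cmollifier hε).fderiv (𝕜 := ℝ)
  have h1 (v : Cn n) : fderiv ℝ (regularize ε f) x v =
      ∫ t, f t * fderiv ℝ (cmollifier ε) (x - t) v := by
    rw [regularize_eq_convolution, hd.fderiv,
      convolution_precompR_apply (ContinuousLinearMap.mul ℝ ℂ) hf hsc hdc x v]
    rfl
  have h2 (v : Cn n) : Integrable fun t => f t * fderiv ℝ (cmollifier ε) (x - t) v := by
    refine integrable_mul_comp_sub (g := fun y => fderiv ℝ (cmollifier ε) y v) hf
      (hdc.clm_apply continuous_const) ?_ x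
    exact hsc.comp_left (g := fun L : Cn n →L[ℝ] ℂ => L v) (by simp)
  rw [wirt, h1, h1, ← integral_const_mul, ← integral_add (h2 w) ((h2 _).const_mul s),
    ← integral_const_mul]
  refine integral_congr_ae (ae_of_all _ fun t => ?_)
  simp only [wirt]
  ring

theorem isTest_cmollifier_sub (hε : 0 < ε) (x : Cn n) {Ω : Set (Cn n)} (h : closedBall x ε ⊆ Ω) :
    IsTest Ω fun t => cmollifier ε (x - t) := by
  have hz (t : Cn n) (ht : t ∉ closedBall x ε) : cmollifier ε (x - t) = 0 := by
    rw [cmollifier, mollifier_eq_zero hε, ofReal_zero]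
    rw [mem_closedBall, not_le, dist_comm, dist_eq_norm] at ht
    exact ht.le
  refine ⟨(contDiff_cmollifier ε (m := 2)).comp (contDiff_const.sub contDiff_id),
    HasCompactSupport.intro (isCompact_closedBall x ε) hz, ?_⟩
  refine (closure_minimal (fun t ht => ?_) isClosed_closedBall).trans h
  by_contra h'
  exact ht (hz t h')

theorem wirt_cmollifier_sub (s : ℂ) (w x t : Cn n) :
    wirt s (fun t => cmollifier ε (x - t)) w t = - wirt s (cmollifier ε) w (x - t) := by
  have h : HasFDerivAt (cmollifier ε : Cn n → ℂ) (fderiv ℝ (cmollifier ε) (x - t)) (x - t) :=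
    ((contDiff_cmollifier ε (m := 1)).differentiable (by norm_num) _).hasFDerivAt
  have h2 : HasFDerivAt (fun t => cmollifier ε (x - t))
      ((fderiv ℝ (cmollifier ε) (x - t)).comp (-ContinuousLinearMap.id ℝ (Cn n))) t :=
    h.comp t ((hasFDerivAt_id t).const_sub x)
  simp only [wirt, h2.fderiv, ContinuousLinearMap.comp_apply, neg_apply,
    ContinuousLinearMap.id_apply, map_neg]
  ring

theorem wirt_regularize_eq_neg (hε : 0 < ε) (hf : LocallyIntegrable f) (s : ℂ) (w x : Cn n) :
    wirt s (regularize ε f) w x = - ∫ t, f t * wirt s (fun t => cmollifier ε (x - t)) w t := by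
  rw [wirt_regularize hε hf, ← integral_neg]
  refine integral_congr_ae (ae_of_all _ fun t => ?_)
  simp only [wirt_cmollifier_sub]
  ring

theorem regularize_eq_zero (hε : 0 < ε) {K : Set (Cn n)} (hf : ∀ x ∉ K, f x = 0) {x : Cn n}
    (hx : x ∉ cthickening ε K) : regularize ε f x = 0 := by
  rw [regularize, ← integral_zero (Cn n) ℂ (μ := volume)]
  refine integral_congr_ae (ae_of_all _ fun t => ?_)
  by_cases ht : t ∈ K
  · have : ε ≤ ‖x - t‖ := by
      by_contra! h
      refine hx (mem_cthickening_of_dist_le x t ε K ht ?_)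
      rw [dist_eq_norm]
      exact h.le
    simp only [cmollifier, mollifier_eq_zero hε this, ofReal_zero, mul_zero]
  · simp only [hf t ht, zero_mul]

theorem hasCompactSupport_regularize (hε : 0 < ε) {K : Set (Cn n)} (hK : IsCompact K)
    (hf : ∀ x ∉ K, f x = 0) : HasCompactSupport (regularize ε f) :=
  HasCompactSupport.intro hK.cthickening fun _ hx => regularize_eq_zero hε hf hx

theorem exists_translate_le (hf : MemLp f 2) {η : ℝ≥0∞} (hη : η ≠ 0) :
    ∃ r > 0, ∀ y : Cn n, ‖y‖ < r → eLpNorm (fun x => f (x - y) - f x) 2 ≤ η := by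
  have hp : Fact ((2 : ℝ≥0∞) ≠ ∞) := ⟨by simp⟩
  have hc : Continuous fun y : Cn n =>
      (DomAddAct.mk (-y) +ᵥ hf.toLp : Lp ℂ 2 (volume : Measure (Cn n))) := by
    have : Continuous fun y : Cn n => DomAddAct.mk (-y) :=
      DomAddAct.continuous_mk.comp continuous_neg
    exact this.vadd continuous_const
  have h0 : ∀ᶠ y in 𝓝 (0 : Cn n), edist (DomAddAct.mk (M := Cn n) (-y) +ᵥ hf.toLp :
      Lp ℂ 2 (volume : Measure (Cn n))) hf.toLp < η := by
    have := hc.tendsto 0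
    have hm : DomAddAct.mk (-(0 : Cn n)) = 0 := by simp
    rw [hm, zero_vadd] at this
    exact this (Metric.eball_mem_nhds _ (pos_iff_ne_zero.2 hη))
  obtain ⟨r, hr, h⟩ := Metric.eventually_nhds_iff.1 h0
  refine ⟨r, hr, fun y hy => ?_⟩
  have := (h (y := y) (by simpa using hy)).le
  rw [DomAddAct.mk_vadd_toLp, Lp.edist_toLp_toLp] at this
  refine le_trans (le_of_eq ?_) this
  refine eLpNorm_congr_ae (ae_of_all _ fun x => ?_)
  simp [sub_eq_neg_add]

theorem regularize_eq_integral_comp_sub (ε : ℝ) (f : Cn n → ℂ) (x : Cn n) :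
    regularize ε f x = ∫ y, f (x - y) * cmollifier ε y := by
  rw [← integral_sub_left_eq_self (fun y => f (x - y) * cmollifier ε y) volume x]
  simp only [regularize, sub_sub_cancel]

theorem eLpNorm_sq_eq (g : Cn n → ℂ) (μ : Measure (Cn n)) :
    eLpNorm g 2 μ ^ 2 = ∫⁻ y, ‖g y‖ₑ ^ 2 ∂μ := by
  have := eLpNorm_nnreal_pow_eq_lintegral (f := g) (μ := μ) (p := 2) (by norm_num)
  have h2 : ((2 : NNReal) : ℝ) = 2 := rfl
  have h3 : ((2 : NNReal) : ℝ≥0∞) = 2 := rfl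
  simpa only [h2, h3, ENNReal.rpow_two] using this

theorem enorm_regularize_sub_le (hε : 0 < ε) (hf : LocallyIntegrable f) (hm : StronglyMeasurable f)
    (x : Cn n) :
    ‖regularize ε f x - f x‖ₑ ^ 2 ≤
      ∫⁻ y, ENNReal.ofReal (mollifier ε y) * ‖f (x - y) - f x‖ₑ ^ 2 := by
  have hd : Measurable fun y : Cn n => ENNReal.ofReal (mollifier ε y) :=
    (continuous_mollifier ε).measurable.ennreal_ofReal
  set μ : Measure (Cn n) := volume.withDensity fun y => ENNReal.ofReal (mollifier ε y) with hμ
  have hprob : IsProbabilityMeasure μ := by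
    refine ⟨?_⟩
    rw [hμ, withDensity_apply _ MeasurableSet.univ, Measure.restrict_univ,
      ← ofReal_integral_eq_lintegral_ofReal (integrable_mollifier hε)
      (ae_of_all _ (mollifier_nonneg hε)), integral_mollifier hε, ENNReal.ofReal_one]
  have hcm : ∫ y : Cn n, cmollifier ε y = 1 := by
    simp only [cmollifier]
    rw [integral_complex_ofReal, integral_mollifier hε, ofReal_one]
  have hic : Integrable (cmollifier ε : Cn n → ℂ) := (integrable_mollifier hε).ofReal
  have hi : Integrable fun y => f (x - y) * cmollifier ε y := by
    have := (integrable_mul_comp_sub hf (contDiff_cmollifier ε (m := 0)).continuous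
      (hasCompactSupport_cmollifier hε) x).comp_sub_left x
    simpa only [sub_sub_cancel] using this
  have h1 : regularize ε f x - f x = ∫ y, (f (x - y) - f x) * cmollifier ε y := by
    simp_rw [sub_mul]
    rw [integral_sub hi (hic.const_mul _), integral_const_mul, hcm, mul_one,
      regularize_eq_integral_comp_sub]
  have hfm : Measurable fun y => f (x - y) - f x := by
    have := hm.measurable
    fun_prop
  have h2 : ‖regularize ε f x - f x‖ₑ ≤ eLpNorm (fun y => f (x - y) - f x) 2 μ := by
    refine le_trans ?_ (eLpNorm_le_eLpNorm_of_exponent_le (p := 1) (by norm_num)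
      hfm.aestronglyMeasurable)
    rw [h1, eLpNorm_one_eq_lintegral_enorm, hμ,
      lintegral_withDensity_eq_lintegral_mul _ hd hfm.enorm]
    refine (enorm_integral_le_lintegral_enorm _).trans (le_of_eq ?_)
    refine lintegral_congr fun y => ?_
    rw [enorm_mul, mul_comm, Pi.mul_apply, cmollifier]
    congr 1
    rw [← ofReal_norm, norm_real, Real.norm_of_nonneg (mollifier_nonneg hε y)]
  calc ‖regularize ε f x - f x‖ₑ ^ 2 ≤ eLpNorm (fun y => f (x - y) - f x) 2 μ ^ 2 := by gcongr
    _ = ∫⁻ y, ‖f (x - y) - f x‖ₑ ^ 2 ∂μ := eLpNorm_sq_eq _ _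
    _ = _ := by
      rw [hμ, lintegral_withDensity_eq_lintegral_mul _ hd (hfm.enorm.pow_const 2)]
      rfl

theorem eLpNorm_regularize_sub_le (hε : 0 < ε) (hf : MemLp f 2) {η : ℝ≥0∞}
    (h : ∀ y : Cn n, ‖y‖ < ε → eLpNorm (fun x => f (x - y) - f x) 2 ≤ η) :
    eLpNorm (fun x => regularize ε f x - f x) 2 ≤ η := by
  obtain ⟨g, hgm, hfg⟩ := hf.1
  have hg : MemLp g 2 := (memLp_congr_ae hfg).1 hf
  have hr : regularize ε f = regularize ε g := by
    ext x
    refine integral_congr_ae ?_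
    filter_upwards [hfg] with t ht
    rw [ht]
  have h' (y : Cn n) (hy : ‖y‖ < ε) : eLpNorm (fun x => g (x - y) - g x) 2 ≤ η := by
    refine le_trans (le_of_eq (eLpNorm_congr_ae ?_)) (h y hy)
    have := (measurePreserving_sub_right (volume : Measure (Cn n)) y).quasiMeasurePreserving.ae_eq_comp hfg
    filter_upwards [this, hfg] with x hx hx'
    simp only [Function.comp_apply] at hx
    rw [hx, hx']
  have e : eLpNorm (fun x => regularize ε f x - f x) 2 =
      eLpNorm (fun x => regularize ε g x - g x) 2 := by
    refine eLpNorm_congr_ae ?_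
    filter_upwards [hfg] with x hx
    rw [hr, hx]
  rw [e, ← ENNReal.pow_le_pow_left_iff (two_ne_zero), eLpNorm_sq_eq]
  have hgl : LocallyIntegrable g := hg.locallyIntegrable (by norm_num)
  have hgM := hgm.measurable
  have hmol := (continuous_mollifier (n := n) ε).measurable
  calc ∫⁻ x, ‖regularize ε g x - g x‖ₑ ^ 2
      ≤ ∫⁻ x, ∫⁻ y, ENNReal.ofReal (mollifier ε y) * ‖g (x - y) - g x‖ₑ ^ 2 :=
        lintegral_mono fun x => enorm_regularize_sub_le hε hgl hgm x
    _ = ∫⁻ y, ∫⁻ x, ENNReal.ofReal (mollifier ε y) * ‖g (x - y) - g x‖ₑ ^ 2 := by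
        refine lintegral_lintegral_swap ?_
        refine Measurable.aemeasurable ?_
        simp only [Function.uncurry_def]
        fun_prop
    _ ≤ ∫⁻ y : Cn n, ENNReal.ofReal (mollifier ε y) * η ^ 2 := by
        refine lintegral_mono fun y => ?_
        simp only
        rw [lintegral_const_mul _ (by fun_prop)]
        rcases lt_or_ge ‖y‖ ε with hy | hy
        · rw [← eLpNorm_sq_eq (fun x => g (x - y) - g x)]
          gcongr
          exact h' y hy
        · simp [mollifier_eq_zero hε hy]
    _ = η ^ 2 := by
        rw [lintegral_mul_const _ (by fun_prop),
          ← ofReal_integral_eq_lintegral_ofReal (integrable_mollifier hε)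
          (ae_of_all _ (mollifier_nonneg hε)), integral_mollifier hε, ENNReal.ofReal_one, one_mul]

theorem tendsto_regularize (hf : MemLp f 2) {r : ℕ → ℝ} (hr : ∀ m, 0 < r m)
    (hr0 : Tendsto r atTop (𝓝 0)) :
    Tendsto (fun m => eLpNorm (fun x => regularize (r m) f x - f x) 2) atTop (𝓝 0) := by
  rw [ENNReal.tendsto_nhds_zero]
  intro η hη
  obtain ⟨ρ, hρ, h⟩ := exists_translate_le hf hη.ne'
  filter_upwards [hr0.eventually (gt_mem_nhds hρ)] with m hm
  exact eLpNorm_regularize_sub_le (hr m) hf fun y hy => h y (hy.trans hm)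

end Mollifier

section L2Tendsto

open Filter Topology
open scoped ENNReal

theorem integral_norm_sq {μ : Measure (Cn n)} {g : Cn n → ℂ} (hg : AEStronglyMeasurable g μ) :
    ∫ x, ‖g x‖ ^ 2 ∂μ = (eLpNorm g 2 μ).toReal ^ 2 := by
  have hm : AEStronglyMeasurable (fun x => ‖g x‖ ^ 2) μ := hg.norm.pow 2
  rw [integral_eq_lintegral_of_nonneg_ae (ae_of_all _ fun x => by positivity) hm,
    ← ENNReal.toReal_pow, eLpNorm_sq_eq]
  congr 1
  refine lintegral_congr fun x => ?_
  rw [ENNReal.ofReal_pow (norm_nonneg _), ofReal_norm]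

/-- Convergence in the unweighted `L²` sense. -/
structure L2Tendsto (F : ℕ → Cn n → ℂ) (f : Cn n → ℂ) : Prop where
  memLp : ∀ m, MemLp (F m) 2
  limit : MemLp f 2
  tendsto : Tendsto (fun m => eLpNorm (fun x => F m x - f x) 2) atTop (𝓝 0)

variable {F G : ℕ → Cn n → ℂ} {f g : Cn n → ℂ}

theorem memLp_mul_of_bounded {b : Cn n → ℂ} (hb : Continuous b) {C : ℝ} (hC : ∀ x, ‖b x‖ ≤ C)
    (hf : MemLp f 2) : MemLp (fun x => b x * f x) 2 := by
  refine MemLp.of_le_mul (c := C) hf (hb.aestronglyMeasurable.mul hf.1) (ae_of_all _ fun x => ?_)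
  rw [norm_mul]
  exact mul_le_mul_of_nonneg_right (hC x) (norm_nonneg _)

namespace L2Tendsto

theorem sub (hF : L2Tendsto F f) (hG : L2Tendsto G g) :
    L2Tendsto (fun m x => F m x - G m x) (fun x => f x - g x) := by
  refine ⟨fun m => (hF.memLp m).sub (hG.memLp m), hF.limit.sub hG.limit, ?_⟩
  refine tendsto_of_tendsto_of_tendsto_of_le_of_le tendsto_const_nhds
    (by simpa using hF.tendsto.add hG.tendsto) (fun m => bot_le) fun m => ?_
  refine le_trans (le_of_eq ?_) (eLpNorm_sub_le ((hF.memLp m).sub hF.limit).1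
    ((hG.memLp m).sub hG.limit).1 (by norm_num))
  congr 1
  ext x
  simp only [Pi.sub_apply]
  ring

theorem zero : L2Tendsto (fun _ (_ : Cn n) => 0) (fun _ => 0) :=
  ⟨fun _ => MemLp.zero', MemLp.zero', by simp⟩

theorem add (hF : L2Tendsto F f) (hG : L2Tendsto G g) :
    L2Tendsto (fun m x => F m x + G m x) (fun x => f x + g x) := by
  have := hF.sub (zero.sub hG)
  simpa only [zero_sub, sub_neg_eq_add] using this

theorem sum {ι : Type*} (A : Finset ι) {F : ι → ℕ → Cn n → ℂ} {f : ι → Cn n → ℂ}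
    (h : ∀ i ∈ A, L2Tendsto (F i) (f i)) :
    L2Tendsto (fun m x => ∑ i ∈ A, F i m x) (fun x => ∑ i ∈ A, f i x) := by
  classical
  induction A using Finset.induction_on with
  | empty => simpa using zero
  | insert i A hi ih =>
    simp only [Finset.sum_insert hi]
    exact (h i (Finset.mem_insert_self _ _)).add
      (ih fun j hj => h j (Finset.mem_insert_of_mem hj))

theorem mul_left {b : Cn n → ℂ} (hb : Continuous b) {C : ℝ} (hC : ∀ x, ‖b x‖ ≤ C)
    (hF : L2Tendsto F f) : L2Tendsto (fun m x => b x * F m x) (fun x => b x * f x) := by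
  refine ⟨fun m => memLp_mul_of_bounded hb hC (hF.memLp m), memLp_mul_of_bounded hb hC hF.limit, ?_⟩
  have h0 : Tendsto (fun m => ENNReal.ofReal C * eLpNorm (fun x => F m x - f x) 2) atTop (𝓝 0) := by
    have := ENNReal.Tendsto.const_mul (a := ENNReal.ofReal C) hF.tendsto (Or.inr ENNReal.ofReal_ne_top)
    simpa using this
  refine tendsto_of_tendsto_of_tendsto_of_le_of_le tendsto_const_nhds h0 (fun m => bot_le)
    fun m => ?_
  refine eLpNorm_le_mul_eLpNorm_of_ae_le_mul (ae_of_all _ fun x => ?_) 2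
  rw [← mul_sub, norm_mul]
  exact mul_le_mul_of_nonneg_right (hC x) (norm_nonneg _)

theorem integral_sq (hF : L2Tendsto F f) :
    Tendsto (fun m => ∫ x, ‖F m x‖ ^ 2) atTop (𝓝 (∫ x, ‖f x‖ ^ 2)) := by
  have key {g : Cn n → ℂ} (hg : MemLp g 2) : ∫ x, ‖g x‖ ^ 2 = ‖hg.toLp‖ ^ 2 := by
    rw [Lp.norm_toLp, integral_norm_sq hg.1]
  have h1 : Tendsto (fun m => (hF.memLp m).toLp) atTop (𝓝 hF.limit.toLp) :=
    (Lp.tendsto_Lp_iff_tendsto_eLpNorm'' _ hF.memLp _ hF.limit).2 hF.tendsto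
  simp_rw [fun m => key (hF.memLp m), key hF.limit]
  exact h1.norm.pow 2

theorem integral_sq_mul (hF : L2Tendsto F f) {w : Cn n → ℝ} (hw : Continuous w)
    (hw0 : ∀ x, 0 ≤ w x) {C : ℝ} (hC : ∀ x, w x ≤ C) :
    Tendsto (fun m => ∫ x, ‖F m x‖ ^ 2 * w x) atTop (𝓝 (∫ x, ‖f x‖ ^ 2 * w x)) := by
  have h := (hF.mul_left (b := fun x => (Real.sqrt (w x) : ℂ))
    (continuous_ofReal.comp (Real.continuous_sqrt.comp hw)) (C := Real.sqrt C) fun x => by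
      rw [norm_real, Real.norm_of_nonneg (Real.sqrt_nonneg _)]
      exact Real.sqrt_le_sqrt (hC x)).integral_sq
  have e (z : ℂ) (x : Cn n) : ‖(Real.sqrt (w x) : ℂ) * z‖ ^ 2 = ‖z‖ ^ 2 * w x := by
    rw [norm_mul, mul_pow, norm_real, Real.norm_of_nonneg (Real.sqrt_nonneg _),
      Real.sq_sqrt (hw0 x), mul_comm]
  simpa only [e] using h

end L2Tendsto

end L2Tendsto

section WeakKMH

open Filter Topology
open scoped ENNReal

theorem integrable_of_zero_off {g : Cn n → ℝ} (hg : Continuous g) {K : Set (Cn n)}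
    (hK : IsCompact K) (h : ∀ z ∉ K, g z = 0) : Integrable g :=
  hg.integrable_of_hasCompactSupport (HasCompactSupport.intro hK h)

theorem norm_sum_mul_sq_le (a b : Fin n → ℂ) :
    ‖∑ j, a j * b j‖ ^ 2 ≤ (∑ j, ‖a j‖ ^ 2) * ∑ j, ‖b j‖ ^ 2 := by
  calc ‖∑ j, a j * b j‖ ^ 2 ≤ (∑ j, ‖a j‖ * ‖b j‖) ^ 2 := by
        gcongr
        exact (norm_sum_le _ _).trans (le_of_eq (by simp_rw [norm_mul]))
    _ ≤ _ := Finset.sum_mul_sq_le_sq_mul_sq _ _ _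

theorem norm_sub_sq_le (x y : ℂ) : ‖x - y‖ ^ 2 ≤ 2 * ‖x‖ ^ 2 + 2 * ‖y‖ ^ 2 := by
  have := norm_sub_le x y
  nlinarith [norm_nonneg (x - y), norm_nonneg x, norm_nonneg y, sq_nonneg (‖x‖ - ‖y‖)]

theorem continuous_leviForm {ϕ : Cn n → ℝ} (hϕ : ContDiff ℝ 2 ϕ) {α : Fin n → Cn n → ℂ}
    (hα : ∀ j, Continuous (α j)) :
    Continuous fun z => LeviForm ϕ z (WithLp.toLp 2 fun j => α j z) := by
  have h1 : Continuous fun z => (WithLp.toLp 2 fun j => α j z : Cn n) :=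
    (PiLp.continuous_toLp 2 _).comp (continuous_pi hα)
  have h2 : Continuous (fderiv ℝ (fderiv ℝ ϕ)) :=
    (hϕ.fderiv_right (m := 1) (by norm_num)).continuous_fderiv (by norm_num)
  have h3 : Continuous fun z => I • (WithLp.toLp 2 fun j => α j z : Cn n) := h1.const_smul I
  unfold LeviForm
  exact continuous_const.mul (((h2.clm_apply h1).clm_apply h1).add
    ((h2.clm_apply h3).clm_apply h3))

variable {ϕ ψ : Cn n → ℝ} {U : Set (Cn n)} {c : ℝ}

theorem smooth_basic_estimate (hϕ : ContDiff ℝ 2 ϕ) (hψ : ContDiff ℝ 2 ψ)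
    (hL : ∀ z ∈ U, ∀ w, (c * Real.exp (ψ z) +
      2 * ∑ j, ‖wirt (-I) (fun x => (ψ x : ℂ)) (e n j) z‖ ^ 2) * ‖w‖ ^ 2 ≤ LeviForm ϕ z w)
    {α : Fin n → Cn n → ℂ} (hα : ∀ j, ContDiff ℝ 2 (α j)) (hc : ∀ j, HasCompactSupport (α j))
    (hU : ∀ j, ∀ z ∉ U, α j z = 0) :
    c * ∫ z, ∑ j, ‖α j z‖ ^ 2 * Real.exp (ψ z - ϕ z) ≤
      2 * (∫ z, ‖∑ j, wirt (-I) (α j) (e n j) z -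
        ∑ j, wirt (-I) (fun x => ((ϕ x - ψ x : ℝ) : ℂ)) (e n j) z * α j z‖ ^ 2 *
          Real.exp (-ϕ z)) +
        ∫ z, (1 / 2 * ∑ j, ∑ k, ‖wirt I (α k) (e n j) z - wirt I (α j) (e n k) z‖ ^ 2) *
          Real.exp (-ϕ z) := by
  set K : Set (Cn n) := ⋃ j, tsupport (α j) with hKdef
  have hK : IsCompact K := isCompact_iUnion fun j => hc j
  have hα0 (j : Fin n) (z : Cn n) (hz : z ∉ K) : α j z = 0 :=
    image_eq_zero_of_notMem_tsupport fun h => hz (mem_iUnion.2 ⟨j, h⟩)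
  have hw0 (j : Fin n) (s : ℂ) (w z : Cn n) (hz : z ∉ K) : wirt s (α j) w z = 0 :=
    wirt_eq_zero_of_notMem fun h => hz (mem_iUnion.2 ⟨j, h⟩)
  have cα (j : Fin n) : Continuous (α j) := (hα j).continuous
  have cw (j : Fin n) (s : ℂ) (w : Cn n) : Continuous (wirt s (α j) w) :=
    (hα j).continuous_wirt (by norm_num)
  have cψ (j : Fin n) : Continuous (wirt (-I) (fun x => (ψ x : ℂ)) (e n j)) :=
    hψ.ofReal_comp.continuous_wirt (by norm_num)
  have cϕψ (j : Fin n) : Continuous (wirt (-I) (fun x => ((ϕ x - ψ x : ℝ) : ℂ)) (e n j)) :=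
    (hϕ.sub hψ).ofReal_comp.continuous_wirt (by norm_num)
  have c1 : Continuous fun z => Real.exp (-ϕ z) := by have := hϕ.continuous; fun_prop
  have c2 : Continuous fun z => Real.exp (ψ z - ϕ z) := by
    have := hϕ.continuous; have := hψ.continuous; fun_prop
  have cv (j : Fin n) : Continuous (wderiv ϕ (α j) (e n j)) :=
    (contDiff_wderiv (m := 1) hϕ (hα j) (by norm_num)).continuous
  set P : Cn n → ℝ := fun z => ∑ j, ‖wirt (-I) (fun x => (ψ x : ℂ)) (e n j) z‖ ^ 2 with hP
  set A : Cn n → ℝ := fun z => ∑ j, ‖α j z‖ ^ 2 with hA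
  set X : Cn n → ℂ := fun z => ∑ j, wirt (-I) (α j) (e n j) z -
        ∑ j, wirt (-I) (fun x => ((ϕ x - ψ x : ℝ) : ℂ)) (e n j) z * α j z with hX
  have cP : Continuous P := by fun_prop
  have cA : Continuous A := by fun_prop
  have cX : Continuous X := by fun_prop
  have hA0 (z : Cn n) (hz : z ∉ K) : A z = 0 := by simp [hA, hα0 _ z hz]
  have hX0 (z : Cn n) (hz : z ∉ K) : X z = 0 := by simp [hX, hα0 _ z hz, hw0 _ _ _ z hz]
  have hAn (z : Cn n) : A z = ‖(WithLp.toLp 2 fun j => α j z : Cn n)‖ ^ 2 := by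
    rw [EuclideanSpace.norm_sq_eq]
  have iA : Integrable fun z => c * (A z * Real.exp (ψ z - ϕ z)) :=
    integrable_of_zero_off (by fun_prop) hK fun z hz => by simp [hA0 z hz]
  have iPA : Integrable fun z => 2 * (P z * A z) * Real.exp (-ϕ z) :=
    integrable_of_zero_off (by fun_prop) hK fun z hz => by simp [hA0 z hz]
  have iX : Integrable fun z => 2 * (‖X z‖ ^ 2 * Real.exp (-ϕ z)) :=
    integrable_of_zero_off (by fun_prop) hK fun z hz => by simp [hX0 z hz]
  have iL : Integrable fun z => LeviForm ϕ z (WithLp.toLp 2 fun j => α j z) * Real.exp (-ϕ z) := by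
    refine integrable_of_zero_off ((continuous_leviForm hϕ cα).mul c1) hK fun z hz => ?_
    have : (WithLp.toLp 2 fun j => α j z : Cn n) = 0 := by
      ext j
      simp [hα0 j z hz]
    rw [this]
    simp [LeviForm]
  have iD : Integrable fun z => ‖∑ j, wderiv ϕ (α j) (e n j) z‖ ^ 2 * Real.exp (-ϕ z) := by
    refine integrable_of_zero_off (by fun_prop) hK fun z hz => ?_
    simp [wderiv, hw0 _ _ _ z hz, hα0 _ z hz]
  have h1 : (∫ z, c * (A z * Real.exp (ψ z - ϕ z))) + ∫ z, 2 * (P z * A z) * Real.exp (-ϕ z) ≤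
      ∫ z, LeviForm ϕ z (WithLp.toLp 2 fun j => α j z) * Real.exp (-ϕ z) := by
    rw [← integral_add iA iPA]
    refine integral_mono (iA.add iPA) iL fun z => ?_
    simp only
    by_cases hz : z ∈ U
    · have h := mul_le_mul_of_nonneg_right (hL z hz (WithLp.toLp 2 fun j => α j z))
        (Real.exp_nonneg (-ϕ z))
      rw [← hAn] at h
      refine le_trans (le_of_eq ?_) h
      rw [sub_eq_add_neg, Real.exp_add]
      ring
    · have h0 : A z = 0 := by simp [hA, hU _ z hz]
      have : (WithLp.toLp 2 fun j => α j z : Cn n) = 0 := by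
        ext j
        simp [hU j z hz]
      rw [this, h0]
      simp [LeviForm]
  have h2 : (∫ z, ‖∑ j, wderiv ϕ (α j) (e n j) z‖ ^ 2 * Real.exp (-ϕ z)) ≤
      (∫ z, 2 * (‖X z‖ ^ 2 * Real.exp (-ϕ z))) + ∫ z, 2 * (P z * A z) * Real.exp (-ϕ z) := by
    rw [← integral_add iX iPA]
    refine integral_mono iD (iX.add iPA) fun z => ?_
    simp only
    have e1 : ∑ j, wderiv ϕ (α j) (e n j) z =
        X z - ∑ j, wirt (-I) (fun x => (ψ x : ℂ)) (e n j) z * α j z := by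
      simp only [hX, wderiv, ← Finset.sum_sub_distrib]
      refine Finset.sum_congr rfl fun j _ => ?_
      have e2 : wirt (-I) (fun x => ((ϕ x - ψ x : ℝ) : ℂ)) (e n j) z =
          wirt (-I) (fun x => (ϕ x : ℂ)) (e n j) z - wirt (-I) (fun x => (ψ x : ℂ)) (e n j) z := by
        simp_rw [ofReal_sub]
        exact wirt_sub (hϕ.ofReal_comp.differentiable (by norm_num) z)
          (hψ.ofReal_comp.differentiable (by norm_num) z)
      rw [e2]
      ring
    have h3 := norm_sub_sq_le (X z) (∑ j, wirt (-I) (fun x => (ψ x : ℂ)) (e n j) z * α j z)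
    have h4 := norm_sum_mul_sq_le (fun j => wirt (-I) (fun x => (ψ x : ℂ)) (e n j) z)
      fun j => α j z
    rw [e1]
    have h5 := mul_le_mul_of_nonneg_right (h3.trans (add_le_add_right
      (mul_le_mul_of_nonneg_left h4 zero_le_two) _)) (Real.exp_nonneg (-ϕ z))
    refine h5.trans (le_of_eq ?_)
    simp only [hP, hA]
    ring
  have h3 := kohn_morrey hϕ hα hc
  rw [integral_const_mul] at h1 h2
  have e3 : ∫ z, ∑ j, ‖α j z‖ ^ 2 * Real.exp (ψ z - ϕ z) = ∫ z, A z * Real.exp (ψ z - ϕ z) := by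
    simp only [hA, Finset.sum_mul]
  rw [e3]
  linarith

theorem l2Tendsto_regularize {f : Cn n → ℂ} (hf : MemLp f 2) {K : Set (Cn n)} (hK : IsCompact K)
    (h0 : ∀ z ∉ K, f z = 0) {r : ℕ → ℝ} (hr : ∀ m, 0 < r m) (hr0 : Tendsto r atTop (𝓝 0)) :
    L2Tendsto (fun m => regularize (r m) f) f :=
  ⟨fun m => ((contDiff_regularize (hr m) (hf.locallyIntegrable (by norm_num))).continuous).memLp_of_hasCompactSupport
    (hasCompactSupport_regularize (hr m) hK h0), hf, tendsto_regularize hf hr hr0⟩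

theorem exists_bound_exp {g : Cn n → ℝ} (hg : Continuous g) (hc : HasCompactSupport g) :
    ∃ C, ∀ x, Real.exp (g x) ≤ C := by
  obtain ⟨C, hC⟩ := hc.exists_bound_of_continuous hg
  exact ⟨Real.exp C, fun x => Real.exp_le_exp.2 ((le_abs_self _).trans (hC x))⟩

theorem weak_basic_estimate (hϕ : ContDiff ℝ 2 ϕ) (hψ : ContDiff ℝ 2 ψ)
    (hϕc : HasCompactSupport ϕ) (hψc : HasCompactSupport ψ) (hU : IsOpen U)
    (hL : ∀ z ∈ U, ∀ w, (c * Real.exp (ψ z) +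
      2 * ∑ j, ‖wirt (-I) (fun x => (ψ x : ℂ)) (e n j) z‖ ^ 2) * ‖w‖ ^ 2 ≤ LeviForm ϕ z w)
    {K : Set (Cn n)} (hK : IsCompact K) (hKU : K ⊆ U)
    {a : Fin n → Cn n → ℂ} {d : Cn n → ℂ} {s : Fin n → Fin n → Cn n → ℂ}
    (ha : ∀ j, MemLp (a j) 2) (hd : MemLp d 2) (hs : ∀ j k, MemLp (s j k) 2)
    (ha0 : ∀ j, ∀ z ∉ K, a j z = 0) (hd0 : ∀ z ∉ K, d z = 0)
    (hs0 : ∀ j k, ∀ z ∉ K, s j k z = 0)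
    (hdiv : ∀ q, IsTest univ q →
      ∫ z, ∑ j, a j z * wirt (-I) q (e n j) z = -∫ z, d z * q z)
    (hcurl : ∀ q, IsTest univ q → ∀ j k,
      ∫ z, (a k z * wirt I q (e n j) z - a j z * wirt I q (e n k) z) = -∫ z, s j k z * q z) :
    c * ∑ j, ∫ z, ‖a j z‖ ^ 2 * Real.exp (ψ z - ϕ z) ≤
      2 * (∫ z, ‖d z - ∑ j, wirt (-I) (fun x => ((ϕ x - ψ x : ℝ) : ℂ)) (e n j) z * a j z‖ ^ 2 *
          Real.exp (-ϕ z)) +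
        1 / 2 * ∑ j, ∑ k, ∫ z, ‖s j k z‖ ^ 2 * Real.exp (-ϕ z) := by
  obtain ⟨r₀, hr₀, hrU⟩ := hK.exists_cthickening_subset_open hU hKU
  set r : ℕ → ℝ := fun m => r₀ / (m + 1) with hrdef
  have hr (m : ℕ) : 0 < r m := by positivity
  have hr1 (m : ℕ) : r m ≤ r₀ := div_le_self hr₀.le (by simp)
  have hr0 : Tendsto r atTop (𝓝 0) :=
    (tendsto_const_div_atTop_nhds_zero_nat r₀).comp (tendsto_add_atTop_nat 1) |>.congr
      fun m => by simp [hrdef]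
  have hal (j : Fin n) : LocallyIntegrable (a j) := (ha j).locallyIntegrable (by norm_num)
  have hdl : LocallyIntegrable d := hd.locallyIntegrable (by norm_num)
  have hsl (j k : Fin n) : LocallyIntegrable (s j k) := (hs j k).locallyIntegrable (by norm_num)
  set α : ℕ → Fin n → Cn n → ℂ := fun m j => regularize (r m) (a j) with hα
  have αC (m : ℕ) (j : Fin n) : ContDiff ℝ 2 (α m j) := contDiff_regularize (hr m) (hal j)
  have αc (m : ℕ) (j : Fin n) : HasCompactSupport (α m j) :=
    hasCompactSupport_regularize (hr m) hK (ha0 j)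
  have iq (f : Cn n → ℂ) (hf : LocallyIntegrable f) (m : ℕ) (x w : Cn n) (t : ℂ) :
      Integrable fun z => f z * wirt t (fun y => cmollifier (r m) (x - y)) w z := by
    have hT := isTest_cmollifier_sub (hr m) x (subset_univ _)
    exact hf.integrable_smul_left_of_hasCompactSupport (hT.continuous_wirt (s := t) (w := w))
      hT.compact_wirt |>.congr (ae_of_all _ fun z => by simp [mul_comm])
  have hD (m : ℕ) (x : Cn n) : ∑ j, wirt (-I) (α m j) (e n j) x = regularize (r m) d x := by
    have hT := isTest_cmollifier_sub (hr m) x (subset_univ _)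
    have h1 := hdiv _ hT
    rw [integral_finsetSum _ fun j _ => iq (a j) (hal j) m x _ _] at h1
    simp only [hα, wirt_regularize_eq_neg (hr m) (hal _), Finset.sum_neg_distrib, h1, neg_neg]
    rfl
  have hS (m : ℕ) (j k : Fin n) (x : Cn n) : wirt I (α m k) (e n j) x - wirt I (α m j) (e n k) x =
      regularize (r m) (s j k) x := by
    have hT := isTest_cmollifier_sub (hr m) x (subset_univ _)
    have h1 := hcurl _ hT j k
    rw [integral_sub (iq (a k) (hal k) m x _ _) (iq (a j) (hal j) m x _ _)] at h1
    simp only [hα, wirt_regularize_eq_neg (hr m) (hal _)]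
    have h2 : ∫ z, s j k z * cmollifier (r m) (x - z) = regularize (r m) (s j k) x := rfl
    rw [← h2]
    linear_combination -h1
  have est (m : ℕ) := smooth_basic_estimate (c := c) hϕ hψ hL (αC m) (αc m) fun j z hz =>
    regularize_eq_zero (hr m) (ha0 j) fun h => hz (hrU (cthickening_mono (hr1 m) K h))
  obtain ⟨C₁, hC₁⟩ := exists_bound_exp (hψ.continuous.sub hϕ.continuous) (hψc.sub hϕc)
  obtain ⟨C₂, hC₂⟩ := exists_bound_exp (hϕ.continuous.neg) (hϕc.neg)
  have w1 : Continuous fun z => Real.exp (ψ z - ϕ z) :=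
    Real.continuous_exp.comp (hψ.continuous.sub hϕ.continuous)
  have w2 : Continuous fun z => Real.exp (-ϕ z) := Real.continuous_exp.comp hϕ.continuous.neg
  have iα (m : ℕ) (j : Fin n) : Integrable fun z => ‖α m j z‖ ^ 2 * Real.exp (ψ z - ϕ z) := by
    refine integrable_of_zero_off (((αC m j).continuous.norm.pow 2).mul w1) (αc m j) fun z hz => ?_
    simp [image_eq_zero_of_notMem_tsupport hz]
  have sC (m : ℕ) (j k : Fin n) : Continuous (regularize (r m) (s j k)) :=
    (contDiff_regularize (hr m) (hsl j k)).continuous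
  have is (m : ℕ) (j k : Fin n) :
      Integrable fun z => ‖regularize (r m) (s j k) z‖ ^ 2 * Real.exp (-ϕ z) := by
    refine integrable_of_zero_off (((sC m j k).norm.pow 2).mul w2)
      (hasCompactSupport_regularize (hr m) hK (hs0 j k)) fun z hz => ?_
    simp [image_eq_zero_of_notMem_tsupport hz]
  have tα (j : Fin n) : L2Tendsto (fun m => α m j) (a j) :=
    l2Tendsto_regularize (ha j) hK (ha0 j) hr hr0
  have hθ (j : Fin n) : ∃ C, ∀ x,
      ‖wirt (-I) (fun x => ((ϕ x - ψ x : ℝ) : ℂ)) (e n j) x‖ ≤ C := by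
    refine HasCompactSupport.exists_bound_of_continuous ?_
      ((hϕ.sub hψ).ofReal_comp.continuous_wirt (by norm_num))
    refine HasCompactSupport.wirt ?_
    exact (hϕc.sub hψc).comp_left (g := fun x : ℝ => (x : ℂ)) rfl
  choose Cθ hCθ using hθ
  have tX : L2Tendsto (fun m z => regularize (r m) d z -
      ∑ j, wirt (-I) (fun x => ((ϕ x - ψ x : ℝ) : ℂ)) (e n j) z * α m j z) _ :=
    (l2Tendsto_regularize hd hK hd0 hr hr0).sub (L2Tendsto.sum Finset.univ fun j _ =>
      (tα j).mul_left ((hϕ.sub hψ).ofReal_comp.continuous_wirt (by norm_num)) (hCθ j))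
  refine le_of_tendsto_of_tendsto' ((tendsto_finsetSum Finset.univ fun j _ =>
    (tα j).integral_sq_mul w1 (fun z => Real.exp_nonneg _) hC₁).const_mul c)
    (((tX.integral_sq_mul w2 (fun z => Real.exp_nonneg _) hC₂).const_mul 2).add
      ((tendsto_finsetSum Finset.univ fun j _ => tendsto_finsetSum Finset.univ fun k _ =>
        (l2Tendsto_regularize (hs j k) hK (hs0 j k) hr hr0).integral_sq_mul w2
          (fun z => Real.exp_nonneg _) hC₂).const_mul (1 / 2))) fun m => ?_
  have h := est m
  simp only [hD, hS] at h
  rw [integral_finsetSum _ fun j _ => iα m j] at h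
  refine h.trans (le_of_eq ?_)
  congr 1
  simp_rw [mul_assoc, Finset.sum_mul]
  rw [integral_const_mul, integral_finsetSum _ fun j _ => integrable_finsetSum _ fun k _ => is m j k]
  congr 1
  exact Finset.sum_congr rfl fun j _ => integral_finsetSum _ fun k _ => is m j k

end WeakKMH

section LeviCalculus

open Filter Topology

theorem leviForm_add {f g : Cn n → ℝ} {z : Cn n} (hf : ContDiffAt ℝ 2 f z)
    (hg : ContDiffAt ℝ 2 g z) (w : Cn n) :
    LeviForm (fun x => f x + g x) z w = LeviForm f z w + LeviForm g z w := by
  have h1 : fderiv ℝ (fun x => f x + g x) =ᶠ[𝓝 z] fun x => fderiv ℝ f x + fderiv ℝ g x := by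
    filter_upwards [hf.eventually (by simp), hg.eventually (by simp)] with x hx hx'
    exact fderiv_fun_add (hx.differentiableAt (by norm_num)) (hx'.differentiableAt (by norm_num))
  have hf' : DifferentiableAt ℝ (fderiv ℝ f) z :=
    (hf.fderiv_right (m := 1) (by norm_num)).differentiableAt (by norm_num)
  have hg' : DifferentiableAt ℝ (fderiv ℝ g) z :=
    (hg.fderiv_right (m := 1) (by norm_num)).differentiableAt (by norm_num)
  simp only [LeviForm, h1.fderiv_eq, fderiv_fun_add hf' hg', add_apply]
  ring

theorem leviForm_congr {f g : Cn n → ℝ} {z : Cn n} (h : f =ᶠ[𝓝 z] g) (w : Cn n) :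
    LeviForm f z w = LeviForm g z w := by
  simp only [LeviForm, h.fderiv.fderiv_eq]

theorem leviForm_const_mul {f : Cn n → ℝ} {z : Cn n} (hf : ContDiffAt ℝ 2 f z) (k : ℝ)
    (w : Cn n) : LeviForm (fun x => k * f x) z w = k * LeviForm f z w := by
  have h1 : fderiv ℝ (fun x => k * f x) =ᶠ[𝓝 z] fun x => k • fderiv ℝ f x := by
    filter_upwards [hf.eventually (by simp)] with x hx
    exact fderiv_const_mul (hx.differentiableAt (by norm_num)) k
  have hf' : DifferentiableAt ℝ (fderiv ℝ f) z :=
    (hf.fderiv_right (m := 1) (by norm_num)).differentiableAt (by norm_num)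
  simp only [LeviForm, h1.fderiv_eq, fderiv_fun_const_smul hf' k, smul_apply, smul_eq_mul]
  ring

theorem leviForm_comp {χ : ℝ → ℝ} {f : Cn n → ℝ} {z : Cn n} (hχ : ContDiffAt ℝ 2 χ (f z))
    (hf : ContDiffAt ℝ 2 f z) (w : Cn n) :
    LeviForm (fun x => χ (f x)) z w = deriv χ (f z) * LeviForm f z w +
      deriv (deriv χ) (f z) * (1 / 4 * (fderiv ℝ f z w ^ 2 + fderiv ℝ f z (I • w) ^ 2)) := by
  have h1 : fderiv ℝ (fun x => χ (f x)) =ᶠ[𝓝 z] fun x => deriv χ (f x) • fderiv ℝ f x := by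
    filter_upwards [hf.eventually (by simp),
      hf.continuousAt.eventually (hχ.eventually (by simp))] with x hx hx'
    exact ((hx'.differentiableAt (by norm_num)).hasDerivAt.comp_hasFDerivAt x
      (hx.differentiableAt (by norm_num)).hasFDerivAt).fderiv
  have hf' : DifferentiableAt ℝ (fderiv ℝ f) z :=
    (hf.fderiv_right (m := 1) (by norm_num)).differentiableAt (by norm_num)
  have hχ' : DifferentiableAt ℝ (deriv χ) (f z) :=
    (hχ.derivWithin (m := 1) (by norm_num)).differentiableAt (by norm_num)
  have h2 : HasFDerivAt (fun x => deriv χ (f x) • fderiv ℝ f x) _ z :=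
    (hχ'.hasDerivAt.comp_hasFDerivAt z
      (hf.differentiableAt (by norm_num)).hasFDerivAt).smul hf'.hasFDerivAt
  simp only [LeviForm, h1.fderiv_eq, h2.fderiv, add_apply, smul_apply, smul_eq_mul,
    ContinuousLinearMap.smulRight_apply, Function.comp_apply]
  ring

theorem contDiff_norm_sub_sq (a : Cn n) {m : WithTop ℕ∞} :
    ContDiff ℝ m fun z : Cn n => ‖z - a‖ ^ 2 :=
  (contDiff_id.sub contDiff_const).norm_sq ℝ

theorem fderiv_norm_sub_sq (a z : Cn n) :
    fderiv ℝ (fun x : Cn n => ‖x - a‖ ^ 2) z = 2 • innerSL ℝ (z - a) := by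
  have h := (hasStrictFDerivAt_norm_sq (z - a)).hasFDerivAt.comp z ((hasFDerivAt_id z).sub_const a)
  rw [ContinuousLinearMap.comp_id] at h
  exact h.fderiv

theorem norm_I_smul (w : Cn n) : ‖I • w‖ = ‖w‖ := by rw [norm_smul, norm_I, one_mul]

theorem leviForm_norm_sub_sq (a z w : Cn n) :
    LeviForm (fun x => ‖x - a‖ ^ 2) z w = ‖w‖ ^ 2 := by
  have h1 : fderiv ℝ (fun x : Cn n => ‖x - a‖ ^ 2) = fun x => (2 • innerSL ℝ) (x - a) := by
    ext1 x
    rw [fderiv_norm_sub_sq]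
    rfl
  have h2 : HasFDerivAt (fun x : Cn n => (2 • innerSL ℝ : Cn n →L[ℝ] Cn n →L[ℝ] ℝ) (x - a))
      (2 • innerSL ℝ : Cn n →L[ℝ] Cn n →L[ℝ] ℝ) z := by
    have := (2 • innerSL ℝ : Cn n →L[ℝ] Cn n →L[ℝ] ℝ).hasFDerivAt.comp z
      ((hasFDerivAt_id z).sub_const a)
    rwa [ContinuousLinearMap.comp_id] at this
  have h3 (v : Cn n) : (2 • innerSL ℝ : Cn n →L[ℝ] Cn n →L[ℝ] ℝ) v v = 2 * ‖v‖ ^ 2 := by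
    rw [← real_inner_self_eq_norm_sq]
    simp only [smul_apply, nsmul_eq_mul, Nat.cast_ofNat]
    rfl
  rw [LeviForm, h1, h2.fderiv, h3, h3, norm_I_smul]
  ring

theorem wirt_comp {χ : ℝ → ℝ} {f : Cn n → ℝ} {z : Cn n} (s : ℂ) (w : Cn n)
    (hχ : DifferentiableAt ℝ χ (f z)) (hf : DifferentiableAt ℝ f z) :
    wirt s (fun x => (χ (f x) : ℂ)) w z = ((deriv χ (f z) : ℝ) : ℂ) * wirt s (fun x => (f x : ℂ)) w z := by
  have h := hχ.hasDerivAt.comp_hasFDerivAt z hf.hasFDerivAt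
  have h1 : HasFDerivAt (fun x => (χ (f x) : ℂ)) _ z := ofRealCLM.hasFDerivAt.comp z h
  have h2 : HasFDerivAt (fun x => (f x : ℂ)) _ z := ofRealCLM.hasFDerivAt.comp z hf.hasFDerivAt
  simp only [wirt, h1.fderiv, h2.fderiv, ContinuousLinearMap.comp_apply, smul_apply,
    ofRealCLM_apply, smul_eq_mul, ofReal_mul]
  ring

theorem norm_wirt_ofReal {f : Cn n → ℝ} {z : Cn n} (w : Cn n) (hf : DifferentiableAt ℝ f z) :
    ‖wirt I (fun x => (f x : ℂ)) w z‖ = ‖wirt (-I) (fun x => (f x : ℂ)) w z‖ := by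
  have hd : DifferentiableAt ℝ (fun x => (f x : ℂ)) z :=
    (ofRealCLM.hasFDerivAt.comp z hf.hasFDerivAt).differentiableAt
  have h := wirt_conj (s := I) (w := w) hd
  simp only [conj_ofReal, conj_I] at h
  rw [h, RCLike.norm_conj]

end LeviCalculus

section ConvexGrowth

open Filter Topology

theorem hasDerivAt_max_zero_pow (k : ℕ) (x : ℝ) :
    HasDerivAt (fun y : ℝ => max y 0 ^ (k + 2)) ((k + 2 : ℕ) * max x 0 ^ (k + 1)) x := by
  rcases lt_trichotomy x 0 with hx | rfl | hx
  · rw [max_eq_right hx.le, zero_pow (by omega), mul_zero]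
    refine (hasDerivAt_const x (0 : ℝ)).congr_of_eventuallyEq ?_
    filter_upwards [Iio_mem_nhds hx] with y hy
    rw [max_eq_right (le_of_lt hy), zero_pow (by omega)]
  · have h1 : HasDerivWithinAt (fun y : ℝ => max y 0 ^ (k + 2)) 0 (Iic 0) 0 :=
      (hasDerivWithinAt_const (0 : ℝ) (Iic 0) (0 : ℝ)).congr (fun y hy => by
        rw [max_eq_right hy, zero_pow (by omega)]) (by simp)
    have h2 : HasDerivWithinAt (fun y : ℝ => max y 0 ^ (k + 2)) 0 (Ici 0) 0 := by
      have := (hasDerivAt_pow (k + 2) (0 : ℝ)).hasDerivWithinAt (s := Ici 0)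
      rw [Nat.add_sub_assoc (by norm_num), zero_pow (by omega), mul_zero] at this
      exact this.congr (fun y hy => by rw [max_eq_left hy]) (by simp)
    have h := h1.union h2
    rw [Iic_union_Ici, hasDerivWithinAt_univ] at h
    simpa using h
  · rw [max_eq_left hx.le]
    refine (hasDerivAt_pow (k + 2) x).congr_of_eventuallyEq ?_
    filter_upwards [Ioi_mem_nhds hx] with y hy
    rw [max_eq_left (le_of_lt hy)]

/-- A locally finite sum of shifted truncated powers. -/
def ramp (a : ℝ) (c : ℕ → ℝ) (k : ℕ) (t : ℝ) : ℝ :=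
  ∑ m ∈ Finset.range ⌈t - a⌉₊, c m * max (t - a - m) 0 ^ k

theorem ramp_eq {a : ℝ} {c : ℕ → ℝ} {k : ℕ} (hk : k ≠ 0) {t : ℝ} {M : ℕ} (hM : t - a ≤ M) :
    ramp a c k t = ∑ m ∈ Finset.range M, c m * max (t - a - m) 0 ^ k := by
  refine Finset.sum_subset (Finset.range_mono (Nat.ceil_le.2 hM)) fun m _ hm => ?_
  have : t - a ≤ m := Nat.ceil_le.1 (not_lt.1 (by simpa using hm))
  rw [max_eq_right (by linarith), zero_pow hk, mul_zero]

theorem ramp_eventuallyEq (a : ℝ) (c : ℕ → ℝ) {k : ℕ} (hk : k ≠ 0) (t : ℝ) :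
    ∃ M : ℕ, t - a ≤ M ∧
      ramp a c k =ᶠ[𝓝 t] fun s => ∑ m ∈ Finset.range M, c m * max (s - a - m) 0 ^ k := by
  obtain ⟨M, hM⟩ := exists_nat_gt (t - a)
  refine ⟨M, hM.le, ?_⟩
  filter_upwards [(continuous_id.sub continuous_const).continuousAt.eventually_lt_const hM]
    with s hs using ramp_eq hk (le_of_lt hs)

theorem continuous_ramp (a : ℝ) (c : ℕ → ℝ) {k : ℕ} (hk : k ≠ 0) : Continuous (ramp a c k) := by
  refine continuous_iff_continuousAt.2 fun t => ?_
  obtain ⟨M, -, h⟩ := ramp_eventuallyEq a c hk t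
  exact ContinuousAt.congr (by fun_prop) h.symm

theorem hasDerivAt_ramp (a : ℝ) (c : ℕ → ℝ) (k : ℕ) (t : ℝ) :
    HasDerivAt (ramp a c (k + 2)) ((k + 2 : ℕ) * ramp a c (k + 1) t) t := by
  obtain ⟨M, hM, h⟩ := ramp_eventuallyEq a c (k := k + 2) (by omega) t
  refine HasDerivAt.congr_of_eventuallyEq ?_ h
  rw [ramp_eq (by omega) hM, Finset.mul_sum]
  refine HasDerivAt.fun_sum fun m _ => ?_
  have := ((hasDerivAt_max_zero_pow k (t - a - m)).comp t
    (((hasDerivAt_id t).sub_const a).sub_const (m : ℝ))).const_mul (c m)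
  refine this.congr_deriv ?_
  ring

theorem deriv_ramp (a : ℝ) (c : ℕ → ℝ) (k : ℕ) :
    deriv (ramp a c (k + 2)) = fun t => (k + 2 : ℕ) * ramp a c (k + 1) t :=
  funext fun t => (hasDerivAt_ramp a c k t).deriv

theorem ramp_of_le {a : ℝ} {c : ℕ → ℝ} {k : ℕ} {t : ℝ} (ht : t ≤ a) : ramp a c k t = 0 := by
  rw [ramp, Nat.ceil_eq_zero.2 (by linarith), Finset.range_zero, Finset.sum_empty]

theorem monotone_ramp (a : ℝ) {c : ℕ → ℝ} (hc : ∀ m, 0 ≤ c m) {k : ℕ} (hk : k ≠ 0) :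
    Monotone (ramp a c k) := by
  intro s t hst
  rw [ramp_eq hk ((sub_le_sub_right hst a).trans (Nat.le_ceil _)), ramp]
  gcongr with m _
  exact hc m

theorem ramp_nonneg (a : ℝ) {c : ℕ → ℝ} (hc : ∀ m, 0 ≤ c m) (k : ℕ) (t : ℝ) :
    0 ≤ ramp a c k t :=
  Finset.sum_nonneg fun m _ => mul_nonneg (hc m) (by positivity)

theorem le_ramp {F : ℝ → ℝ} (hF : Monotone F) {a t : ℝ} {c : ℕ → ℝ} (hc : ∀ m, 0 ≤ c m)
    (hFc : ∀ m : ℕ, F (a + 2 + m) ≤ c m) (ht : a + 1 ≤ t) (k : ℕ) : F t ≤ ramp a c k t := by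
  have h0 : 0 ≤ t - a - 1 := by linarith
  set M := ⌊t - a - 1⌋₊
  have h1 : (M : ℝ) ≤ t - a - 1 := Nat.floor_le h0
  have h2 : t - a - 1 < M + 1 := Nat.lt_floor_add_one _
  have hM : M ∈ Finset.range ⌈t - a⌉₊ := by
    rw [Finset.mem_range, Nat.lt_ceil]
    linarith
  calc F t ≤ F (a + 2 + M) := hF (by linarith)
    _ ≤ c M := hFc M
    _ ≤ c M * max (t - a - M) 0 ^ k :=
        le_mul_of_one_le_right (hc M) (one_le_pow₀ (le_max_of_le_left (by linarith)))
    _ ≤ ramp a c k t := Finset.single_le_sum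
        (f := fun m : ℕ => c m * max (t - a - m) 0 ^ k)
        (fun m _ => mul_nonneg (hc m) (by positivity)) hM

theorem exists_convex_growth {F : ℝ → ℝ} (hF : Monotone F) (a : ℝ) :
    ∃ χ : ℝ → ℝ, ContDiff ℝ 2 χ ∧ (∀ t, 0 ≤ deriv (deriv χ) t) ∧ (∀ t, 0 ≤ deriv χ t) ∧
      (∀ t, 0 ≤ χ t) ∧ (∀ t ≤ a, χ t = 0) ∧ (∀ t ≤ a, deriv χ t = 0) ∧ Monotone χ ∧
      Monotone (deriv χ) ∧ (∀ t, a + 1 ≤ t → F t ≤ χ t) ∧ ∀ t, a + 1 ≤ t → F t ≤ deriv χ t := by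
  set c : ℕ → ℝ := fun m => max (F (a + 2 + m)) 0
  have hc (m : ℕ) : 0 ≤ c m := le_max_right _ _
  have hFc (m : ℕ) : F (a + 2 + m) ≤ c m := le_max_left _ _
  have h1 : deriv (ramp a c 3) = fun t => 3 * ramp a c 2 t := by simpa using deriv_ramp a c 1
  have h2 : deriv (fun t => 3 * ramp a c 2 t) = fun t => 3 * (2 * ramp a c 1 t) := by
    ext t
    exact (((hasDerivAt_ramp a c 0 t).const_mul 3).deriv).trans (by simp)
  refine ⟨ramp a c 3, ?_, ?_, ?_, ramp_nonneg a hc 3, fun t ht => ramp_of_le ht, ?_,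
    monotone_ramp a hc (by norm_num), ?_, fun t ht => le_ramp hF hc hFc ht 3, ?_⟩
  · have e2 : (2 : WithTop ℕ∞) = 1 + 1 := by norm_num
    rw [e2, contDiff_succ_iff_deriv]
    refine ⟨fun t => (hasDerivAt_ramp a c 1 t).differentiableAt, by simp, ?_⟩
    rw [h1, contDiff_one_iff_deriv, h2]
    exact ⟨fun t => ((hasDerivAt_ramp a c 0 t).differentiableAt).const_mul 3,
      continuous_const.mul (continuous_const.mul (continuous_ramp a c (by norm_num)))⟩
  · intro t
    rw [h1, h2]
    have := ramp_nonneg a hc 1 t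
    positivity
  · intro t
    rw [h1]
    have := ramp_nonneg a hc 2 t
    positivity
  · intro t ht
    rw [h1]
    simp [ramp_of_le ht]
  · rw [h1]
    exact (monotone_ramp a hc (by norm_num)).const_mul (by norm_num)
  · intro t ht
    rw [h1]
    have := ramp_nonneg a hc 2 t
    have h := le_ramp hF hc hFc ht 2
    show F t ≤ 3 * ramp a c 2 t
    linarith

theorem exists_cutoff_real : ∃ θ : ℝ → ℝ, ContDiff ℝ 2 θ ∧ (∀ t, θ t ∈ Icc (0 : ℝ) 1) ∧
    (∀ t ≤ 0, θ t = 1) ∧ (∀ t, 1 ≤ t → θ t = 0) ∧ (∀ t ≤ 0, deriv θ t = 0) ∧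
    ∃ C, ∀ t, deriv θ t ^ 2 ≤ C := by
  set θ : ℝ → ℝ := fun t => Real.smoothTransition (1 - t)
  have hθ : ContDiff ℝ 2 θ := Real.smoothTransition.contDiff.comp (contDiff_const.sub contDiff_id)
  have h1 : ∀ t ≤ 0, θ t = 1 := fun t ht => Real.smoothTransition.one_of_one_le (by linarith)
  have h0 : ∀ t, 1 ≤ t → θ t = 0 := fun t ht => Real.smoothTransition.zero_of_nonpos (by linarith)
  have hI : ∀ t, θ t ∈ Icc (0 : ℝ) 1 := fun t =>
    ⟨Real.smoothTransition.nonneg _, Real.smoothTransition.le_one _⟩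
  have hd : ∀ t, θ t = 1 → deriv θ t = 0 := fun t ht =>
    IsLocalMax.deriv_eq_zero (Eventually.of_forall fun s => ht ▸ (hI s).2)
  have hd' : ∀ t, θ t = 0 → deriv θ t = 0 := fun t ht =>
    IsLocalMin.deriv_eq_zero (Eventually.of_forall fun s => ht ▸ (hI s).1)
  have hcont : Continuous (deriv θ) := hθ.continuous_deriv (by norm_num)
  obtain ⟨C, hC⟩ := (isCompact_Icc (a := (0 : ℝ)) (b := 1)).exists_bound_of_continuousOn
    (hcont.pow 2).continuousOn
  refine ⟨θ, hθ, hI, h1, h0, fun t ht => hd t (h1 t ht), C, fun t => ?_⟩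
  have hC0 : 0 ≤ C := (norm_nonneg _).trans (hC 0 (by simp))
  by_cases ht : t ∈ Icc (0 : ℝ) 1
  · exact (le_abs_self _).trans (hC t ht)
  · have : deriv θ t = 0 := by
      rcases lt_or_ge t 0 with h | h
      · exact hd t (h1 t h.le)
      · exact hd' t (h0 t (not_lt.1 fun h' => ht ⟨h, h'.le⟩))
    rw [this]
    simpa using hC0

end ConvexGrowth

section Weights

open Filter Topology

theorem isCompact_sublevel {Ω : Set (Cn n)} {ρ g : Cn n → ℝ} (hρ : ∀ c : ℝ, IsCompact {z ∈ Ω | ρ z ≤ c})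
    (hg : ContinuousOn g Ω) (hle : ∀ z, ρ z ≤ g z) (c : ℝ) : IsCompact {z ∈ Ω | g z ≤ c} := by
  have h : {z ∈ Ω | g z ≤ c} = {z ∈ Ω | ρ z ≤ c} ∩ g ⁻¹' Iic c := by
    ext z
    simp only [mem_ofPred_eq, mem_inter_iff, mem_preimage, mem_Iic]
    exact ⟨fun h => ⟨⟨h.1, (hle z).trans h.2⟩, h.2⟩, fun h => ⟨h.1.1, h.2⟩⟩
  rw [h]
  exact (hρ c).of_isClosed_subset ((hg.mono fun z hz => hz.1).preimage_isClosed_of_isClosed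
    (hρ c).isClosed isClosed_Iic) inter_subset_left

theorem exists_monotone_bound {Ω : Set (Cn n)} {ρ g : Cn n → ℝ}
    (hρ : ∀ c : ℝ, IsCompact {z ∈ Ω | ρ z ≤ c}) (hg : ContinuousOn g Ω) :
    ∃ G : ℝ → ℝ, Monotone G ∧ (∀ t, 0 ≤ G t) ∧ ∀ z ∈ Ω, g z ≤ G (ρ z) := by
  have hb (t : ℝ) : BddAbove (insert 0 (g '' {z ∈ Ω | ρ z ≤ t})) :=
    (((hρ t).image_of_continuousOn (hg.mono fun z hz => hz.1)).bddAbove).insert 0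
  refine ⟨fun t => sSup (insert 0 (g '' {z ∈ Ω | ρ z ≤ t})), fun s t hst => ?_, fun t => ?_,
    fun z hz => ?_⟩
  · exact csSup_le_csSup (hb t) (insert_nonempty _ _)
      (insert_subset_insert (image_mono fun z hz => ⟨hz.1, hz.2.trans hst⟩))
  · exact le_csSup (hb t) (mem_insert _ _)
  · exact le_csSup (hb _) (mem_insert_of_mem _ ⟨z, ⟨hz, le_rfl⟩, rfl⟩)

/-- Weights and cutoff functions that make the three-weight estimate of Hörmander available, while
leaving the given weight `Φ` unchanged on `S`. -/
structure WeightSystem (Ω : Set (Cn n)) (Φ : Cn n → ℝ) (S : Set (Cn n)) (c : ℝ)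
    (ϕ ψ : Cn n → ℝ) (η : ℕ → Cn n → ℝ) : Prop where
  contDiffOn_fst : ContDiffOn ℝ 2 ϕ Ω
  contDiffOn_snd : ContDiffOn ℝ 2 ψ Ω
  fst_eq : ∀ z ∈ S, ϕ z = Φ z
  snd_eq : ∀ z ∈ S, ψ z = 0
  le_sub : ∀ z ∈ Ω, Φ z ≤ ϕ z - ψ z
  levi : ∀ z ∈ Ω, ∀ w, (c * Real.exp (ψ z) +
    2 * ∑ j, ‖wirt (-I) (fun x => (ψ x : ℂ)) (e n j) z‖ ^ 2) * ‖w‖ ^ 2 ≤ LeviForm ϕ z w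
  contDiff_cutoff : ∀ m, ContDiff ℝ 2 (η m)
  compact_cutoff : ∀ m, HasCompactSupport (η m)
  tsupport_cutoff : ∀ m, tsupport (η m) ⊆ Ω
  cutoff_mem : ∀ m z, η m z ∈ Icc (0 : ℝ) 1
  cutoff_eq : ∀ m, ∀ z ∈ S, η m =ᶠ[𝓝 z] 1
  cutoff_tendsto : ∀ z ∈ Ω, ∀ᶠ m in atTop, η m =ᶠ[𝓝 z] 1
  norm_dbar_cutoff : ∀ m, ∀ z ∈ Ω,
    ∑ j, ‖wirt I (fun x => (η m x : ℂ)) (e n j) z‖ ^ 2 ≤ Real.exp (ψ z)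

theorem exists_weightSystem {Ω : Set (Cn n)} (hΩ : IsOpen Ω) (hpsc : Pseudoconvex Ω)
    {Φ : Cn n → ℝ} (hΦ : ContDiffOn ℝ 2 Φ Ω) {c : ℝ} (hc : 0 ≤ c)
    (hL : ∀ z ∈ Ω, ∀ w, c * ‖w‖ ^ 2 ≤ LeviForm Φ z w) {S : Set (Cn n)} (hS : IsCompact S)
    (hSΩ : S ⊆ Ω) : ∃ ϕ ψ η, WeightSystem Ω Φ S c ϕ ψ η := by
  obtain ⟨ρ, hρ, hρc, hρL⟩ := hpsc
  set r : Cn n → ℝ := fun z => ρ z + ‖z - 0‖ ^ 2 with hr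
  have hn (z : Cn n) : ContDiffAt ℝ 2 (fun z : Cn n => ‖z - 0‖ ^ 2) z :=
    (contDiff_norm_sub_sq 0).contDiffAt
  have hat {f : Cn n → ℝ} (hf : ContDiffOn ℝ 2 f Ω) {z : Cn n} (hz : z ∈ Ω) : ContDiffAt ℝ 2 f z :=
    hf.contDiffAt (hΩ.mem_nhds hz)
  have hrC : ContDiffOn ℝ 2 r Ω := fun z hz => ((hat hρ hz).add (hn z)).contDiffWithinAt
  have hrc := isCompact_sublevel hρc hrC.continuousOn fun z => by
    have := sq_nonneg ‖z - 0‖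
    simp only [hr]
    linarith
  have hrL : ∀ z ∈ Ω, ∀ w, ‖w‖ ^ 2 ≤ LeviForm r z w := fun z hz w => by
    rw [hr, leviForm_add (hat hρ hz) (hn z), leviForm_norm_sub_sq]
    linarith [hρL z hz w]
  set g : Cn n → ℝ := fun z => ∑ j, ‖wirt (-I) (fun x => (r x : ℂ)) (e n j) z‖ ^ 2
  have hg : ContinuousOn g Ω := fun z hz => by
    refine ContinuousAt.continuousWithinAt ?_
    refine tendsto_finsetSum _ fun j _ => ?_
    have : ContDiffAt ℝ 1 (wirt (-I) (fun x => (r x : ℂ)) (e n j)) z :=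
      ((hat hrC hz).ofReal_comp).wirt (by norm_num)
    exact this.continuousAt.norm.pow 2
  obtain ⟨G, hGm, hG0, hG⟩ := exists_monotone_bound hrc hg
  obtain ⟨a, ha⟩ : ∃ a, ∀ z ∈ S, r z < a := by
    obtain ⟨b, hb⟩ := (hS.image_of_continuousOn (hrC.continuousOn.mono hSΩ)).bddAbove
    exact ⟨b + 1, fun z hz => (hb (mem_image_of_mem r hz)).trans_lt (lt_add_one b)⟩
  obtain ⟨θ, hθ, hθI, hθ1, hθ0, hθd, C, hC⟩ := exists_cutoff_real
  have hC0 : 0 ≤ C := (sq_nonneg _).trans (hC 0)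
  obtain ⟨σ, hσ, -, hσd, hσ0, hσz, hσdz, hσm, hσdm, hσF, -⟩ :=
    exists_convex_growth (hGm.const_mul hC0) (a + 1)
  have hF : Monotone fun t => c * Real.exp (σ t) + 2 * (deriv σ t ^ 2 * G t) + σ t := by
    intro s t hst
    have h1 := hσm hst
    have h2 := hσdm hst
    have h3 := hGm hst
    have h4 := hσd s
    have h5 := hG0 s
    dsimp only
    gcongr
  obtain ⟨χ, hχ, hχdd, hχd, hχ0, hχz, hχdz, -, -, hχF, hχF'⟩ := exists_convex_growth hF a
  have hcomp {f : ℝ → ℝ} (hf : ContDiff ℝ 2 f) : ContDiffOn ℝ 2 (fun z => f (r z)) Ω :=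
    hf.comp_contDiffOn hrC
  have hw {f : ℝ → ℝ} (hf : ContDiff ℝ 2 f) {z : Cn n} (hz : z ∈ Ω) :
      ∑ j, ‖wirt (-I) (fun x => (f (r x) : ℂ)) (e n j) z‖ ^ 2 = deriv f (r z) ^ 2 * g z := by
    rw [Finset.mul_sum]
    refine Finset.sum_congr rfl fun j _ => ?_
    rw [wirt_comp _ _ (hf.differentiable (by norm_num) _)
      ((hat hrC hz).differentiableAt (by norm_num)), norm_mul, mul_pow, norm_real, Real.norm_eq_abs,
      sq_abs]
  have hg0 (z : Cn n) : 0 ≤ g z := Finset.sum_nonneg fun j _ => sq_nonneg _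
  classical
  set η : ℕ → Cn n → ℝ := fun m z => if z ∈ Ω then θ (r z - (a + 2 + m)) else 0 with hη
  have hηΩ (m : ℕ) {z : Cn n} (hz : z ∈ Ω) : η m =ᶠ[𝓝 z] fun x => θ (r x - (a + 2 + m)) := by
    filter_upwards [hΩ.mem_nhds hz] with x hx
    simp [hη, hx]
  have hθs (m : ℕ) : ContDiff ℝ 2 fun t => θ (t - (a + 2 + m)) :=
    hθ.comp (contDiff_id.sub contDiff_const)
  have hη0 (m : ℕ) {z : Cn n} (hz : z ∉ {z ∈ Ω | r z ≤ a + 3 + m}) : η m z = 0 := by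
    by_cases h : z ∈ Ω
    · have : a + 3 + m < r z := not_le.1 fun h' => hz ⟨h, h'⟩
      simp only [hη, h, if_true]
      exact hθ0 _ (by linarith)
    · simp [hη, h]
  have hηt (m : ℕ) : tsupport (η m) ⊆ {z ∈ Ω | r z ≤ a + 3 + m} :=
    closure_minimal (fun z hz => by_contra fun h => hz (hη0 m h)) (hrc _).isClosed
  have hη1 (m : ℕ) {z : Cn n} (hz : z ∈ Ω) (h : r z < a + 2 + m) : η m =ᶠ[𝓝 z] 1 := by
    filter_upwards [hηΩ m hz, (hat hrC hz).continuousAt.eventually_lt_const h] with x hx hx'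
    rw [hx]
    exact hθ1 _ (by linarith)
  refine ⟨fun z => Φ z + χ (r z), fun z => σ (r z), η, ⟨hΦ.add (hcomp hχ), hcomp hσ, ?_, ?_, ?_,
    ?_, ?_, ?_, fun m => (hηt m).trans fun z hz => hz.1, ?_, ?_, ?_, ?_⟩⟩
  · intro z hz
    simp [hχz _ (ha z hz).le]
  · intro z hz
    exact hσz _ (by linarith [ha z hz])
  · intro z hz
    by_cases h : r z ≤ a + 1
    · simp only [hσz _ h]
      linarith [hχ0 (r z)]
    · have h1 := hχF _ (not_le.1 h).le
      have h2 : 0 ≤ c * Real.exp (σ (r z)) := by positivity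
      have h3 : 0 ≤ deriv σ (r z) ^ 2 * G (r z) := mul_nonneg (sq_nonneg _) (hG0 _)
      linarith
  · intro z hz w
    rw [hw hσ hz, leviForm_add (hat hΦ hz) (hat (hcomp hχ) hz),
      leviForm_comp hχ.contDiffAt (hat hrC hz)]
    have h1 := hL z hz w
    have h2 : deriv χ (r z) * ‖w‖ ^ 2 ≤ deriv χ (r z) * LeviForm r z w :=
      mul_le_mul_of_nonneg_left (hrL z hz w) (hχd _)
    have h3 : 0 ≤ deriv (deriv χ) (r z) *
        (1 / 4 * (fderiv ℝ r z w ^ 2 + fderiv ℝ r z (I • w) ^ 2)) :=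
      mul_nonneg (hχdd _) (by positivity)
    have h4 : c * Real.exp (σ (r z)) + 2 * (deriv σ (r z) ^ 2 * g z) ≤ c + deriv χ (r z) := by
      by_cases h : r z ≤ a + 1
      · rw [hσz _ h, hσdz _ h, Real.exp_zero]
        linarith [hχd (r z)]
      · have h5 := hχF' _ (not_le.1 h).le
        have h6 : deriv σ (r z) ^ 2 * g z ≤ deriv σ (r z) ^ 2 * G (r z) :=
          mul_le_mul_of_nonneg_left (hG z hz) (sq_nonneg _)
        have h7 := hσ0 (r z)
        linarith
    have h5 := mul_le_mul_of_nonneg_right h4 (sq_nonneg ‖w‖)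
    linarith
  · intro m
    refine contDiff_iff_contDiffAt.2 fun z => ?_
    by_cases hz : z ∈ Ω
    · exact ((hθs m).contDiffAt.comp z (hat hrC hz)).congr_of_eventuallyEq (hηΩ m hz)
    · refine (contDiffAt_const (c := (0 : ℝ))).congr_of_eventuallyEq ?_
      filter_upwards [(hrc (a + 3 + m)).isClosed.isOpen_compl.mem_nhds fun h => hz h.1] with x hx
        using hη0 m hx
  · exact fun m => HasCompactSupport.intro (hrc _) fun z hz => hη0 m hz
  · intro m z
    by_cases hz : z ∈ Ω
    · simpa [hη, hz] using hθI _
    · simp [hη, hz]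
  · exact fun m z hz => hη1 m (hSΩ hz) (by linarith [ha z hz, m.cast_nonneg (α := ℝ)])
  · intro z hz
    obtain ⟨M, hM⟩ := exists_nat_gt (r z - (a + 2))
    filter_upwards [eventually_ge_atTop M] with m hm
    have : (M : ℝ) ≤ m := by exact_mod_cast hm
    exact hη1 m hz (by linarith)
  · intro m z hz
    have hd : DifferentiableAt ℝ (fun x => θ (r x - (a + 2 + m))) z :=
      (hat (hcomp (hθs m)) hz).differentiableAt (by norm_num)
    have h1 : ∀ j, ‖wirt I (fun x => (η m x : ℂ)) (e n j) z‖ =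
        ‖wirt (-I) (fun x => (θ (r x - (a + 2 + m)) : ℂ)) (e n j) z‖ := fun j => by
      rw [← norm_wirt_ofReal _ hd]
      congr 1
      exact wirt_congr ((hηΩ m hz).fun_comp ofReal)
    simp only [h1]
    rw [hw (hθs m) hz, deriv_comp_sub_const]
    by_cases h : r z ≤ a + 2 + m
    · rw [hθd _ (by linarith)]
      simpa using (Real.exp_pos _).le
    · have hm := m.cast_nonneg (α := ℝ)
      calc deriv θ (r z - (a + 2 + m)) ^ 2 * g z ≤ C * G (r z) :=
            mul_le_mul (hC _) (hG z hz) (hg0 z) hC0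
        _ ≤ σ (r z) := hσF _ (by linarith)
        _ ≤ Real.exp (σ (r z)) := by linarith [Real.add_one_le_exp (σ (r z))]

end Weights

section LocalEstimate

open Filter Topology Manifold

theorem exists_cutoff {Ω K : Set (Cn n)} (hΩ : IsOpen Ω) (hK : IsCompact K) (hKΩ : K ⊆ Ω) :
    ∃ κ : Cn n → ℝ, ContDiff ℝ 2 κ ∧ HasCompactSupport κ ∧ tsupport κ ⊆ Ω ∧
      (∀ᶠ x in 𝓝ˢ K, κ x = 1) ∧ ∀ x, κ x ∈ Icc (0 : ℝ) 1 := by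
  obtain ⟨L, hL, hKL, hLΩ⟩ := exists_compact_between hK hΩ hKΩ
  obtain ⟨f, hf1, hf0, hfI⟩ := exists_contMDiffMap_one_nhds_of_subset_interior (n := 2)
    (modelWithCornersSelf ℝ (Cn n)) hK.isClosed hKL
  have ht : tsupport f ⊆ L :=
    closure_minimal (fun z hz => by_contra fun h => hz (hf0 z h)) hL.isClosed
  exact ⟨f, f.contMDiff.contDiff, HasCompactSupport.intro hL hf0, ht.trans hLΩ, hf1, hfI⟩

theorem weak_basic_estimate_on {Ω : Set (Cn n)} (hΩ : IsOpen Ω) {ϕ ψ : Cn n → ℝ} {c : ℝ}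
    (hϕ : ContDiffOn ℝ 2 ϕ Ω) (hψ : ContDiffOn ℝ 2 ψ Ω)
    (hL : ∀ z ∈ Ω, ∀ w, (c * Real.exp (ψ z) +
      2 * ∑ j, ‖wirt (-I) (fun x => (ψ x : ℂ)) (e n j) z‖ ^ 2) * ‖w‖ ^ 2 ≤ LeviForm ϕ z w)
    {K : Set (Cn n)} (hK : IsCompact K) (hKΩ : K ⊆ Ω)
    {a : Fin n → Cn n → ℂ} {d : Cn n → ℂ} {s : Fin n → Fin n → Cn n → ℂ}
    (ha : ∀ j, MemLp (a j) 2) (hd : MemLp d 2) (hs : ∀ j k, MemLp (s j k) 2)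
    (ha0 : ∀ j, ∀ z ∉ K, a j z = 0) (hd0 : ∀ z ∉ K, d z = 0)
    (hs0 : ∀ j k, ∀ z ∉ K, s j k z = 0)
    (hdiv : ∀ q, IsTest univ q →
      ∫ z, ∑ j, a j z * wirt (-I) q (e n j) z = -∫ z, d z * q z)
    (hcurl : ∀ q, IsTest univ q → ∀ j k,
      ∫ z, (a k z * wirt I q (e n j) z - a j z * wirt I q (e n k) z) = -∫ z, s j k z * q z) :
    c * ∑ j, ∫ z, ‖a j z‖ ^ 2 * Real.exp (ψ z - ϕ z) ≤
      2 * (∫ z, ‖d z - ∑ j, wirt (-I) (fun x => ((ϕ x - ψ x : ℝ) : ℂ)) (e n j) z * a j z‖ ^ 2 *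
          Real.exp (-ϕ z)) +
        1 / 2 * ∑ j, ∑ k, ∫ z, ‖s j k z‖ ^ 2 * Real.exp (-ϕ z) := by
  obtain ⟨κ, hκ, hκc, hκs, hκ1, -⟩ := exists_cutoff hΩ hK hKΩ
  set U := interior {z | κ z = 1}
  have hKU : K ⊆ U := fun z hz => mem_interior_iff_mem_nhds.2 (eventually_nhdsSet_iff_forall.1 hκ1 z hz)
  have hU1 : ∀ z ∈ U, κ =ᶠ[𝓝 z] 1 := fun z hz => mem_interior_iff_mem_nhds.1 hz
  have hUΩ : U ⊆ Ω := fun z hz => hκs (subset_tsupport _ (by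
    rw [Function.mem_support, (hU1 z hz).eq_of_nhds]
    exact one_ne_zero))
  have hmul {f : Cn n → ℝ} (hf : ContDiffOn ℝ 2 f Ω) : ContDiff ℝ 2 fun z => f z * κ z := by
    refine contDiff_iff_contDiffAt.2 fun x => ?_
    by_cases hx : x ∈ tsupport κ
    · exact (hf.contDiffAt (hΩ.mem_nhds (hκs hx))).mul hκ.contDiffAt
    · have h0 : (fun z => f z * κ z) =ᶠ[𝓝 x] fun _ => 0 := by
        filter_upwards [notMem_tsupport_iff_eventuallyEq.1 hx] with z hz
        simp [hz]
      exact contDiffAt_const.congr_of_eventuallyEq h0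
  have heq (f : Cn n → ℝ) {z : Cn n} (hz : z ∈ U) : (fun x => f x * κ x) =ᶠ[𝓝 z] f := by
    filter_upwards [hU1 z hz] with x hx
    simp [hx]
  have h := weak_basic_estimate (U := U) (c := c) (hmul hϕ) (hmul hψ) hκc.mul_left hκc.mul_left
    isOpen_interior (fun z hz w => by
      rw [leviForm_congr (heq ϕ hz), (heq ψ hz).eq_of_nhds]
      have hw (j : Fin n) : wirt (-I) (fun x => ((ψ x * κ x : ℝ) : ℂ)) (e n j) z =
        wirt (-I) (fun x => (ψ x : ℂ)) (e n j) z := wirt_congr ((heq ψ hz).fun_comp ofReal)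
      simp only [hw]
      exact hL z (hUΩ hz) w) hK hKU ha hd hs ha0 hd0 hs0 hdiv hcurl
  have e1 : ∀ j, (fun z => ‖a j z‖ ^ 2 * Real.exp (ψ z * κ z - ϕ z * κ z)) =
      fun z => ‖a j z‖ ^ 2 * Real.exp (ψ z - ϕ z) := fun j => by
    ext z
    by_cases hz : z ∈ K
    · have h1 := (heq ϕ (hKU hz)).eq_of_nhds
      have h2 := (heq ψ (hKU hz)).eq_of_nhds
      rw [h1, h2]
    · simp [ha0 j z hz]
  have e2 : (fun z => ‖d z - ∑ j, wirt (-I) (fun x => ((ϕ x * κ x - ψ x * κ x : ℝ) : ℂ)) (e n j) z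
      * a j z‖ ^ 2 * Real.exp (-(ϕ z * κ z))) =
      fun z => ‖d z - ∑ j, wirt (-I) (fun x => ((ϕ x - ψ x : ℝ) : ℂ)) (e n j) z * a j z‖ ^ 2 *
          Real.exp (-ϕ z) := by
    ext z
    by_cases hz : z ∈ K
    · have h1 := (heq ϕ (hKU hz)).eq_of_nhds
      have h3 : (fun x => ((ϕ x * κ x - ψ x * κ x : ℝ) : ℂ)) =ᶠ[𝓝 z]
          fun x => ((ϕ x - ψ x : ℝ) : ℂ) := by
        filter_upwards [heq ϕ (hKU hz), heq ψ (hKU hz)] with x hx hx'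
        rw [hx, hx']
      rw [h1]
      simp_rw [wirt_congr h3]
    · simp [ha0 _ z hz, hd0 z hz]
  have e3 : ∀ j k, (fun z => ‖s j k z‖ ^ 2 * Real.exp (-(ϕ z * κ z))) =
      fun z => ‖s j k z‖ ^ 2 * Real.exp (-ϕ z) := fun j k => by
    ext z
    by_cases hz : z ∈ K
    · have h1 := (heq ϕ (hKU hz)).eq_of_nhds
      rw [h1]
    · simp [hs0 j k z hz]
  simpa only [e1, e2, e3] using h

theorem MeasureTheory.MemLp.integrable_mul_compact {f g : Cn n → ℂ} (hf : MemLp f 2)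
    (hg : Continuous g)
    (hc : HasCompactSupport g) : Integrable fun z => g z * f z :=
  (hf.locallyIntegrable (by norm_num)).integrable_smul_left_of_hasCompactSupport hg hc

theorem MeasureTheory.MemLp.mul_compact {f g : Cn n → ℂ} (hf : MemLp f 2) (hg : Continuous g)
    (hc : HasCompactSupport g) : MemLp (fun z => g z * f z) 2 := by
  obtain ⟨C, hC⟩ := hc.exists_bound_of_continuous hg
  exact memLp_mul_of_bounded hg hC hf

theorem integral_sum_wirt_mul {Ω : Set (Cn n)} {f : Cn n → ℂ} {γ : Fin n → Cn n → ℂ}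
    (hΩ : IsOpen Ω) (hf : IsTest Ω f) (hγ : ∀ j, IsTest Ω (γ j)) :
    ∫ z, ∑ j, wirt (-I) f (e n j) z * γ j z =
      -∫ z, f z * ∑ j, wirt (-I) (γ j) (e n j) z := by
  have h1 (j : Fin n) : Integrable fun z => wirt (-I) f (e n j) z * γ j z :=
    (hf.continuous_wirt.mul (hγ j).continuous).integrable_of_hasCompactSupport
      (hγ j).compact.mul_left
  have h2 (j : Fin n) : Integrable fun z => f z * wirt (-I) (γ j) (e n j) z :=
    (hf.continuous.mul (hγ j).continuous_wirt).integrable_of_hasCompactSupport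
      (hγ j).compact_wirt.mul_left
  simp_rw [Finset.mul_sum]
  rw [integral_finsetSum _ fun j _ => h1 j, integral_finsetSum _ fun j _ => h2 j,
    ← Finset.sum_neg_distrib]
  refine Finset.sum_congr rfl fun j _ => ?_
  rw [integral_mul_wirt hΩ (hf.contDiff.contDiffOn.of_le (by norm_num))
    ((hγ j).contDiff.of_le (by norm_num)) (hγ j).compact (hγ j).subset, neg_neg]

end LocalEstimate

section CoreEstimate

open Filter Topology

theorem ofReal_exp_neg_half_mul (t : ℝ) :
    cexp ((-(t / 2) : ℝ) : ℂ) * cexp (t : ℂ) = cexp ((t / 2 : ℝ) : ℂ) := by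
  rw [← Complex.exp_add, ← ofReal_add]
  congr 2
  ring

theorem norm_cexp_half_sq (t : ℝ) : ‖cexp ((t / 2 : ℝ) : ℂ)‖ ^ 2 = Real.exp t := by
  rw [norm_exp_ofReal, sq, ← Real.exp_add, add_halves]

variable {Ω S : Set (Cn n)} {Φ ϕ ψ : Cn n → ℝ} {η : ℕ → Cn n → ℝ} {c : ℝ}

theorem cutoff_div_identity (hΩ : IsOpen Ω) {g : Cn n → ℝ} (hg : ContDiffOn ℝ 2 g Ω)
    {h q : Cn n → ℂ} (hh : IsTest Ω h) (hq : IsTest univ q) (p : Fin n → ℂ) (z : Cn n) :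
    ∑ j, cexp ((g z / 2 : ℝ) : ℂ) * h z * p j * wirt (-I) q (e n j) z =
      cexp ((-(g z / 2) : ℝ) : ℂ) *
        ∑ j, wirt (-I) (fun x => cexp (g x : ℂ) * (q x * h x)) (e n j) z * p j -
      q z * ∑ j, (cexp ((g z / 2 : ℝ) : ℂ) * wirt (-I) h (e n j) z +
        cexp ((g z / 2 : ℝ) : ℂ) * (wirt (-I) (fun x => (g x : ℂ)) (e n j) z * h z)) * p j := by
  by_cases hz : z ∈ Ω
  · have hgd : DifferentiableAt ℝ (fun x => (g x : ℂ)) z :=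
      ((hg.contDiffAt (hΩ.mem_nhds hz)).ofReal_comp).differentiableAt (by norm_num)
    rw [Finset.mul_sum, Finset.mul_sum, ← Finset.sum_sub_distrib]
    refine Finset.sum_congr rfl fun j _ => ?_
    rw [wirt_mul hgd.cexp ((hq.differentiable z).fun_mul (hh.differentiable z)),
      wirt_mul (hq.differentiable z) (hh.differentiable z), wirt_cexp hgd,
      ← ofReal_exp_neg_half_mul]
    ring
  · have h0 : z ∉ tsupport h := fun h' => hz (hh.subset h')
    have h1 : z ∉ tsupport fun x => cexp (g x : ℂ) * (q x * h x) := fun h' =>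
      h0 (tsupport_mul_subset_right (tsupport_mul_subset_right h'))
    simp [image_eq_zero_of_notMem_tsupport h0, wirt_eq_zero_of_notMem h0, wirt_eq_zero_of_notMem h1]

theorem contDiffOn_cexp (hg : ContDiffOn ℝ 2 ϕ Ω) : ContDiffOn ℝ 2 (fun z => cexp (ϕ z : ℂ)) Ω :=
  (hg.ofReal_comp).cexp

theorem continuousOn_wirt (hΩ : IsOpen Ω) {f : Cn n → ℂ} (hf : ContDiffOn ℝ 2 f Ω) (s : ℂ)
    (w : Cn n) : ContinuousOn (wirt s f w) Ω := fun z hz =>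
  ((hf.contDiffAt (hΩ.mem_nhds hz)).wirt (by norm_num) :
    ContDiffAt ℝ 1 (wirt s f w) z).continuousAt.continuousWithinAt

theorem weighted_bound_of_cutoff (W : WeightSystem Ω Φ S c ϕ ψ η) (m : ℕ) {γ : Fin n → Cn n → ℂ}
    (hγS : ∀ j, tsupport (γ j) ⊆ S) (p : Fin n → ℂ) (z : Cn n) :
    ‖cexp ((ϕ z - ψ z : ℝ) : ℂ) * (η m z * ∑ j, wirt (-I) (γ j) (e n j) z) +
      ∑ j, cexp (((ϕ z - ψ z) / 2 : ℝ) : ℂ) * wirt (-I) (fun x => (η m x : ℂ)) (e n j) z * p j‖ ^ 2 *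
        Real.exp (-ϕ z) ≤
    ‖∑ j, wirt (-I) (γ j) (e n j) z‖ ^ 2 * Real.exp (Φ z) +
      Real.exp (-ψ z) * (∑ j, ‖wirt I (fun x => (η m x : ℂ)) (e n j) z‖ ^ 2) * ∑ j, ‖p j‖ ^ 2 := by
  by_cases hzS : z ∈ S
  · have h1 : (fun x => (η m x : ℂ)) =ᶠ[𝓝 z] fun _ => 1 := by
      filter_upwards [W.cutoff_eq m z hzS] with x hx
      simp [hx]
    have h2 (s : ℂ) (w : Cn n) : wirt s (fun x => (η m x : ℂ)) w z = 0 := by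
      rw [wirt_congr h1]
      simp [wirt]
    have h3 := h1.eq_of_nhds
    simp only [h2, h3, W.fst_eq z hzS, W.snd_eq z hzS, sub_zero, one_mul, mul_zero, zero_mul,
      Finset.sum_const_zero, add_zero, norm_mul, norm_exp_ofReal, norm_zero]
    rw [mul_pow, sq (Real.exp (Φ z)), Real.exp_neg]
    have := (Real.exp_pos (Φ z)).ne'
    field_simp
    simp
  · have h1 : ∑ j, wirt (-I) (γ j) (e n j) z = 0 :=
      Finset.sum_eq_zero fun j _ => wirt_eq_zero_of_notMem fun h => hzS (hγS j h)
    have hd : DifferentiableAt ℝ (η m) z := (W.contDiff_cutoff m).differentiable (by norm_num) z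
    simp only [h1, mul_zero, zero_add, norm_zero, mul_assoc, ← Finset.mul_sum, norm_mul, mul_pow,
      norm_cexp_half_sq]
    simp only [norm_wirt_ofReal _ hd]
    have h2 := norm_sum_mul_sq_le
      (fun j => wirt (-I) (fun x => (η m x : ℂ)) (e n j) z) p
    have h3 : Real.exp (-ψ z) = Real.exp (ϕ z - ψ z) * Real.exp (-ϕ z) := by
      rw [← Real.exp_add]
      congr 1
      ring
    rw [h3]
    have h4 := mul_le_mul_of_nonneg_left h2
      (mul_pos (Real.exp_pos (ϕ z - ψ z)) (Real.exp_pos (-ϕ z))).le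
    have h5 : (0 : ℝ) ^ 2 * Real.exp (Φ z) = 0 := by simp
    rw [h5]
    linarith

theorem curl_bound (ϕ ψ : Cn n → ℝ) (η : ℕ → Cn n → ℝ) (m : ℕ) (p : Fin n → ℂ) (z : Cn n) :
    ∑ j, ∑ k, ‖cexp (((ϕ z - ψ z) / 2 : ℝ) : ℂ) * wirt I (fun x => (η m x : ℂ)) (e n j) z * p k -
      cexp (((ϕ z - ψ z) / 2 : ℝ) : ℂ) * wirt I (fun x => (η m x : ℂ)) (e n k) z * p j‖ ^ 2 *
        Real.exp (-ϕ z) ≤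
    4 * (Real.exp (-ψ z) * (∑ j, ‖wirt I (fun x => (η m x : ℂ)) (e n j) z‖ ^ 2) *
      ∑ j, ‖p j‖ ^ 2) := by
  set D : Fin n → ℂ := fun j => wirt I (fun x => (η m x : ℂ)) (e n j) z with hD
  have h3 : Real.exp (-ψ z) = Real.exp (ϕ z - ψ z) * Real.exp (-ϕ z) := by
    rw [← Real.exp_add]
    congr 1
    ring
  have h1 (j k : Fin n) : ‖cexp (((ϕ z - ψ z) / 2 : ℝ) : ℂ) * D j * p k -
      cexp (((ϕ z - ψ z) / 2 : ℝ) : ℂ) * D k * p j‖ ^ 2 * Real.exp (-ϕ z) ≤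
      2 * Real.exp (-ψ z) * (‖D j‖ ^ 2 * ‖p k‖ ^ 2 + ‖D k‖ ^ 2 * ‖p j‖ ^ 2) := by
    have := mul_le_mul_of_nonneg_right (norm_sub_sq_le
      (cexp (((ϕ z - ψ z) / 2 : ℝ) : ℂ) * D j * p k)
      (cexp (((ϕ z - ψ z) / 2 : ℝ) : ℂ) * D k * p j)) (Real.exp_pos (-ϕ z)).le
    refine this.trans (le_of_eq ?_)
    simp only [norm_mul, mul_pow, norm_cexp_half_sq, h3]
    ring
  refine (Finset.sum_le_sum fun j _ => Finset.sum_le_sum fun k _ => h1 j k).trans (le_of_eq ?_)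
  simp only [← Finset.mul_sum, Finset.sum_add_distrib, ← Finset.sum_mul]
  ring

theorem continuous_half_weight_mul_wirt (hΩ : IsOpen Ω) {g : Cn n → ℝ} (hg : ContDiffOn ℝ 2 g Ω)
    {h : Cn n → ℂ} (hh : IsTest Ω h) (s : ℂ) (w : Cn n) :
    Continuous fun z => cexp ((g z / 2 : ℝ) : ℂ) * wirt s h w z :=
  continuous_mul_of_tsupport hΩ (contDiffOn_cexp (hg.div_const 2)).continuousOn hh.continuous_wirt
    hh.tsupport_wirt

theorem continuous_half_weight_mul_add (hΩ : IsOpen Ω) {g : Cn n → ℝ} (hg : ContDiffOn ℝ 2 g Ω)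
    {h : Cn n → ℂ} (hh : IsTest Ω h) (s : ℂ) (w : Cn n) :
    Continuous fun z => cexp ((g z / 2 : ℝ) : ℂ) * wirt s h w z +
      cexp ((g z / 2 : ℝ) : ℂ) * (wirt s (fun x => (g x : ℂ)) w z * h z) :=
  (continuous_half_weight_mul_wirt hΩ hg hh s w).add
    (continuous_mul_of_tsupport hΩ (contDiffOn_cexp (hg.div_const 2)).continuousOn
      (continuous_mul_of_tsupport hΩ (continuousOn_wirt hΩ hg.ofReal_comp _ _) hh.continuous hh.subset)
      (tsupport_mul_subset_right.trans hh.subset))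

theorem IsTest.integrable_mul {f D : Cn n → ℂ} (hf : IsTest Ω f) (hD : Continuous D) :
    Integrable fun z => f z * D z := by
  have h : Continuous fun z => f z * D z := hf.continuous.mul hD
  have hc : HasCompactSupport fun z => f z * D z := hf.compact.mul_right
  exact h.integrable_of_hasCompactSupport hc

theorem IsTest.integrable_sum_wirt_mul (hΩ : IsOpen Ω) {f a : Cn n → ℂ} (hf : IsTest Ω f)
    (ha : ContinuousOn a Ω) (s : ℂ) {p : Fin n → Cn n → ℂ} (hp : ∀ j, MemLp (p j) 2) :
    Integrable fun z => a z * ∑ j, wirt s f (e n j) z * p j z := by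
  have hc (j : Fin n) : Continuous fun z => a z * wirt s f (e n j) z :=
    continuous_mul_of_tsupport hΩ ha hf.continuous_wirt hf.tsupport_wirt
  have hs (j : Fin n) : HasCompactSupport fun z => a z * wirt s f (e n j) z :=
    hf.compact_wirt.mul_left
  have hi := integrable_finsetSum Finset.univ fun j _ => (hp j).integrable_mul_compact (hc j) (hs j)
  refine hi.congr (ae_of_all _ fun z => ?_)
  simp only [Finset.mul_sum, mul_assoc]

theorem cutoff_div (hΩ : IsOpen Ω) {g : Cn n → ℝ} (hg : ContDiffOn ℝ 2 g Ω)
    {h q : Cn n → ℂ} (hh : IsTest Ω h) (hq : IsTest univ q)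
    {p : Fin n → Cn n → ℂ} (hp : ∀ j, MemLp (p j) 2) {γ : Fin n → Cn n → ℂ}
    (hγ : ∀ j, IsTest Ω (γ j))
    (hdiv : ∀ f, IsTest Ω f → ∫ z, cexp ((-(g z / 2) : ℝ) : ℂ) *
      ∑ j, wirt (-I) f (e n j) z * p j z = ∫ z, ∑ j, wirt (-I) f (e n j) z * γ j z) :
    ∫ z, ∑ j, cexp ((g z / 2 : ℝ) : ℂ) * h z * p j z * wirt (-I) q (e n j) z =
      -∫ z, (cexp (g z : ℂ) * (h z * ∑ j, wirt (-I) (γ j) (e n j) z) +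
        ∑ j, (cexp ((g z / 2 : ℝ) : ℂ) * wirt (-I) h (e n j) z +
          cexp ((g z / 2 : ℝ) : ℂ) * (wirt (-I) (fun x => (g x : ℂ)) (e n j) z * h z)) * p j z) *
            q z := by
  have hf : IsTest Ω fun z => cexp (g z : ℂ) * (q z * h z) :=
    (hh.mul_left hΩ hq.contDiff.contDiffOn).mul_left hΩ (contDiffOn_cexp hg)
  have e1 := hdiv _ hf
  rw [integral_sum_wirt_mul hΩ hf hγ] at e1
  have hTC (j : Fin n) := continuous_half_weight_mul_add hΩ hg hh (-I) (e n j)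
  have i1 : Integrable fun z => q z * ∑ j, (cexp ((g z / 2 : ℝ) : ℂ) * wirt (-I) h (e n j) z +
      cexp ((g z / 2 : ℝ) : ℂ) * (wirt (-I) (fun x => (g x : ℂ)) (e n j) z * h z)) * p j z := by
    have hc (j : Fin n) : Continuous fun z => q z * (cexp ((g z / 2 : ℝ) : ℂ) *
        wirt (-I) h (e n j) z + cexp ((g z / 2 : ℝ) : ℂ) *
          (wirt (-I) (fun x => (g x : ℂ)) (e n j) z * h z)) := hq.continuous.mul (hTC j)
    have hs (j : Fin n) : HasCompactSupport fun z => q z * (cexp ((g z / 2 : ℝ) : ℂ) *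
        wirt (-I) h (e n j) z + cexp ((g z / 2 : ℝ) : ℂ) *
          (wirt (-I) (fun x => (g x : ℂ)) (e n j) z * h z)) := hq.compact.mul_right
    have hi := integrable_finsetSum Finset.univ fun j _ => (hp j).integrable_mul_compact (hc j) (hs j)
    refine hi.congr (ae_of_all _ fun z => ?_)
    simp only [Finset.mul_sum, mul_assoc]
  have i2 : Integrable fun z => cexp (g z : ℂ) * (q z * h z) * ∑ j, wirt (-I) (γ j) (e n j) z :=
    hf.integrable_mul (D := fun z => ∑ j, wirt (-I) (γ j) (e n j) z)
      (continuous_finsetSum _ fun j _ => (hγ j).continuous_wirt)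
  have i3 : Integrable fun z => cexp ((-(g z / 2) : ℝ) : ℂ) *
      ∑ j, wirt (-I) (fun z => cexp (g z : ℂ) * (q z * h z)) (e n j) z * p j z :=
    hf.integrable_sum_wirt_mul hΩ (contDiffOn_cexp (hg.div_const 2).neg).continuousOn (-I) hp
  rw [integral_congr_ae (ae_of_all _ fun z =>
    cutoff_div_identity hΩ hg hh hq (fun j => p j z) z), integral_sub i3 i1, e1, ← neg_add',
    ← integral_add i2 i1]
  congr 2
  ext z
  ring

theorem cutoff_curl (hΩ : IsOpen Ω) {g : Cn n → ℝ} (hg : ContDiffOn ℝ 2 g Ω)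
    {h q : Cn n → ℂ} (hh : IsTest Ω h) (hq : IsTest univ q)
    {p : Fin n → Cn n → ℂ} (hp : ∀ j, MemLp (p j) 2)
    (hcurl : ∀ q, IsTest Ω q → ∀ j k, ∫ z, cexp ((g z / 2 : ℝ) : ℂ) *
      (p k z * wirt I q (e n j) z - p j z * wirt I q (e n k) z) = 0) (j k : Fin n) :
    ∫ z, (cexp ((g z / 2 : ℝ) : ℂ) * h z * p k z * wirt I q (e n j) z -
        cexp ((g z / 2 : ℝ) : ℂ) * h z * p j z * wirt I q (e n k) z) =
      -∫ z, (cexp ((g z / 2 : ℝ) : ℂ) * wirt I h (e n j) z * p k z -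
        cexp ((g z / 2 : ℝ) : ℂ) * wirt I h (e n k) z * p j z) * q z := by
  have hf : IsTest Ω fun z => q z * h z := hh.mul_left hΩ hq.contDiff.contDiffOn
  have e1 := hcurl _ hf j k
  have hXh : IsTest Ω fun z => cexp ((g z / 2 : ℝ) : ℂ) * h z :=
    hh.mul_left hΩ (contDiffOn_cexp (hg.div_const 2))
  have hXw (j : Fin n) := continuous_half_weight_mul_wirt hΩ hg hh I (e n j)
  have i1 (j k : Fin n) : Integrable fun z =>
      cexp ((g z / 2 : ℝ) : ℂ) * h z * p k z * wirt I q (e n j) z := by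
    refine ((hp k).integrable_mul_compact
      ((hq.continuous_wirt (s := I) (w := e n j)).mul hXh.continuous) hXh.compact.mul_left).congr
      (ae_of_all _ fun z => ?_)
    simp only [Pi.mul_apply]
    ring
  have i2 (j k : Fin n) : Integrable fun z =>
      cexp ((g z / 2 : ℝ) : ℂ) * wirt I h (e n j) z * p k z * q z := by
    refine ((hp k).integrable_mul_compact (hq.continuous.mul (hXw j)) hq.compact.mul_right).congr
      (ae_of_all _ fun z => ?_)
    simp only [Pi.mul_apply]
    ring
  have i3 : Integrable fun z => cexp ((g z / 2 : ℝ) : ℂ) * h z * p k z * wirt I q (e n j) z -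
      cexp ((g z / 2 : ℝ) : ℂ) * h z * p j z * wirt I q (e n k) z := (i1 j k).sub (i1 k j)
  have i4 : Integrable fun z => (cexp ((g z / 2 : ℝ) : ℂ) * wirt I h (e n j) z * p k z -
      cexp ((g z / 2 : ℝ) : ℂ) * wirt I h (e n k) z * p j z) * q z := by
    simp_rw [sub_mul]
    exact (i2 j k).sub (i2 k j)
  rw [eq_neg_iff_add_eq_zero, ← integral_add i3 i4, ← e1]
  congr 1
  ext z
  rw [wirt_mul (hq.differentiable z) (hh.differentiable z),
    wirt_mul (hq.differentiable z) (hh.differentiable z)]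
  ring

theorem integrable_cutoff_error (hΩ : IsOpen Ω) (hψ : ContDiffOn ℝ 2 ψ Ω) {h : Cn n → ℂ}
    (hh : IsTest Ω h) {P : Cn n → ℝ} (hP : Integrable P) :
    Integrable fun z => Real.exp (-ψ z) * (∑ j, ‖wirt I h (e n j) z‖ ^ 2) * P z := by
  set v : Cn n → ℂ := fun z => cexp ((-ψ z : ℝ) : ℂ) *
    (((∑ j, ‖wirt I h (e n j) z‖ ^ 2 : ℝ)) : ℂ) with hv
  have hvs : Function.support (fun z => (((∑ j, ‖wirt I h (e n j) z‖ ^ 2 : ℝ)) : ℂ)) ⊆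
      tsupport h := fun z hz => by_contra fun h' => hz (by simp [wirt_eq_zero_of_notMem h'])
  have hvt := closure_minimal hvs (isClosed_tsupport h)
  have hvC : Continuous v := continuous_mul_of_tsupport hΩ (contDiffOn_cexp hψ.neg).continuousOn
    (continuous_ofReal.comp (continuous_finsetSum _ fun j _ => hh.continuous_wirt.norm.pow 2))
    (hvt.trans hh.subset)
  have hvc : HasCompactSupport v :=
    HasCompactSupport.mul_left (hh.compact.of_isClosed_subset isClosed_closure hvt)
  obtain ⟨C, hC⟩ := hvc.exists_bound_of_continuous hvC
  have := hP.bdd_mul (c := C) hvC.norm.aestronglyMeasurable (ae_of_all _ fun z => by simpa using hC z)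
  refine this.congr (ae_of_all _ fun z => ?_)
  simp only [hv, norm_mul, norm_exp_ofReal, norm_real, Real.norm_eq_abs]
  rw [abs_of_nonneg (Finset.sum_nonneg fun j _ => sq_nonneg _)]

theorem integrable_divergence_weight (hΩ : IsOpen Ω) (W : WeightSystem Ω Φ S c ϕ ψ η)
    {γ : Fin n → Cn n → ℂ} (hγ : ∀ j, IsTest Ω (γ j)) (hγS : ∀ j, tsupport (γ j) ⊆ S) :
    Integrable fun z => ‖∑ j, wirt (-I) (γ j) (e n j) z‖ ^ 2 * Real.exp (Φ z) := by
  have hfS : ∀ z ∉ ⋃ j, tsupport (γ j), ∑ j, wirt (-I) (γ j) (e n j) z = 0 := fun z hz =>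
    Finset.sum_eq_zero fun j _ => wirt_eq_zero_of_notMem fun h => hz (mem_iUnion.2 ⟨j, h⟩)
  have hcl : IsClosed (⋃ j, tsupport (γ j)) := isClosed_iUnion_of_finite fun j => isClosed_tsupport _
  have hts : tsupport (fun z => ∑ j, wirt (-I) (γ j) (e n j) z) ⊆ ⋃ j, tsupport (γ j) :=
    closure_minimal (fun z hz => by_contra fun h => hz (hfS z h)) hcl
  have hc : HasCompactSupport fun z => ∑ j, wirt (-I) (γ j) (e n j) z :=
    HasCompactSupport.intro (isCompact_iUnion fun j => (hγ j).compact) hfS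
  have hD : Continuous fun z => ∑ j, wirt (-I) (γ j) (e n j) z :=
    continuous_finsetSum _ fun j _ => (hγ j).continuous_wirt
  have h1 : Continuous fun z => cexp ((ϕ z / 2 : ℝ) : ℂ) * ∑ j, wirt (-I) (γ j) (e n j) z :=
    continuous_mul_of_tsupport hΩ (contDiffOn_cexp (W.contDiffOn_fst.div_const 2)).continuousOn hD
      (hts.trans (iUnion_subset fun j => (hγ j).subset))
  have h2 := (h1.memLp_of_hasCompactSupport (p := 2) (μ := volume) hc.mul_left).integrable_norm_pow
    (by norm_num)
  refine h2.congr (ae_of_all _ fun z => ?_)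
  by_cases hz : z ∈ S
  · simp only [norm_mul, mul_pow, norm_cexp_half_sq, W.fst_eq z hz, mul_comm]
  · simp [hfS z fun h => hz (iUnion_subset hγS h)]

theorem integrable_curl_term (hΩ : IsOpen Ω) (hϕ : ContDiffOn ℝ 2 ϕ Ω) (hψ : ContDiffOn ℝ 2 ψ Ω)
    {h : Cn n → ℂ} (hh : IsTest Ω h) {p : Fin n → Cn n → ℂ} (hp : ∀ j, MemLp (p j) 2)
    (j k : Fin n) :
    Integrable fun z => ‖cexp (((ϕ z - ψ z) / 2 : ℝ) : ℂ) * wirt I h (e n j) z * p k z -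
      cexp (((ϕ z - ψ z) / 2 : ℝ) : ℂ) * wirt I h (e n k) z * p j z‖ ^ 2 * Real.exp (-ϕ z) := by
  set V : Cn n → ℂ := fun z => cexp ((-ϕ z / 2 : ℝ) : ℂ) with hV
  set X : Cn n → ℂ := fun z => cexp (((ϕ z - ψ z) / 2 : ℝ) : ℂ)
  have hVw (w : Cn n) : Continuous fun z => V z * (X z * wirt I h w z) :=
    continuous_mul_of_tsupport hΩ (contDiffOn_cexp (hϕ.neg.div_const 2)).continuousOn
      (continuous_half_weight_mul_wirt hΩ (hϕ.sub hψ) hh I w)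
      (tsupport_mul_subset_right.trans hh.tsupport_wirt)
  have hVc (w : Cn n) : HasCompactSupport fun z => V z * (X z * wirt I h w z) :=
    hh.compact_wirt.mul_left.mul_left
  have h1 : MemLp (fun z => V z * (X z * wirt I h (e n j) z) * p k z -
      V z * (X z * wirt I h (e n k) z) * p j z) 2 :=
    ((hp k).mul_compact (hVw _) (hVc _)).sub ((hp j).mul_compact (hVw _) (hVc _))
  refine (h1.integrable_norm_pow (by norm_num)).congr (ae_of_all _ fun z => ?_)
  have : V z * (X z * wirt I h (e n j) z) * p k z - V z * (X z * wirt I h (e n k) z) * p j z =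
    V z * (X z * wirt I h (e n j) z * p k z - X z * wirt I h (e n k) z * p j z) := by ring
  dsimp only
  rw [this]
  simp only [norm_mul, mul_pow, hV, norm_cexp_half_sq]
  ring

theorem core_memLp_div (hΩ : IsOpen Ω) {g : Cn n → ℝ} (hg : ContDiffOn ℝ 2 g Ω)
    {h : Cn n → ℂ} (hh : IsTest Ω h) {p : Fin n → Cn n → ℂ} (hp : ∀ j, MemLp (p j) 2)
    {γ : Fin n → Cn n → ℂ} (hγ : ∀ j, IsTest Ω (γ j)) :
    MemLp (fun z => cexp (g z : ℂ) * (h z * ∑ j, wirt (-I) (γ j) (e n j) z) +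
      ∑ j, (cexp ((g z / 2 : ℝ) : ℂ) * wirt (-I) h (e n j) z +
        cexp ((g z / 2 : ℝ) : ℂ) * (wirt (-I) (fun x => (g x : ℂ)) (e n j) z * h z)) * p j z) 2 := by
  have hD : Continuous fun z => ∑ j, wirt (-I) (γ j) (e n j) z :=
    continuous_finsetSum _ fun j _ => (hγ j).continuous_wirt
  have h1 : Continuous fun z => cexp (g z : ℂ) * (h z * ∑ j, wirt (-I) (γ j) (e n j) z) :=
    continuous_mul_of_tsupport hΩ (contDiffOn_cexp hg).continuousOn (hh.continuous.mul hD)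
      (tsupport_mul_subset_left.trans hh.subset)
  exact (h1.memLp_of_hasCompactSupport hh.compact.mul_right.mul_left).add
    (memLp_finsetSum _ fun j _ => (hp j).mul_compact
      (continuous_half_weight_mul_add hΩ hg hh (-I) (e n j))
      (hh.compact_wirt.mul_left.add hh.compact.mul_left.mul_left))

theorem core_step (hΩ : IsOpen Ω) (W : WeightSystem Ω Φ S c ϕ ψ η) (m : ℕ)
    {p : Fin n → Cn n → ℂ} (hp : ∀ j, MemLp (p j) 2) {γ : Fin n → Cn n → ℂ}
    (hγ : ∀ j, IsTest Ω (γ j)) (hγS : ∀ j, tsupport (γ j) ⊆ S)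
    (hcurl : ∀ q, IsTest Ω q → ∀ j k, ∫ z, cexp (((ϕ z - ψ z) / 2 : ℝ) : ℂ) *
      (p k z * wirt I q (e n j) z - p j z * wirt I q (e n k) z) = 0)
    (hdiv : ∀ f, IsTest Ω f → ∫ z, cexp ((-((ϕ z - ψ z) / 2) : ℝ) : ℂ) *
      ∑ j, wirt (-I) f (e n j) z * p j z = ∫ z, ∑ j, wirt (-I) f (e n j) z * γ j z) :
    c * ∑ j, ∫ z, η m z ^ 2 * ‖p j z‖ ^ 2 ≤
      2 * (∫ z, ‖∑ j, wirt (-I) (γ j) (e n j) z‖ ^ 2 * Real.exp (Φ z)) +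
      4 * ∫ z, Real.exp (-ψ z) * (∑ j, ‖wirt I (fun x => (η m x : ℂ)) (e n j) z‖ ^ 2) *
        ∑ j, ‖p j z‖ ^ 2 := by
  set h : Cn n → ℂ := fun x => (η m x : ℂ) with hh_def
  have hs : tsupport h ⊆ tsupport (η m) := closure_mono fun z hz hz' => hz (by simp [hh_def, hz'])
  have hh : IsTest Ω h := ⟨(W.contDiff_cutoff m).ofReal_comp,
    (W.compact_cutoff m).of_isClosed_subset (isClosed_tsupport _) hs, hs.trans (W.tsupport_cutoff m)⟩
  have hg : ContDiffOn ℝ 2 (fun z => ϕ z - ψ z) Ω := W.contDiffOn_fst.sub W.contDiffOn_snd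
  have ha (j : Fin n) : MemLp (fun z => cexp (((ϕ z - ψ z) / 2 : ℝ) : ℂ) * h z * p j z) 2 :=
    have hXh : IsTest Ω fun z => cexp (((ϕ z - ψ z) / 2 : ℝ) : ℂ) * h z :=
      hh.mul_left hΩ (contDiffOn_cexp (hg.div_const 2))
    (hp j).mul_compact hXh.continuous hXh.compact
  have hd := core_memLp_div hΩ hg hh hp hγ
  have hs2 (j k : Fin n) : MemLp (fun z => cexp (((ϕ z - ψ z) / 2 : ℝ) : ℂ) * wirt I h (e n j) z * p k z -
      cexp (((ϕ z - ψ z) / 2 : ℝ) : ℂ) * wirt I h (e n k) z * p j z) 2 :=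
    ((hp k).mul_compact (continuous_half_weight_mul_wirt hΩ hg hh I _) hh.compact_wirt.mul_left).sub
      ((hp j).mul_compact (continuous_half_weight_mul_wirt hΩ hg hh I _) hh.compact_wirt.mul_left)
  have h0 : ∀ z ∉ tsupport h, h z = 0 := fun z hz => image_eq_zero_of_notMem_tsupport hz
  have hw0 (s : ℂ) (w : Cn n) : ∀ z ∉ tsupport h, wirt s h w z = 0 := fun z hz =>
    wirt_eq_zero_of_notMem hz
  have key := weak_basic_estimate_on hΩ W.contDiffOn_fst W.contDiffOn_snd W.levi
    (K := tsupport h) hh.compact hh.subset ha hd hs2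
    (fun j z hz => by simp [h0 z hz]) (fun z hz => by simp [h0 z hz, hw0 _ _ z hz])
    (fun j k z hz => by simp [hw0 _ _ z hz])
    (fun q hq => cutoff_div hΩ hg hh hq hp hγ hdiv)
    (fun q hq j k => cutoff_curl hΩ hg hh hq hp hcurl j k)
  have hP : Integrable fun z => ∑ j, ‖p j z‖ ^ 2 :=
    integrable_finsetSum _ fun j _ => (hp j).integrable_norm_pow (by norm_num)
  have hτ := integrable_cutoff_error hΩ W.contDiffOn_snd hh hP
  have hDΦ := integrable_divergence_weight hΩ W hγ hγS
  have k1 : ∀ j, (fun z => ‖cexp (((ϕ z - ψ z) / 2 : ℝ) : ℂ) * h z * p j z‖ ^ 2 * Real.exp (ψ z - ϕ z)) =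
      fun z => η m z ^ 2 * ‖p j z‖ ^ 2 := fun j => by
    ext z
    simp only [hh_def, norm_mul, mul_pow, norm_cexp_half_sq, norm_real, Real.norm_eq_abs, sq_abs]
    rw [← neg_sub (ϕ z), Real.exp_neg]
    have := (Real.exp_pos (ϕ z - ψ z)).ne'
    field_simp
  have k2 : ∫ z, ‖cexp ((ϕ z - ψ z : ℝ) : ℂ) * (h z * ∑ j, wirt (-I) (γ j) (e n j) z) +
      ∑ j, (cexp (((ϕ z - ψ z) / 2 : ℝ) : ℂ) * wirt (-I) h (e n j) z +
        cexp (((ϕ z - ψ z) / 2 : ℝ) : ℂ) *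
          (wirt (-I) (fun x => ((ϕ x - ψ x : ℝ) : ℂ)) (e n j) z * h z)) * p j z -
      ∑ j, wirt (-I) (fun x => ((ϕ x - ψ x : ℝ) : ℂ)) (e n j) z *
        (cexp (((ϕ z - ψ z) / 2 : ℝ) : ℂ) * h z * p j z)‖ ^ 2 * Real.exp (-ϕ z) ≤
      (∫ z, ‖∑ j, wirt (-I) (γ j) (e n j) z‖ ^ 2 * Real.exp (Φ z)) +
      ∫ z, Real.exp (-ψ z) * (∑ j, ‖wirt I h (e n j) z‖ ^ 2) * ∑ j, ‖p j z‖ ^ 2 := by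
    rw [← integral_add hDΦ hτ]
    refine integral_mono_of_nonneg (ae_of_all _ fun z => by positivity) (hDΦ.add hτ)
      (ae_of_all _ fun z => ?_)
    refine le_trans (le_of_eq ?_) (weighted_bound_of_cutoff W m hγS (fun j => p j z) z)
    dsimp only
    congr 3
    rw [add_sub_assoc, ← Finset.sum_sub_distrib]
    congr 1
    refine Finset.sum_congr rfl fun j _ => ?_
    ring
  have k3 : ∑ j, ∑ k, ∫ z, ‖cexp (((ϕ z - ψ z) / 2 : ℝ) : ℂ) * wirt I h (e n j) z * p k z -
      cexp (((ϕ z - ψ z) / 2 : ℝ) : ℂ) * wirt I h (e n k) z * p j z‖ ^ 2 * Real.exp (-ϕ z) ≤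
      4 * ∫ z, Real.exp (-ψ z) * (∑ j, ‖wirt I h (e n j) z‖ ^ 2) * ∑ j, ‖p j z‖ ^ 2 := by
    have hi (j k : Fin n) := integrable_curl_term hΩ W.contDiffOn_fst W.contDiffOn_snd hh hp j k
    simp_rw [← integral_finsetSum _ fun k _ => hi _ k]
    rw [← integral_finsetSum _ fun j _ => integrable_finsetSum _ fun k _ => hi j k,
      ← integral_const_mul]
    exact integral_mono (integrable_finsetSum _ fun j _ => integrable_finsetSum _ fun k _ => hi j k)
      (hτ.const_mul 4) fun z => curl_bound ϕ ψ η m (fun j => p j z) z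
  simp only [k1] at key
  linarith

theorem core_estimate (hΩ : IsOpen Ω) (W : WeightSystem Ω Φ S c ϕ ψ η)
    {p : Fin n → Cn n → ℂ} (hp : ∀ j, MemLp (p j) 2) {γ : Fin n → Cn n → ℂ}
    (hγ : ∀ j, IsTest Ω (γ j)) (hγS : ∀ j, tsupport (γ j) ⊆ S)
    (hcurl : ∀ q, IsTest Ω q → ∀ j k, ∫ z, cexp (((ϕ z - ψ z) / 2 : ℝ) : ℂ) *
      (p k z * wirt I q (e n j) z - p j z * wirt I q (e n k) z) = 0)
    (hdiv : ∀ f, IsTest Ω f → ∫ z, cexp ((-((ϕ z - ψ z) / 2) : ℝ) : ℂ) *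
      ∑ j, wirt (-I) f (e n j) z * p j z = ∫ z, ∑ j, wirt (-I) f (e n j) z * γ j z) :
    c * ∑ j, ∫ z in Ω, ‖p j z‖ ^ 2 ≤
      2 * (∫ z, ‖∑ j, wirt (-I) (γ j) (e n j) z‖ ^ 2 * Real.exp (Φ z)) := by
  have hpi (j : Fin n) : Integrable fun z => ‖p j z‖ ^ 2 := (hp j).integrable_norm_pow (by norm_num)
  have hP : Integrable fun z => ∑ j, ‖p j z‖ ^ 2 := integrable_finsetSum _ fun j _ => hpi j
  have hs (m : ℕ) : tsupport (fun x => (η m x : ℂ)) ⊆ tsupport (η m) :=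
    closure_mono fun z hz hz' => hz (by simp [hz'])
  have hη0 (m : ℕ) {z : Cn n} (hz : z ∉ Ω) : η m z = 0 :=
    image_eq_zero_of_notMem_tsupport fun h => hz (W.tsupport_cutoff m h)
  have hw0 (m : ℕ) {z : Cn n} (hz : z ∉ Ω) (j : Fin n) :
      wirt I (fun x => (η m x : ℂ)) (e n j) z = 0 :=
    wirt_eq_zero_of_notMem fun h => hz (W.tsupport_cutoff m (hs m h))
  have hh (m : ℕ) : IsTest Ω fun x => (η m x : ℂ) := ⟨(W.contDiff_cutoff m).ofReal_comp,
    (W.compact_cutoff m).of_isClosed_subset (isClosed_tsupport _) (hs m),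
    (hs m).trans (W.tsupport_cutoff m)⟩
  have l1 (j : Fin n) : Tendsto (fun m => ∫ z, η m z ^ 2 * ‖p j z‖ ^ 2) atTop
      (𝓝 (∫ z in Ω, ‖p j z‖ ^ 2)) := by
    rw [← integral_indicator hΩ.measurableSet]
    refine tendsto_integral_of_dominated_convergence (fun z => ‖p j z‖ ^ 2) (fun m => ?_) (hpi j)
      (fun m => ae_of_all _ fun z => ?_) (ae_of_all _ fun z => ?_)
    · exact ((W.contDiff_cutoff m).continuous.pow 2).aestronglyMeasurable.mul
        (hpi j).aestronglyMeasurable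
    · have := W.cutoff_mem m z
      rw [norm_mul, norm_pow, norm_pow, norm_norm, Real.norm_eq_abs, abs_of_nonneg this.1]
      exact mul_le_of_le_one_left (sq_nonneg _) (pow_le_one₀ this.1 this.2)
    · by_cases hz : z ∈ Ω
      · rw [indicator_of_mem hz]
        refine tendsto_const_nhds.congr' ?_
        filter_upwards [W.cutoff_tendsto z hz] with m hm
        simp [hm.eq_of_nhds]
      · rw [indicator_of_notMem hz]
        exact tendsto_const_nhds.congr fun m => by simp [hη0 m hz]
  have l2 : Tendsto (fun m => ∫ z, Real.exp (-ψ z) *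
      (∑ j, ‖wirt I (fun x => (η m x : ℂ)) (e n j) z‖ ^ 2) * ∑ j, ‖p j z‖ ^ 2) atTop
      (𝓝 (∫ _ : Cn n, (0 : ℝ))) := by
    refine tendsto_integral_of_dominated_convergence (fun z => ∑ j, ‖p j z‖ ^ 2) (fun m => ?_) hP
      (fun m => ae_of_all _ fun z => ?_) (ae_of_all _ fun z => ?_)
    · exact (integrable_cutoff_error hΩ W.contDiffOn_snd (hh m) hP).aestronglyMeasurable
    · have h0 : (0 : ℝ) ≤ ∑ j, ‖wirt I (fun x => (η m x : ℂ)) (e n j) z‖ ^ 2 :=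
        Finset.sum_nonneg fun j _ => sq_nonneg _
      have h1 : (0 : ℝ) ≤ ∑ j, ‖p j z‖ ^ 2 := Finset.sum_nonneg fun j _ => sq_nonneg _
      rw [Real.norm_eq_abs, abs_of_nonneg (mul_nonneg (mul_nonneg (Real.exp_pos _).le h0) h1)]
      refine mul_le_of_le_one_left h1 ?_
      by_cases hz : z ∈ Ω
      · refine (mul_le_mul_of_nonneg_left (W.norm_dbar_cutoff m z hz) (Real.exp_pos _).le).trans ?_
        rw [← Real.exp_add, neg_add_cancel, Real.exp_zero]
      · simp [hw0 m hz]
    · refine tendsto_const_nhds.congr' ?_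
      by_cases hz : z ∈ Ω
      · filter_upwards [W.cutoff_tendsto z hz] with m hm
        have h1 : (fun x => (η m x : ℂ)) =ᶠ[𝓝 z] fun _ => 1 := by
          filter_upwards [hm] with x hx
          simp [hx]
        simp only [wirt_congr h1]
        simp [wirt]
      · exact Eventually.of_forall fun m => by simp [hw0 m hz]
  have l3 := (tendsto_finsetSum Finset.univ fun j _ => l1 j).const_mul c
  have l4 := (l2.const_mul 4).const_add
    (2 * (∫ z, ‖∑ j, wirt (-I) (γ j) (e n j) z‖ ^ 2 * Real.exp (Φ z)))
  refine (le_of_tendsto_of_tendsto' l3 l4 fun m => core_step hΩ W m hp hγ hγS hcurl hdiv).trans ?_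
  simp

end CoreEstimate

section Weyl

open Filter Topology

theorem differentiableAt_of_wirt_eq_zero {f : Cn n → ℂ} {z : Cn n} (hf : DifferentiableAt ℝ f z)
    (h0 : ∀ j, wirt I f (e n j) z = 0) : DifferentiableAt ℂ f z := by
  set D := fderiv ℝ f z with hD
  have hI (j : Fin n) : D (I • e n j) = I * D (e n j) := by
    have := h0 j
    simp only [wirt, ← hD] at this
    have h2 : D (e n j) + I * D (I • e n j) = 0 := by linear_combination 2 * this
    linear_combination (-I) * h2 + D (I • e n j) * I_mul_I
  have hc (c : ℂ) (j : Fin n) : D (c • e n j) = c * D (e n j) := by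
    have : c • e n j = c.re • e n j + c.im • (I • e n j) := by
      conv_lhs => rw [← re_add_im c, add_smul, mul_smul]
      rfl
    rw [this, map_add, map_smul, map_smul, hI]
    conv_rhs => rw [← re_add_im c]
    simp only [real_smul]
    ring
  have hlin : (∑ j, (EuclideanSpace.proj j : Cn n →L[ℂ] ℂ).smulRight (D (e n j))).restrictScalars ℝ
      = D := by
    ext w
    conv_rhs => rw [eq_sum_e w, map_sum]
    simp [hc]
  have := hasFDerivAt_of_restrictScalars ℝ (hD ▸ hf.hasFDerivAt) hlin
  exact this.differentiableAt

theorem wirt_I_eq_zero {f : Cn n → ℂ} {z : Cn n} (hf : DifferentiableAt ℂ f z) (w : Cn n) :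
    wirt I f w z = 0 := by
  rw [wirt, (hf.hasFDerivAt.restrictScalars ℝ).fderiv]
  simp only [ContinuousLinearMap.coe_restrictScalars', map_smul, smul_eq_mul]
  linear_combination (1 / 2 * fderiv ℂ f z w) * I_mul_I

theorem norm_sq_toLp {α : Type*} [MeasurableSpace α] {μ : Measure α} {v : α → ℂ}
    (hv : MemLp v 2 μ) : ‖hv.toLp‖ ^ 2 = ∫ x, ‖v x‖ ^ 2 ∂μ := by
  have h : inner ℂ hv.toLp hv.toLp = ((∫ x, ‖v x‖ ^ 2 ∂μ : ℝ) : ℂ) := by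
    rw [L2.inner_def, ← integral_complex_ofReal]
    refine integral_congr_ae ?_
    filter_upwards [hv.coeFn_toLp] with x hx
    rw [hx, inner_self_eq_norm_sq_to_K]
    simp
  rw [inner_self_eq_norm_sq_to_K] at h
  refine ofReal_injective ?_
  rw [ofReal_pow]
  exact h

theorem norm_sq_integral_mul_le {α : Type*} [MeasurableSpace α] {μ : Measure α} {u g : α → ℂ}
    (hu : MemLp u 2 μ) (hg : MemLp g 2 μ) :
    ‖∫ x, u x * g x ∂μ‖ ^ 2 ≤ (∫ x, ‖u x‖ ^ 2 ∂μ) * ∫ x, ‖g x‖ ^ 2 ∂μ := by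
  have hu' : MemLp (fun x => conj (u x)) 2 μ := hu.star
  have h : inner ℂ hu'.toLp hg.toLp = ∫ x, u x * g x ∂μ := by
    rw [L2.inner_def]
    refine integral_congr_ae ?_
    filter_upwards [hu'.coeFn_toLp, hg.coeFn_toLp] with x hx hy
    rw [hx, hy, RCLike.inner_apply]
    simp [mul_comm]
  have h2 : ∫ x, ‖u x‖ ^ 2 ∂μ = ‖hu'.toLp‖ ^ 2 := by
    rw [norm_sq_toLp]
    simp
  rw [h2, ← norm_sq_toLp hg, ← h, ← mul_pow]
  exact pow_le_pow_left₀ (norm_nonneg _) (norm_inner_le_norm _ _) 2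

theorem integral_circle_eq {F : Cn n → ℂ} {x y : Cn n} {R : ℝ}
    (hF : DifferentiableOn ℂ F (ball x R)) (hy : ‖y‖ < R) :
    ∫ θ in (0 : ℝ)..2 * Real.pi, F (x - cexp (θ * I) • y) = 2 * Real.pi * F x := by
  have hm (l : ℂ) (hl : ‖l‖ ≤ 1) : x - l • y ∈ ball x R := by
    rw [mem_ball, dist_eq_norm, sub_sub_cancel_left, norm_neg, norm_smul]
    exact (mul_le_of_le_one_left (norm_nonneg _) hl).trans_lt hy
  have hg : DiffContOnCl ℂ (fun l : ℂ => F (x - l • y)) (ball 0 |1|) := by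
    rw [abs_one]
    refine DifferentiableOn.diffContOnCl fun l hl => ?_
    have hl' : ‖l‖ ≤ 1 := by simpa using closure_ball_subset_closedBall hl
    have h1 : DifferentiableAt ℂ F (x - l • y) :=
      hF.differentiableAt (isOpen_ball.mem_nhds (hm l hl'))
    exact (h1.comp (f := fun l : ℂ => x - l • y) l
      ((differentiableAt_const x).sub (differentiableAt_id.smul_const y))).differentiableWithinAt
  have h := hg.circleAverage
  rw [Real.circleAverage_def] at h
  simp only [zero_smul, sub_zero, circleMap, ofReal_one, one_mul, zero_add] at h
  rw [← h, real_smul, ← mul_assoc]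
  push_cast
  rw [mul_inv_cancel₀ (by simp), one_mul]

theorem integral_comp_unit_smul (c : Circle) (G : Cn n → ℂ) :
    ∫ y, G ((c : ℂ) • y) = ∫ y, G y := by
  let L : Cn n ≃ₗᵢ[ℝ] Cn n :=
    { DistribMulAction.toLinearEquiv ℝ (Cn n) c with
      norm_map' := fun y => by
        change ‖(c : ℂ) • y‖ = ‖y‖
        rw [norm_smul, Circle.norm_coe, one_mul] }
  exact L.measurePreserving.integral_comp L.toHomeomorph.measurableEmbedding G

theorem regularize_eq_self {F : Cn n → ℂ} (hFc : Continuous F) {x : Cn n} {R δ : ℝ}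
    (hF : DifferentiableOn ℂ F (ball x R)) (hδ : 0 < δ) (hδR : δ < R) :
    regularize δ F x = F x := by
  rw [regularize_eq_integral_comp_sub]
  have hρ : Continuous (cmollifier δ : Cn n → ℂ) := (contDiff_cmollifier δ (m := 0)).continuous
  have hρ0 : ∀ y ∉ closedBall (0 : Cn n) δ, cmollifier δ y = 0 := fun y hy => by
    rw [cmollifier, mollifier_eq_zero hδ, ofReal_zero]
    simpa using (not_le.1 fun h => hy (by simpa using h)).le
  have h1 (θ : ℝ) : ∫ y in closedBall 0 δ, F (x - cexp (θ * I) • y) * cmollifier δ y =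
      ∫ y, F (x - y) * cmollifier δ y := by
    rw [setIntegral_eq_integral_of_forall_compl_eq_zero fun y hy => by rw [hρ0 y hy, mul_zero],
      ← integral_comp_unit_smul (Circle.exp θ) fun y => F (x - y) * cmollifier δ y]
    refine integral_congr_ae (ae_of_all _ fun y => ?_)
    simp only [Circle.coe_exp, cmollifier]
    rw [mollifier_congr (x := cexp (θ * I) • y) (y := y)
      (by rw [norm_smul, norm_exp_ofReal_mul_I, one_mul])]
  have hint : Integrable (Function.uncurry fun (θ : ℝ) (y : Cn n) =>
      F (x - cexp (θ * I) • y) * cmollifier δ y)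
      ((volume.restrict (uIoc 0 (2 * Real.pi))).prod (volume.restrict (closedBall 0 δ))) := by
    rw [Measure.prod_restrict]
    have hc : Continuous (Function.uncurry fun (θ : ℝ) (y : Cn n) =>
      F (x - cexp (θ * I) • y) * cmollifier δ y) := by
      simp only [Function.uncurry_def]
      fun_prop
    have hi := hc.continuousOn.integrableOn_compact (μ := (volume : Measure ℝ).prod volume)
      ((isCompact_uIcc (a := (0 : ℝ)) (b := 2 * Real.pi)).prod (isCompact_closedBall (0 : Cn n) δ))
    exact hi.mono_set (prod_mono uIoc_subset_uIcc subset_rfl)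
  have h2 := intervalIntegral_integral_swap hint
  simp only [h1, intervalIntegral.integral_const, intervalIntegral.integral_mul_const, sub_zero] at h2
  have h3 : ∫ y in closedBall (0 : Cn n) δ,
      (∫ θ in (0 : ℝ)..2 * Real.pi, F (x - cexp (θ * I) • y)) * cmollifier δ y =
      2 * Real.pi * F x := by
    have : ∫ y in closedBall (0 : Cn n) δ,
        (∫ θ in (0 : ℝ)..2 * Real.pi, F (x - cexp (θ * I) • y)) * cmollifier δ y =
        ∫ y in closedBall (0 : Cn n) δ, 2 * Real.pi * F x * cmollifier δ y :=
      setIntegral_congr_fun isClosed_closedBall.measurableSet fun y hy => by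
        rw [integral_circle_eq hF (lt_of_le_of_lt (by simpa using hy) hδR)]
    rw [this, setIntegral_eq_integral_of_forall_compl_eq_zero fun y hy => by rw [hρ0 y hy, mul_zero],
      integral_const_mul]
    simp only [cmollifier]
    rw [integral_complex_ofReal, integral_mollifier hδ, ofReal_one, mul_one]
  rw [h3, real_smul] at h2
  push_cast at h2
  have hpi : (2 * Real.pi : ℂ) ≠ 0 := by simp
  exact mul_left_cancel₀ hpi h2

theorem differentiableAt_regularize {f : Cn n → ℂ} (hf : LocallyIntegrable f) {ε : ℝ} (hε : 0 < ε)
    {x : Cn n} (h0 : ∀ q, IsTest (closedBall x ε) q → ∀ j, ∫ t, f t * wirt I q (e n j) t = 0) :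
    DifferentiableAt ℂ (regularize ε f) x := by
  refine differentiableAt_of_wirt_eq_zero
    ((contDiff_regularize hε hf).differentiable (by norm_num) x) fun j => ?_
  rw [wirt_regularize_eq_neg hε hf, h0 _ (isTest_cmollifier_sub hε x subset_rfl) j, neg_zero]

theorem tendsto_regularize_apply {F : ℕ → Cn n → ℂ} {f : Cn n → ℂ} (hF : L2Tendsto F f) {δ : ℝ}
    (hδ : 0 < δ) (x : Cn n) :
    Tendsto (fun m => regularize δ (F m) x) atTop (𝓝 (regularize δ f x)) := by
  have hρ : Continuous fun t : Cn n => cmollifier δ (x - t) :=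
    (isTest_cmollifier_sub hδ x (Ω := univ) (subset_univ _)).continuous
  have hρ2 : MemLp (fun t : Cn n => cmollifier δ (x - t)) 2 :=
    hρ.memLp_of_hasCompactSupport (isTest_cmollifier_sub hδ x (Ω := univ) (subset_univ _)).compact
  have hi {g : Cn n → ℂ} (hg : MemLp g 2) : Integrable fun t => g t * cmollifier δ (x - t) :=
    hg.integrable_mul hρ2
  have h1 : Tendsto (fun m => (∫ t, ‖F m t - f t‖ ^ 2) * ∫ t, ‖cmollifier δ (x - t)‖ ^ 2) atTop
      (𝓝 0) := by
    have h2 : L2Tendsto (fun m t => F m t - f t) fun _ => 0 := by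
      refine ⟨fun m => (hF.memLp m).sub hF.limit, MemLp.zero', ?_⟩
      simpa using hF.tendsto
    have := h2.integral_sq.mul_const (∫ t, ‖cmollifier δ (x - t)‖ ^ 2)
    simpa using this
  rw [tendsto_iff_norm_sub_tendsto_zero]
  have h3 := (Real.continuous_sqrt.tendsto _).comp h1
  rw [Real.sqrt_zero] at h3
  refine squeeze_zero (fun m => norm_nonneg _) (fun m => ?_) h3
  refine Real.le_sqrt_of_sq_le ?_
  rw [regularize, regularize, ← integral_sub (hi (hF.memLp m)) (hi hF.limit)]
  simp_rw [← sub_mul]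
  exact norm_sq_integral_mul_le ((hF.memLp m).sub hF.limit) hρ2

variable {Ω : Set (Cn n)} {h : Cn n → ℂ}

theorem weyl_local (hh : ∀ K, IsCompact K → K ⊆ Ω → MemLp (K.indicator h) 2)
    (h0 : ∀ q, IsTest Ω q → ∀ j, ∫ z, h z * wirt I q (e n j) z = 0) {a : Cn n} {r : ℝ} (hr : 0 < r)
    (har : closedBall a (3 * r) ⊆ Ω) :
    ∃ G, DifferentiableOn ℂ G (ball a r) ∧ ∀ᵐ z, z ∈ ball a r → h z = G z := by
  set f : Cn n → ℂ := (closedBall a (3 * r)).indicator h with hf_def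
  have hf : MemLp f 2 := hh _ (isCompact_closedBall _ _) har
  have hfl : LocallyIntegrable f := hf.locallyIntegrable (by norm_num)
  have hd {ε : ℝ} (hε : 0 < ε) (hεr : ε ≤ r) {x : Cn n} (hx : x ∈ ball a (2 * r)) :
      DifferentiableAt ℂ (regularize ε f) x := by
    refine differentiableAt_regularize hfl hε fun q hq j => ?_
    have hsub : closedBall x ε ⊆ closedBall a (3 * r) :=
      closedBall_subset_closedBall' (by linarith [mem_ball.1 hx])
    rw [← h0 q ⟨hq.contDiff, hq.compact, hq.subset.trans (hsub.trans har)⟩ j]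
    refine integral_congr_ae (ae_of_all _ fun t => ?_)
    by_cases ht : t ∈ closedBall a (3 * r)
    · simp only [hf_def, indicator_of_mem ht]
    · simp only [wirt_eq_zero_of_notMem fun h' => ht (hsub (hq.subset h')), mul_zero]
  set ε : ℕ → ℝ := fun m => r / (m + 1) with hε_def
  have hε (m : ℕ) : 0 < ε m := by positivity
  have hεr (m : ℕ) : ε m ≤ r := div_le_self hr.le (by linarith [(Nat.cast_nonneg m : (0 : ℝ) ≤ m)])
  have hε0 : Tendsto ε atTop (𝓝 0) := by
    have := (tendsto_one_div_add_atTop_nhds_zero_nat (𝕜 := ℝ)).const_mul r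
    simpa [hε_def, div_eq_mul_inv] using this
  have hL : L2Tendsto (fun m => regularize (ε m) f) f :=
    l2Tendsto_regularize hf (isCompact_closedBall a (3 * r)) (fun z hz => indicator_of_notMem hz _)
      hε hε0
  obtain ⟨ns, hns, hae⟩ := (tendstoInMeasure_of_tendsto_eLpNorm (by norm_num)
    (fun m => (hL.memLp m).1) hf.1 hL.tendsto).exists_seq_tendsto_ae
  refine ⟨regularize (r / 2) f, fun x hx => (hd (by positivity) (by linarith)
    (ball_subset_ball (by linarith) hx)).differentiableWithinAt, ?_⟩
  filter_upwards [hae] with z hz hza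
  have h1 : Tendsto (fun m => regularize (ε (ns m)) f z) atTop (𝓝 (regularize (r / 2) f z)) := by
    refine ((tendsto_regularize_apply hL (half_pos hr) z).comp hns.tendsto_atTop).congr fun m => ?_
    refine regularize_eq_self (contDiff_regularize (hε _) hfl).continuous (R := r) ?_ (half_pos hr)
      (half_lt_self hr)
    refine fun y hy => (hd (hε _) (hεr _) ?_).differentiableWithinAt
    exact ball_subset_ball' (by linarith [mem_ball.1 hza]) hy
  rw [← tendsto_nhds_unique hz h1, hf_def,
    indicator_of_mem (ball_subset_closedBall.trans (closedBall_subset_closedBall (by linarith)) hza)]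

theorem weyl (hΩ : IsOpen Ω) (hh : ∀ K, IsCompact K → K ⊆ Ω → MemLp (K.indicator h) 2)
    (h0 : ∀ q, IsTest Ω q → ∀ j, ∫ z, h z * wirt I q (e n j) z = 0) :
    ∃ H, DifferentiableOn ℂ H Ω ∧ ∀ᵐ z, z ∈ Ω → h z = H z := by
  have hex (a : Cn n) (ha : a ∈ Ω) : ∃ r > 0, ball a r ⊆ Ω ∧ ∃ G, DifferentiableOn ℂ G (ball a r) ∧
      ∀ᵐ z, z ∈ ball a r → h z = G z := by
    obtain ⟨R, hR, hRΩ⟩ := nhds_basis_closedBall.mem_iff.1 (hΩ.mem_nhds ha)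
    have h3 : closedBall a (3 * (R / 3)) ⊆ Ω := by rwa [mul_div_cancel₀ R (by norm_num)]
    exact ⟨R / 3, by positivity,
      (ball_subset_closedBall.trans (closedBall_subset_closedBall (by linarith))).trans h3,
      weyl_local hh h0 (by positivity) h3⟩
  choose! r hr hrΩ G hG hGh using hex
  have heq {a b : Cn n} (ha : a ∈ Ω) (hb : b ∈ Ω) (hba : b ∈ ball a (r a)) : G b b = G a b := by
    have hU : IsOpen (ball a (r a) ∩ ball b (r b)) := isOpen_ball.inter isOpen_ball
    refine Measure.eqOn_open_of_ae_eq (μ := volume) ?_ hU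
      ((hG b hb).continuousOn.mono inter_subset_right)
      ((hG a ha).continuousOn.mono inter_subset_left) ⟨hba, mem_ball_self (hr b hb)⟩
    rw [Filter.EventuallyEq, ae_restrict_iff' hU.measurableSet]
    filter_upwards [hGh a ha, hGh b hb] with z h1 h2 hz
    rw [← h1 hz.1, ← h2 hz.2]
  refine ⟨fun z => G z z, fun a ha => ?_, ?_⟩
  · have h1 : DifferentiableAt ℂ (G a) a :=
      (hG a ha).differentiableAt (isOpen_ball.mem_nhds (mem_ball_self (hr a ha)))
    refine (h1.congr_of_eventuallyEq ?_).differentiableWithinAt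
    filter_upwards [isOpen_ball.mem_nhds (mem_ball_self (hr a ha))] with z hz
    exact heq ha (hrΩ a ha hz) hz
  · rw [ae_iff]
    refine measure_null_of_locally_null _ fun a ha => ?_
    have haΩ : a ∈ Ω := by
      by_contra h'
      exact ha fun h'' => absurd h'' h'
    refine ⟨ball a (r a) ∩ {z | ¬(z ∈ Ω → h z = G z z)}, inter_mem
      (mem_nhdsWithin_of_mem_nhds (ball_mem_nhds a (hr a haΩ))) self_mem_nhdsWithin, ?_⟩
    refine measure_mono_null (fun z hz => ?_) (ae_iff.1 (hGh a haΩ))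
    refine fun h' => hz.2 fun hzΩ => ?_
    rw [h' hz.1, heq haΩ hzΩ hz.1]

end Weyl

section Duality

open Filter Topology

theorem inner_toLp {a b : Cn n → ℂ} (ha : MemLp a 2) (hb : MemLp b 2) :
    inner ℂ ha.toLp hb.toLp = ∫ z, b z * conj (a z) := by
  rw [L2.inner_def]
  refine integral_congr_ae ?_
  filter_upwards [ha.coeFn_toLp, hb.coeFn_toLp] with x hx hy
  rw [hx, hy, RCLike.inner_apply]

/-- Square integrable vector fields. -/
abbrev VecL2 (n : ℕ) := PiLp 2 (fun _ : Fin n => Lp ℂ 2 (volume : Measure (Cn n)))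

def toVecL2 {a : Fin n → Cn n → ℂ} (ha : ∀ j, MemLp (a j) 2) : VecL2 n :=
  WithLp.toLp 2 fun j => (ha j).toLp

theorem inner_toVecL2 {a b : Fin n → Cn n → ℂ} (ha : ∀ j, MemLp (a j) 2) (hb : ∀ j, MemLp (b j) 2) :
    inner ℂ (toVecL2 ha) (toVecL2 hb) = ∑ j, ∫ z, b j z * conj (a j z) := by
  rw [PiLp.inner_apply]
  exact Finset.sum_congr rfl fun j _ => inner_toLp (ha j) (hb j)

theorem norm_sq_toVecL2 {a : Fin n → Cn n → ℂ} (ha : ∀ j, MemLp (a j) 2) :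
    ‖toVecL2 ha‖ ^ 2 = ∑ j, ∫ z, ‖a j z‖ ^ 2 := by
  rw [PiLp.norm_sq_eq_of_L2]
  exact Finset.sum_congr rfl fun j _ => norm_sq_toLp (ha j)

theorem norm_sq_sum_integral_le {a b : Fin n → Cn n → ℂ} (ha : ∀ j, MemLp (a j) 2)
    (hb : ∀ j, MemLp (b j) 2) :
    ‖∑ j, ∫ z, b j z * conj (a j z)‖ ^ 2 ≤
      (∑ j, ∫ z, ‖b j z‖ ^ 2) * ∑ j, ∫ z, ‖a j z‖ ^ 2 := by
  rw [← inner_toVecL2 ha hb, ← norm_sq_toVecL2 ha, ← norm_sq_toVecL2 hb, ← mul_pow, mul_comm]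
  exact pow_le_pow_left₀ (norm_nonneg _) (norm_inner_le_norm _ _) 2

theorem exists_toVecL2_eq (p : VecL2 n) :
    ∃ (a : Fin n → Cn n → ℂ) (ha : ∀ j, MemLp (a j) 2), p = toVecL2 ha := by
  refine ⟨fun j => p j, fun j => Lp.memLp (p j), ?_⟩
  ext1 j
  exact (Lp.toLp_coeFn (p j) (Lp.memLp (p j))).symm

theorem exists_add_mem_orthogonal {H : Type*} [NormedAddCommGroup H] [InnerProductSpace ℂ H]
    [CompleteSpace H] (N : Submodule ℂ H) (x : H) : ∃ p ∈ Nᗮ, ∃ z ∈ Nᗮᗮ, x = p + z := by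
  have : CompleteSpace (Nᗮ : Submodule ℂ H) := N.isClosed_orthogonal.completeSpace_coe
  exact Submodule.exists_add_mem_mem_orthogonal (K := Nᗮ) x

variable {Ω : Set (Cn n)} {g : Cn n → ℝ}

theorem integral_wirt_mul_wirt_comm (hΩ : IsOpen Ω) {v q : Cn n → ℂ} (hv : ContDiffOn ℝ 2 v Ω)
    (hq : IsTest Ω q) (s : ℂ) (j k : Fin n) :
    ∫ z, wirt s v (e n k) z * wirt s q (e n j) z = ∫ z, wirt s v (e n j) z * wirt s q (e n k) z := by
  have hv1 : ContDiffOn ℝ 1 v Ω := hv.of_le (by norm_num)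
  have hw (j : Fin n) : ContDiff ℝ 1 (wirt s q (e n j)) := hq.contDiff.wirt (by norm_num)
  have h (j k : Fin n) := integral_mul_wirt (s := s) (w := e n k) hΩ hv1 (hw j) hq.compact_wirt
    hq.tsupport_wirt
  rw [← neg_inj, ← h j k, ← h k j]
  refine integral_congr_ae (ae_of_all _ fun z => ?_)
  dsimp only
  rw [wirt_comm hq.contDiff.contDiffAt]

/-- The weighted components of `∂̄v`. -/
def weightedDbar (Ω : Set (Cn n)) (g : Cn n → ℝ) (v : Cn n → ℂ) (j : Fin n) : Cn n → ℂ :=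
  Ω.indicator fun z => cexp ((-(g z / 2) : ℝ) : ℂ) * wirt I v (e n j) z

theorem weightedDbar_mul (g : Cn n → ℝ) (v : Cn n → ℂ) (j : Fin n) {h : Cn n → ℂ}
    (hh : tsupport h ⊆ Ω) (z : Cn n) :
    weightedDbar Ω g v j z * (cexp ((g z / 2 : ℝ) : ℂ) * h z) = wirt I v (e n j) z * h z := by
  by_cases hz : z ∈ Ω
  · rw [weightedDbar, indicator_of_mem hz]
    have : cexp ((-(g z / 2) : ℝ) : ℂ) * cexp ((g z / 2 : ℝ) : ℂ) = 1 := by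
      rw [← Complex.exp_add, ← ofReal_add, neg_add_cancel, ofReal_zero, Complex.exp_zero]
    linear_combination (wirt I v (e n j) z * h z) * this
  · rw [image_eq_zero_of_notMem_tsupport fun h' => hz (hh h'), mul_zero, mul_zero, mul_zero]

theorem exists_projection (hΩ : IsOpen Ω) (hg : ContDiffOn ℝ 2 g Ω) {γ : Fin n → Cn n → ℂ}
    (hγ : ∀ j, IsTest Ω (γ j)) : ∃ p : Fin n → Cn n → ℂ, (∀ j, MemLp (p j) 2) ∧
      (∀ q, IsTest Ω q → ∀ j k, ∫ z, cexp ((g z / 2 : ℝ) : ℂ) *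
        (p k z * wirt I q (e n j) z - p j z * wirt I q (e n k) z) = 0) ∧
      ∀ v, ContDiffOn ℝ 2 v Ω → (∀ j, MemLp (weightedDbar Ω g v j) 2) →
        ∑ j, ∫ z, weightedDbar Ω g v j z * conj (p j z) =
          ∑ j, ∫ z, wirt I v (e n j) z * conj (γ j z) := by
  have hA' {q : Cn n → ℂ} (hq : IsTest Ω q) (j : Fin n) :
      MemLp (fun z => cexp ((g z / 2 : ℝ) : ℂ) * wirt I q (e n j) z) 2 :=
    (continuous_half_weight_mul_wirt hΩ hg hq I (e n j)).memLp_of_hasCompactSupport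
      hq.compact_wirt.mul_left
  have hA {q : Cn n → ℂ} (hq : IsTest Ω q) (j : Fin n) :
      MemLp (fun z => conj (cexp ((g z / 2 : ℝ) : ℂ) * wirt I q (e n j) z)) 2 := (hA' hq j).star
  have hF (j : Fin n) : MemLp (fun z => cexp ((g z / 2 : ℝ) : ℂ) * γ j z) 2 := by
    have h : IsTest Ω fun z => cexp ((g z / 2 : ℝ) : ℂ) * γ j z :=
      (hγ j).mul_left hΩ (contDiffOn_cexp (hg.div_const 2))
    exact h.continuous.memLp_of_hasCompactSupport h.compact
  let N : Submodule ℂ (VecL2 n) := Submodule.span ℂ {x | ∃ (q : Cn n → ℂ) (hq : IsTest Ω q)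
    (j k : Fin n), x = WithLp.toLp 2 (Pi.single k (hA hq j).toLp - Pi.single j (hA hq k).toLp)}
  have hin {q : Cn n → ℂ} (hq : IsTest Ω q) (j k : Fin n) {a : Fin n → Cn n → ℂ}
      (ha : ∀ j, MemLp (a j) 2) : inner ℂ (WithLp.toLp 2
        (Pi.single k (hA hq j).toLp - Pi.single j (hA hq k).toLp) : VecL2 n) (toVecL2 ha) =
      (∫ z, a k z * (cexp ((g z / 2 : ℝ) : ℂ) * wirt I q (e n j) z)) -
        ∫ z, a j z * (cexp ((g z / 2 : ℝ) : ℂ) * wirt I q (e n k) z) := by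
    have h1 (i : Fin n) (b : Lp ℂ 2 (volume : Measure (Cn n))) :
        ∑ l, inner ℂ ((Pi.single i b : Fin n → Lp ℂ 2 (volume : Measure (Cn n))) l)
          ((toVecL2 ha) l) = inner ℂ b ((toVecL2 ha) i) := by
      rw [Finset.sum_eq_single i (fun l _ hl => by rw [Pi.single_eq_of_ne hl, inner_zero_left])
        (fun h => absurd (Finset.mem_univ i) h), Pi.single_eq_same]
    rw [PiLp.inner_apply]
    simp only [Pi.sub_apply, inner_sub_left, Finset.sum_sub_distrib, h1]
    simp only [toVecL2, inner_toLp, conj_conj]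
  obtain ⟨p', hp', z', hz', hFp⟩ := exists_add_mem_orthogonal N (toVecL2 hF)
  obtain ⟨p, hp, rfl⟩ := exists_toVecL2_eq p'
  refine ⟨p, hp, fun q hq j k => ?_, fun v hv hvG => ?_⟩
  · have h := (Submodule.mem_orthogonal N _).1 hp' _ (Submodule.subset_span ⟨q, hq, j, k, rfl⟩)
    have hi (j k : Fin n) : Integrable fun z => p k z * (cexp ((g z / 2 : ℝ) : ℂ) *
        wirt I q (e n j) z) := (hp k).integrable_mul (hA' hq j)
    rw [hin hq j k hp, ← integral_sub (hi j k) (hi k j)] at h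
    rw [← h]
    congr 1
    ext z
    ring
  · have hG : toVecL2 hvG ∈ Nᗮ := by
      rw [Submodule.mem_orthogonal]
      intro u hu
      induction hu using Submodule.span_induction with
      | mem x hx =>
        obtain ⟨q, hq, j, k, rfl⟩ := hx
        rw [hin hq j k hvG, sub_eq_zero]
        simp only [weightedDbar_mul g v _ hq.tsupport_wirt]
        exact integral_wirt_mul_wirt_comm hΩ hv hq I j k
      | zero => exact inner_zero_left _
      | add x y _ _ hx hy => rw [inner_add_left, hx, hy, add_zero]
      | smul c x _ hx => rw [inner_smul_left, hx, mul_zero]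
    have h0 := (Submodule.mem_orthogonal' Nᗮ _).1 hz' _ hG
    rw [← inner_toVecL2 hp hvG, ← add_zero (inner ℂ (toVecL2 hp) (toVecL2 hvG)), ← h0,
      ← inner_add_left, ← hFp, inner_toVecL2]
    refine Finset.sum_congr rfl fun j _ => integral_congr_ae (ae_of_all _ fun z => ?_)
    dsimp only
    rw [map_mul, ← exp_conj, conj_ofReal]
    exact weightedDbar_mul g v j (hγ j).conjugate.subset z

end Duality

section DualityEstimate

open Filter Topology

variable {Ω : Set (Cn n)} {Φ g : Cn n → ℝ} {v : Cn n → ℂ} {c : ℝ}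

theorem norm_sq_weightedDbar (g : Cn n → ℝ) (v : Cn n → ℂ) (j : Fin n) (z : Cn n) :
    ‖weightedDbar Ω g v j z‖ ^ 2 =
      Ω.indicator (fun z => ‖wirt I v (e n j) z‖ ^ 2 * Real.exp (-g z)) z := by
  by_cases hz : z ∈ Ω
  · rw [weightedDbar, indicator_of_mem hz, indicator_of_mem hz, norm_mul, mul_pow, ← neg_div,
      norm_cexp_half_sq, mul_comm]
  · rw [weightedDbar, indicator_of_notMem hz, indicator_of_notMem hz, norm_zero, sq, mul_zero]

theorem norm_sq_wirt_le (v : Cn n → ℂ) (j : Fin n) (z : Cn n) :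
    ‖wirt I v (e n j) z‖ ^ 2 ≤ formNormSq (dbar v) z :=
  Finset.single_le_sum (f := fun j => ‖dbar v z j‖ ^ 2) (fun _ _ => sq_nonneg _)
    (Finset.mem_univ j)

theorem memLp_weightedDbar (hΩ : IsOpen Ω) (hg : ContDiffOn ℝ 2 g Ω) (hle : ∀ z ∈ Ω, Φ z ≤ g z)
    (hv : ContDiffOn ℝ 2 v Ω)
    (hvi : IntegrableOn (fun z => formNormSq (dbar v) z * Real.exp (-Φ z)) Ω) (j : Fin n) :
    MemLp (weightedDbar Ω g v j) 2 := by
  have hm : AEStronglyMeasurable (weightedDbar Ω g v j) volume := by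
    rw [weightedDbar, aestronglyMeasurable_indicator_iff hΩ.measurableSet]
    refine ContinuousOn.aestronglyMeasurable ?_ hΩ.measurableSet
    exact (contDiffOn_cexp (hg.div_const 2).neg).continuousOn.mul (continuousOn_wirt hΩ hv I (e n j))
  rw [memLp_two_iff_integrable_sq_norm hm]
  refine ((integrable_indicator_iff hΩ.measurableSet).2 hvi).mono' (hm.norm.pow 2)
    (ae_of_all _ fun z => ?_)
  rw [Real.norm_of_nonneg (sq_nonneg _), norm_sq_weightedDbar]
  refine indicator_le_indicator' fun hz => ?_
  exact mul_le_mul (norm_sq_wirt_le v j z) (Real.exp_le_exp.2 (neg_le_neg (hle z hz)))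
    (Real.exp_pos _).le (Finset.sum_nonneg fun _ _ => sq_nonneg _)

theorem sum_norm_sq_weightedDbar_le (hΩ : IsOpen Ω) (hg : ContDiffOn ℝ 2 g Ω)
    (hle : ∀ z ∈ Ω, Φ z ≤ g z) (hv : ContDiffOn ℝ 2 v Ω)
    (hvi : IntegrableOn (fun z => formNormSq (dbar v) z * Real.exp (-Φ z)) Ω) :
    ∑ j, ∫ z, ‖weightedDbar Ω g v j z‖ ^ 2 ≤
      ∫ z in Ω, formNormSq (dbar v) z * Real.exp (-Φ z) := by
  have hi (j : Fin n) : Integrable fun z => ‖weightedDbar Ω g v j z‖ ^ 2 :=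
    (memLp_weightedDbar hΩ hg hle hv hvi j).integrable_norm_pow (by norm_num)
  rw [← integral_finsetSum _ fun j _ => hi j, ← integral_indicator hΩ.measurableSet]
  refine integral_mono (integrable_finsetSum _ fun j _ => hi j)
    ((integrable_indicator_iff hΩ.measurableSet).2 hvi) fun z => ?_
  dsimp only
  simp only [norm_sq_weightedDbar]
  by_cases hz : z ∈ Ω
  · simp only [indicator_of_mem hz, ← Finset.sum_mul]
    exact mul_le_mul_of_nonneg_left (Real.exp_le_exp.2 (neg_le_neg (hle z hz)))
      (Finset.sum_nonneg fun _ _ => sq_nonneg _)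
  · simp only [indicator_of_notMem hz, Finset.sum_const_zero, le_refl]

theorem integral_mul_conj_sum_wirt (hΩ : IsOpen Ω) (hv : ContDiffOn ℝ 2 v Ω)
    {γ : Fin n → Cn n → ℂ} (hγ : ∀ j, IsTest Ω (γ j)) :
    ∫ z, v z * conj (∑ j, wirt (-I) (γ j) (e n j) z) =
      -∑ j, ∫ z, wirt I v (e n j) z * conj (γ j z) := by
  have hc (j : Fin n) (z : Cn n) : conj (wirt (-I) (γ j) (e n j) z) =
      wirt I (fun x => conj (γ j x)) (e n j) z := by
    rw [wirt_conj (hγ j).differentiable.differentiableAt, conj_I]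
  have hi (j : Fin n) : Integrable fun z => v z * wirt I (fun x => conj (γ j x)) (e n j) z := by
    have h1 : Continuous fun z => v z * wirt I (fun x => conj (γ j x)) (e n j) z :=
      continuous_mul_of_tsupport hΩ hv.continuousOn (hγ j).conjugate.continuous_wirt
        (hγ j).conjugate.tsupport_wirt
    have h2 : HasCompactSupport fun z => v z * wirt I (fun x => conj (γ j x)) (e n j) z :=
      (hγ j).conjugate.compact_wirt.mul_left
    exact h1.integrable_of_hasCompactSupport h2
  simp only [map_sum, hc, Finset.mul_sum]
  rw [integral_finsetSum _ fun j _ => hi j, ← Finset.sum_neg_distrib]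
  exact Finset.sum_congr rfl fun j _ => integral_mul_wirt hΩ (hv.of_le (by norm_num))
    ((hγ j).conjugate.contDiff.of_le (by norm_num)) (hγ j).conjugate.compact (hγ j).conjugate.subset

theorem duality (hΩ : IsOpen Ω) (hpsc : Pseudoconvex Ω) (hΦ : ContDiffOn ℝ 2 Φ Ω) (hc : 0 ≤ c)
    (hL : ∀ z ∈ Ω, ∀ w, c * ‖w‖ ^ 2 ≤ LeviForm Φ z w) (hv : ContDiffOn ℝ 2 v Ω)
    (hvi : IntegrableOn (fun z => formNormSq (dbar v) z * Real.exp (-Φ z)) Ω)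
    {γ : Fin n → Cn n → ℂ} (hγ : ∀ j, IsTest Ω (γ j)) :
    c * ‖∫ z, v z * conj (∑ j, wirt (-I) (γ j) (e n j) z)‖ ^ 2 ≤
      2 * (∫ z in Ω, formNormSq (dbar v) z * Real.exp (-Φ z)) *
        ∫ z, ‖∑ j, wirt (-I) (γ j) (e n j) z‖ ^ 2 * Real.exp (Φ z) := by
  obtain ⟨ϕ, ψ, η, W⟩ := exists_weightSystem hΩ hpsc hΦ hc hL
    (S := ⋃ j, tsupport (γ j)) (isCompact_iUnion fun j => (hγ j).compact)
    (iUnion_subset fun j => (hγ j).subset)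
  have hg : ContDiffOn ℝ 2 (fun z => ϕ z - ψ z) Ω := W.contDiffOn_fst.sub W.contDiffOn_snd
  obtain ⟨p, hp, hcurl, hproj⟩ := exists_projection hΩ hg hγ
  have hwc {f : Cn n → ℂ} (hf : IsTest Ω f) (j : Fin n) (z : Cn n) :
      wirt I (fun x => conj (f x)) (e n j) z = conj (wirt (-I) f (e n j) z) := by
    rw [wirt_conj hf.differentiable.differentiableAt, conj_I]
  have hdiv : ∀ f, IsTest Ω f → ∫ z, cexp ((-((ϕ z - ψ z) / 2) : ℝ) : ℂ) *
      ∑ j, wirt (-I) f (e n j) z * p j z = ∫ z, ∑ j, wirt (-I) f (e n j) z * γ j z := by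
    intro f hf
    have hwd (j : Fin n) (z : Cn n) : weightedDbar Ω (fun z => ϕ z - ψ z) (fun x => conj (f x)) j z =
        cexp ((-((ϕ z - ψ z) / 2) : ℝ) : ℂ) * wirt I (fun x => conj (f x)) (e n j) z := by
      by_cases hz : z ∈ Ω
      · rw [weightedDbar, indicator_of_mem hz]
      · rw [weightedDbar, indicator_of_notMem hz,
          wirt_eq_zero_of_notMem fun h => hz (hf.conjugate.subset h), mul_zero]
    have hm (j : Fin n) : MemLp (weightedDbar Ω (fun z => ϕ z - ψ z) (fun x => conj (f x)) j) 2 := by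
      have h1 : Continuous fun z =>
          cexp ((-((ϕ z - ψ z) / 2) : ℝ) : ℂ) * wirt I (fun x => conj (f x)) (e n j) z :=
        continuous_mul_of_tsupport hΩ (contDiffOn_cexp (hg.div_const 2).neg).continuousOn
          hf.conjugate.continuous_wirt hf.conjugate.tsupport_wirt
      have h2 : HasCompactSupport fun z =>
          cexp ((-((ϕ z - ψ z) / 2) : ℝ) : ℂ) * wirt I (fun x => conj (f x)) (e n j) z :=
        hf.conjugate.compact_wirt.mul_left
      rw [funext (hwd j)]
      exact h1.memLp_of_hasCompactSupport h2
    have hi1 (j : Fin n) : Integrable fun z =>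
        weightedDbar Ω (fun z => ϕ z - ψ z) (fun x => conj (f x)) j z * conj (p j z) :=
      (hm j).integrable_mul (hp j).star
    have hi2 (j : Fin n) : Integrable fun z =>
        wirt I (fun x => conj (f x)) (e n j) z * conj (γ j z) := by
      have h1 : Continuous fun z => wirt I (fun x => conj (f x)) (e n j) z * conj (γ j z) :=
        hf.conjugate.continuous_wirt.mul (hγ j).conjugate.continuous
      have h2 : HasCompactSupport fun z => wirt I (fun x => conj (f x)) (e n j) z * conj (γ j z) :=
        (hγ j).conjugate.compact.mul_left
      exact h1.integrable_of_hasCompactSupport h2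
    have h := hproj _ hf.conjugate.contDiff.contDiffOn hm
    rw [← integral_finsetSum _ fun j _ => hi1 j, ← integral_finsetSum _ fun j _ => hi2 j] at h
    have h' := congrArg conj h
    rw [← integral_conj, ← integral_conj] at h'
    simp only [map_sum, map_mul, conj_conj, hwd, hwc hf, ← exp_conj, conj_ofReal] at h'
    simp only [Finset.mul_sum, ← mul_assoc]
    exact h'
  have hcore := core_estimate hΩ W hp hγ (fun j => subset_iUnion (fun j => tsupport (γ j)) j)
    hcurl hdiv
  have hm := memLp_weightedDbar hΩ hg W.le_sub hv hvi
  have hpΩ (j : Fin n) : MemLp (Ω.indicator (p j)) 2 := (hp j).indicator hΩ.measurableSet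
  have hin (j : Fin n) (z : Cn n) : weightedDbar Ω (fun z => ϕ z - ψ z) v j z * conj (p j z) =
      weightedDbar Ω (fun z => ϕ z - ψ z) v j z * conj (Ω.indicator (p j) z) := by
    by_cases hz : z ∈ Ω
    · rw [indicator_of_mem hz]
    · rw [weightedDbar, indicator_of_notMem hz, zero_mul, zero_mul]
  have hnp (j : Fin n) : ∫ z, ‖Ω.indicator (p j) z‖ ^ 2 = ∫ z in Ω, ‖p j z‖ ^ 2 := by
    rw [← integral_indicator hΩ.measurableSet]
    refine integral_congr_ae (ae_of_all _ fun z => ?_)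
    by_cases hz : z ∈ Ω
    · simp only [indicator_of_mem hz]
    · simp only [indicator_of_notMem hz, norm_zero, sq, mul_zero]
  have hcs := norm_sq_sum_integral_le hpΩ hm
  simp only [hnp, ← hin] at hcs
  rw [integral_mul_conj_sum_wirt hΩ hv hγ, norm_neg, ← hproj v hv hm]
  calc _ ≤ c * ((∑ j, ∫ z, ‖weightedDbar Ω (fun z => ϕ z - ψ z) v j z‖ ^ 2) *
        ∑ j, ∫ z in Ω, ‖p j z‖ ^ 2) := mul_le_mul_of_nonneg_left hcs hc
    _ = (∑ j, ∫ z, ‖weightedDbar Ω (fun z => ϕ z - ψ z) v j z‖ ^ 2) *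
        (c * ∑ j, ∫ z in Ω, ‖p j z‖ ^ 2) := by ring
    _ ≤ (∫ z in Ω, formNormSq (dbar v) z * Real.exp (-Φ z)) *
        (2 * (∫ z, ‖∑ j, wirt (-I) (γ j) (e n j) z‖ ^ 2 * Real.exp (Φ z))) :=
      mul_le_mul (sum_norm_sq_weightedDbar_le hΩ hg W.le_sub hv hvi) hcore
        (mul_nonneg hc (Finset.sum_nonneg fun _ _ => integral_nonneg fun _ => sq_nonneg _))
        (integral_nonneg fun _ => mul_nonneg (Finset.sum_nonneg fun _ _ => sq_nonneg _)
          (Real.exp_pos _).le)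
    _ = _ := by ring

end DualityEstimate

section MinimalEstimate

open Filter Topology

variable {Ω : Set (Cn n)} {Φ : Cn n → ℝ} {v : Cn n → ℂ} {c : ℝ}

/-- The divergence `∑ ∂γ_j/∂z_j` multiplied by `e^{Φ/2}`. -/
def weightedDiv (Φ : Cn n → ℝ) (γ : Fin n → Cn n → ℂ) (z : Cn n) : ℂ :=
  cexp ((Φ z / 2 : ℝ) : ℂ) * ∑ j, wirt (-I) (γ j) (e n j) z

theorem memLp_weightedDiv (hΩ : IsOpen Ω) (hΦ : ContDiffOn ℝ 2 Φ Ω) {γ : Fin n → Cn n → ℂ}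
    (hγ : ∀ j, IsTest Ω (γ j)) : MemLp (weightedDiv Φ γ) 2 := by
  have h : weightedDiv Φ γ =
      fun z => ∑ j, cexp ((Φ z / 2 : ℝ) : ℂ) * wirt (-I) (γ j) (e n j) z :=
    funext fun z => Finset.mul_sum _ _ _
  rw [h]
  refine memLp_finsetSum _ fun j _ => ?_
  have h2 : HasCompactSupport fun z => cexp ((Φ z / 2 : ℝ) : ℂ) * wirt (-I) (γ j) (e n j) z :=
    (hγ j).compact_wirt.mul_left
  exact (continuous_half_weight_mul_wirt hΩ hΦ (hγ j) (-I) (e n j)).memLp_of_hasCompactSupport h2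

/-- The range of the weighted divergence on test vector fields. -/
def divRange (hΩ : IsOpen Ω) (hΦ : ContDiffOn ℝ 2 Φ Ω) :
    Submodule ℂ (Lp ℂ 2 (volume : Measure (Cn n))) where
  carrier := {m | ∃ (γ : Fin n → Cn n → ℂ) (hγ : ∀ j, IsTest Ω (γ j)),
    m = (memLp_weightedDiv hΩ hΦ hγ).toLp}
  add_mem' := by
    rintro _ _ ⟨γ, hγ, rfl⟩ ⟨γ', hγ', rfl⟩
    refine ⟨fun j z => γ j z + γ' j z, fun j => (hγ j).add (hγ' j), ?_⟩
    rw [← MemLp.toLp_add]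
    refine MemLp.toLp_congr _ _ (ae_of_all _ fun z => ?_)
    rw [Pi.add_apply, weightedDiv, weightedDiv, weightedDiv, ← mul_add, ← Finset.sum_add_distrib]
    congr 1
    exact Finset.sum_congr rfl fun j _ => (wirt_add (hγ j).differentiable.differentiableAt
      (hγ' j).differentiable.differentiableAt).symm
  zero_mem' := by
    refine ⟨fun _ _ => 0, fun j => IsTest.zero, ?_⟩
    rw [← MemLp.toLp_zero (MemLp.zero' (p := 2))]
    refine MemLp.toLp_congr _ _ (ae_of_all _ fun z => ?_)
    simp [weightedDiv, wirt]
  smul_mem' := by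
    rintro a _ ⟨γ, hγ, rfl⟩
    refine ⟨fun j z => a * γ j z, fun j => (hγ j).const_mul a, ?_⟩
    rw [← MemLp.toLp_const_smul]
    refine MemLp.toLp_congr _ _ (ae_of_all _ fun z => ?_)
    rw [Pi.smul_apply, weightedDiv, weightedDiv, smul_eq_mul, mul_left_comm, Finset.mul_sum]
    congr 1
    refine Finset.sum_congr rfl fun j _ => ?_
    rw [wirt_mul (differentiableAt_const a) (hγ j).differentiable.differentiableAt]
    simp [wirt]

theorem norm_sq_toLp_weightedDiv (hΩ : IsOpen Ω) (hΦ : ContDiffOn ℝ 2 Φ Ω) {γ : Fin n → Cn n → ℂ}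
    (hγ : ∀ j, IsTest Ω (γ j)) : ‖(memLp_weightedDiv hΩ hΦ hγ).toLp‖ ^ 2 =
      ∫ z, ‖∑ j, wirt (-I) (γ j) (e n j) z‖ ^ 2 * Real.exp (Φ z) := by
  rw [norm_sq_toLp]
  refine integral_congr_ae (ae_of_all _ fun z => ?_)
  dsimp only
  rw [weightedDiv, norm_mul, mul_pow, norm_cexp_half_sq, mul_comm]

theorem exists_holomorphic_of_orthogonal (hΩ : IsOpen Ω) (hΦ : ContDiffOn ℝ 2 Φ Ω)
    {y : Lp ℂ 2 (volume : Measure (Cn n))} (hy : y ∈ (divRange hΩ hΦ)ᗮ) :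
    ∃ H, DifferentiableOn ℂ H Ω ∧ ∀ᵐ z, z ∈ Ω → cexp ((Φ z / 2 : ℝ) : ℂ) * y z = H z := by
  refine weyl (h := fun z => cexp ((Φ z / 2 : ℝ) : ℂ) * y z) hΩ (fun K hK hKΩ => ?_) fun q hq j => ?_
  · have hc : ContinuousOn (fun z => cexp ((Φ z / 2 : ℝ) : ℂ)) K :=
      ((contDiffOn_cexp (hΦ.div_const 2)).continuousOn).mono hKΩ
    obtain ⟨C, hC⟩ := hK.exists_bound_of_continuousOn hc
    have hyK : MemLp (K.indicator y) 2 := (Lp.memLp y).indicator hK.measurableSet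
    refine hyK.of_le_mul (c := C) ?_ (ae_of_all _ fun z => ?_)
    · rw [aestronglyMeasurable_indicator_iff hK.measurableSet]
      exact (hc.aestronglyMeasurable hK.measurableSet).mul (Lp.aestronglyMeasurable y).restrict
    · by_cases hz : z ∈ K
      · rw [indicator_of_mem hz, indicator_of_mem hz, norm_mul]
        exact mul_le_mul_of_nonneg_right (hC z hz) (norm_nonneg _)
      · rw [indicator_of_notMem hz, indicator_of_notMem hz, norm_zero, mul_zero]
  · have ht (k : Fin n) : IsTest Ω (fun z => if k = j then conj (q z) else 0) := by
      by_cases hk : k = j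
      · simpa only [if_pos hk] using hq.conjugate
      · simpa only [if_neg hk] using IsTest.zero
    have h := (Submodule.mem_orthogonal _ _).1 hy _ ⟨_, ht, rfl⟩
    rw [← Lp.toLp_coeFn y (Lp.memLp y), inner_toLp] at h
    rw [← h]
    refine integral_congr_ae (ae_of_all _ fun z => ?_)
    dsimp only
    have h1 (k : Fin n) : wirt (-I) (fun z => if k = j then conj (q z) else 0) (e n k) z =
        if k = j then conj (wirt I q (e n j) z) else 0 := by
      by_cases hk : k = j
      · subst hk
        simp only [if_true]
        rw [wirt_conj hq.differentiable.differentiableAt, map_neg, conj_I, neg_neg]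
      · simp [hk, wirt]
    simp only [weightedDiv, h1, Finset.sum_ite_eq', Finset.mem_univ, if_true]
    rw [map_mul, conj_conj, ← exp_conj, conj_ofReal]
    ring

/-- Hörmander's `L²` estimate for the minimal solution of the `∂̄`-equation. -/
theorem hormander (hΩ : IsOpen Ω) (hpsc : Pseudoconvex Ω) (hΦ : ContDiffOn ℝ 2 Φ Ω) (hc : 0 ≤ c)
    (hL : ∀ z ∈ Ω, ∀ w, c * ‖w‖ ^ 2 ≤ LeviForm Φ z w) (hv : ContDiffOn ℝ 2 v Ω)
    (hvm : MemL2 Ω Φ v) (hvo : OrthToHolo Ω Φ v)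
    (hvi : IntegrableOn (fun z => formNormSq (dbar v) z * Real.exp (-Φ z)) Ω) :
    c * ∫ z in Ω, ‖v z‖ ^ 2 * Real.exp (-Φ z) ≤
      2 * ∫ z in Ω, formNormSq (dbar v) z * Real.exp (-Φ z) := by
  set A : ℝ := ∫ z in Ω, formNormSq (dbar v) z * Real.exp (-Φ z) with hA
  have hA0 : 0 ≤ A := integral_nonneg fun _ =>
    mul_nonneg (Finset.sum_nonneg fun _ _ => sq_nonneg _) (Real.exp_pos _).le
  set x : Cn n → ℂ := Ω.indicator fun z => cexp ((-(Φ z / 2) : ℝ) : ℂ) * v z with hx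
  have hxm : AEStronglyMeasurable x volume := by
    rw [hx, aestronglyMeasurable_indicator_iff hΩ.measurableSet]
    exact ((contDiffOn_cexp (hΦ.div_const 2).neg).continuousOn.aestronglyMeasurable
      hΩ.measurableSet).mul hvm.1
  have hxn (z : Cn n) : ‖x z‖ ^ 2 = Ω.indicator (fun z => ‖v z‖ ^ 2 * Real.exp (-Φ z)) z := by
    by_cases hz : z ∈ Ω
    · rw [hx, indicator_of_mem hz, indicator_of_mem hz, norm_mul, mul_pow, ← neg_div,
        norm_cexp_half_sq, mul_comm]
    · rw [hx, indicator_of_notMem hz, indicator_of_notMem hz, norm_zero, sq, mul_zero]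
  have hxL : MemLp x 2 := by
    rw [memLp_two_iff_integrable_sq_norm hxm, funext hxn]
    exact (integrable_indicator_iff hΩ.measurableSet).2 hvm.2
  have hX : ‖hxL.toLp‖ ^ 2 = ∫ z in Ω, ‖v z‖ ^ 2 * Real.exp (-Φ z) := by
    rw [norm_sq_toLp, funext hxn, integral_indicator hΩ.measurableSet]
  have hmem : hxL.toLp ∈ (divRange hΩ hΦ)ᗮᗮ := by
    rw [Submodule.mem_orthogonal]
    intro y hy
    obtain ⟨H, hH, hyH⟩ := exists_holomorphic_of_orthogonal hΩ hΦ hy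
    have hyH' : ∀ᵐ z ∂volume.restrict Ω, cexp ((Φ z / 2 : ℝ) : ℂ) * y z = H z :=
      (ae_restrict_iff' hΩ.measurableSet).2 hyH
    have hHm : MemL2 Ω Φ H := by
      refine ⟨hH.continuousOn.aestronglyMeasurable hΩ.measurableSet, ?_⟩
      refine ((Lp.memLp y).integrable_norm_pow (by norm_num)).integrableOn.congr ?_
      filter_upwards [hyH'] with z hz
      rw [← hz, norm_mul, mul_pow, norm_cexp_half_sq, mul_right_comm, ← Real.exp_add,
        add_neg_cancel, Real.exp_zero, one_mul]
    have h := hvo H hH hHm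
    rw [← Lp.toLp_coeFn y (Lp.memLp y), inner_toLp, ← h, ← integral_indicator hΩ.measurableSet]
    refine integral_congr_ae ?_
    filter_upwards [hyH] with z hz
    by_cases hzΩ : z ∈ Ω
    · rw [hx, indicator_of_mem hzΩ, indicator_of_mem hzΩ, ← hz hzΩ, map_mul, ← exp_conj,
        conj_ofReal]
      have h1 : cexp ((-(Φ z / 2) : ℝ) : ℂ) = cexp ((Φ z / 2 : ℝ) : ℂ) * (Real.exp (-Φ z) : ℂ) := by
        rw [ofReal_exp, ← Complex.exp_add, ← ofReal_add]
        congr 2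
        ring
      rw [h1]
      ring
    · rw [hx, indicator_of_notMem hzΩ, indicator_of_notMem hzΩ, zero_mul]
  rw [Submodule.orthogonal_orthogonal_eq_closure] at hmem
  have hclosed : IsClosed {m : Lp ℂ 2 (volume : Measure (Cn n)) |
      c * ‖inner ℂ m hxL.toLp‖ ^ 2 ≤ 2 * A * ‖m‖ ^ 2} := by
    refine isClosed_le ?_ ?_ <;> fun_prop
  have hsub : (divRange hΩ hΦ : Set (Lp ℂ 2 (volume : Measure (Cn n)))) ⊆
      {m | c * ‖inner ℂ m hxL.toLp‖ ^ 2 ≤ 2 * A * ‖m‖ ^ 2} := by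
    rintro _ ⟨γ, hγ, rfl⟩
    rw [mem_ofPred_eq, inner_toLp, norm_sq_toLp_weightedDiv hΩ hΦ hγ]
    have h1 (z : Cn n) : x z * conj (weightedDiv Φ γ z) =
        v z * conj (∑ j, wirt (-I) (γ j) (e n j) z) := by
      by_cases hz : z ∈ Ω
      · rw [hx, indicator_of_mem hz, weightedDiv, map_mul, ← exp_conj, conj_ofReal]
        have : cexp ((-(Φ z / 2) : ℝ) : ℂ) * cexp ((Φ z / 2 : ℝ) : ℂ) = 1 := by
          rw [← Complex.exp_add, ← ofReal_add, neg_add_cancel, ofReal_zero, Complex.exp_zero]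
        linear_combination (v z * conj (∑ j, wirt (-I) (γ j) (e n j) z)) * this
      · rw [hx, indicator_of_notMem hz, zero_mul, Finset.sum_eq_zero fun j _ =>
          wirt_eq_zero_of_notMem fun h => hz ((hγ j).subset h), map_zero, mul_zero]
    simp only [h1]
    exact duality hΩ hpsc hΦ hc hL hv hvi hγ
  have hfin : c * ‖inner ℂ hxL.toLp hxL.toLp‖ ^ 2 ≤ 2 * A * ‖hxL.toLp‖ ^ 2 :=
    closure_minimal hsub hclosed hmem
  rw [inner_self_eq_norm_sq_to_K, norm_pow, RCLike.norm_ofReal, abs_norm, hX] at hfin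
  rcases (integral_nonneg fun _ => mul_nonneg (sq_nonneg _) (Real.exp_pos _).le :
    0 ≤ ∫ z in Ω, ‖v z‖ ^ 2 * Real.exp (-Φ z)).eq_or_lt with h0 | h0
  · rw [← h0, mul_zero]
    exact mul_nonneg zero_le_two hA0
  · refine le_of_mul_le_mul_right ?_ h0
    rw [sq, ← mul_assoc] at hfin
    exact hfin

end MinimalEstimate

section TwistedEstimate

open Filter Topology

variable {Ω : Set (Cn n)} {φ ψ : Cn n → ℝ} {v : Cn n → ℂ} {b c : ℝ}

theorem formNormSq_nonneg (f : Cn n → Fin n → ℂ) (z : Cn n) : 0 ≤ formNormSq f z :=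
  Finset.sum_nonneg fun _ _ => sq_nonneg _

theorem exists_continuous_eqOn_closedBall (hΩ : IsOpen Ω) (hv : ContinuousOn v Ω) {a : Cn n} {R : ℝ}
    (h : closedBall a R ⊆ Ω) : ∃ F : Cn n → ℂ, Continuous F ∧ EqOn F v (closedBall a R) := by
  obtain ⟨κ, hκ, -, hκΩ, hκ1, -⟩ := exists_cutoff hΩ (isCompact_closedBall a R) h
  have hs : tsupport (fun x => (κ x : ℂ)) ⊆ tsupport κ :=
    closure_mono fun z hz hz' => hz (by simp [hz'])
  refine ⟨fun z => v z * (κ z : ℂ),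
    continuous_mul_of_tsupport hΩ hv (continuous_ofReal.comp hκ.continuous)
      (hs.trans hκΩ), fun z hz => ?_⟩
  dsimp only
  rw [hκ1.self_of_nhdsSet z hz, ofReal_one, mul_one]

theorem contDiffOn_of_holomorphic (hΩ : IsOpen Ω) (hv : DifferentiableOn ℂ v Ω) :
    ContDiffOn ℝ 2 v Ω := by
  intro a ha
  obtain ⟨R, hR, hRΩ⟩ := nhds_basis_closedBall.mem_iff.1 (hΩ.mem_nhds ha)
  obtain ⟨F, hF, hFv⟩ := exists_continuous_eqOn_closedBall hΩ hv.continuousOn hRΩ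
  have hd : DifferentiableOn ℂ F (ball a R) :=
    (hv.mono (ball_subset_closedBall.trans hRΩ)).congr (hFv.mono ball_subset_closedBall)
  have h : v =ᶠ[𝓝 a] regularize (R / 4) F := by
    filter_upwards [ball_mem_nhds a (half_pos hR)] with y hy
    rw [regularize_eq_self hF (R := R / 2) (hd.mono (ball_subset_ball' ?_)) (by linarith)
      (by linarith)]
    · exact (hFv (ball_subset_closedBall (ball_subset_ball (by linarith) hy))).symm
    · linarith [mem_ball.1 hy]
  exact ((contDiff_regularize (by linarith) hF.locallyIntegrable).contDiffAt.congr_of_eventuallyEq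
    h).contDiffWithinAt

theorem twisted_estimate (hΩ : IsOpen Ω) (hpsc : Pseudoconvex Ω) (hφ : ContDiffOn ℝ 2 φ Ω)
    (hψ : ContDiffOn ℝ 2 ψ Ω) (hψ0 : ∀ z ∈ Ω, ψ z ≤ 0) (hc : 0 ≤ c)
    (hL : ∀ z ∈ Ω, ∀ w, c * ‖w‖ ^ 2 ≤ LeviForm (fun z => φ z + ψ z) z w)
    (hb : ∀ z ∈ Ω, ∑ j, ‖wirt I (fun x => (ψ x : ℂ)) (e n j) z‖ ^ 2 ≤ b) (hbc : 8 * b ≤ c)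
    (hv : ContDiffOn ℝ 2 v Ω) (hvm : MemL2 Ω φ v) (hvo : OrthToHolo Ω φ v)
    (hvi : IntegrableOn (fun z => formNormSq (dbar v) z * Real.exp (ψ z - φ z)) Ω) :
    c * ∫ z in Ω, ‖v z‖ ^ 2 * Real.exp (ψ z - φ z) ≤
      8 * ∫ z in Ω, formNormSq (dbar v) z * Real.exp (ψ z - φ z) := by
  have hm : MeasurableSet Ω := hΩ.measurableSet
  have hψC : ContDiffOn ℝ 2 (fun z => cexp (ψ z : ℂ)) Ω := contDiffOn_cexp hψ
  have hvC : ContDiffOn ℝ 2 (fun z => cexp (ψ z : ℂ) * v z) Ω := hψC.mul hv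
  have hexp (z : Cn n) : Real.exp (2 * ψ z) * Real.exp (-(φ z + ψ z)) = Real.exp (ψ z - φ z) := by
    rw [← Real.exp_add]
    congr 1
    ring
  have hn (z : Cn n) : ‖cexp (ψ z : ℂ)‖ ^ 2 = Real.exp (2 * ψ z) := by
    rw [norm_exp_ofReal, two_mul, Real.exp_add, sq]
  have hsq (z : Cn n) : ‖cexp (ψ z : ℂ) * v z‖ ^ 2 * Real.exp (-(φ z + ψ z)) =
      ‖v z‖ ^ 2 * Real.exp (ψ z - φ z) := by
    rw [norm_mul, mul_pow, hn, ← hexp z]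
    ring
  have hcont : ContinuousOn (fun z => Real.exp (ψ z - φ z)) Ω :=
    (hψ.continuousOn.sub hφ.continuousOn).rexp
  have hvA : IntegrableOn (fun z => ‖v z‖ ^ 2 * Real.exp (ψ z - φ z)) Ω := by
    refine Integrable.mono' hvm.2 (((hv.continuousOn.norm.pow 2).mul hcont).aestronglyMeasurable hm)
      ((ae_restrict_iff' hm).2 (ae_of_all _ fun z hz => ?_))
    rw [Real.norm_of_nonneg (mul_nonneg (sq_nonneg _) (Real.exp_pos _).le)]
    exact mul_le_mul_of_nonneg_left (Real.exp_le_exp.2 (by linarith [hψ0 z hz])) (sq_nonneg _)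
  have hM : MemL2 Ω (fun z => φ z + ψ z) fun z => cexp (ψ z : ℂ) * v z := by
    refine ⟨hvC.continuousOn.aestronglyMeasurable hm, ?_⟩
    simp only [hsq]
    exact hvA
  have hO : OrthToHolo Ω (fun z => φ z + ψ z) fun z => cexp (ψ z : ℂ) * v z := by
    intro h hh hhm
    rw [← hvo h hh ⟨hhm.1, ?_⟩]
    · refine integral_congr_ae (ae_of_all _ fun z => ?_)
      dsimp only
      have : cexp (ψ z : ℂ) * (Real.exp (-(φ z + ψ z)) : ℂ) = (Real.exp (-φ z) : ℂ) := by
        rw [ofReal_exp, ofReal_exp, ← Complex.exp_add, ← ofReal_add]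
        congr 2
        ring
      linear_combination (v z * conj (h z)) * this
    · refine Integrable.mono' hhm.2 (((hh.continuousOn.norm.pow 2).mul
        (hφ.continuousOn.neg.rexp)).aestronglyMeasurable hm)
        ((ae_restrict_iff' hm).2 (ae_of_all _ fun z hz => ?_))
      rw [Real.norm_of_nonneg (mul_nonneg (sq_nonneg _) (Real.exp_pos _).le)]
      exact mul_le_mul_of_nonneg_left (Real.exp_le_exp.2 (by linarith [hψ0 z hz])) (sq_nonneg _)
  have hbd (z : Cn n) (hz : z ∈ Ω) :
      formNormSq (dbar fun z => cexp (ψ z : ℂ) * v z) z * Real.exp (-(φ z + ψ z)) ≤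
      2 * (formNormSq (dbar v) z * Real.exp (ψ z - φ z)) +
        2 * b * (‖v z‖ ^ 2 * Real.exp (ψ z - φ z)) := by
    have hψd : DifferentiableAt ℝ (fun x => (ψ x : ℂ)) z :=
      ((hψ.ofReal_comp).contDiffAt (hΩ.mem_nhds hz)).differentiableAt (by norm_num)
    have hvd : DifferentiableAt ℝ v z :=
      (hv.contDiffAt (hΩ.mem_nhds hz)).differentiableAt (by norm_num)
    have hj (j : Fin n) : ‖dbar (fun z => cexp (ψ z : ℂ) * v z) z j‖ ^ 2 ≤
        Real.exp (2 * ψ z) * (2 * ‖dbar v z j‖ ^ 2 +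
          2 * ‖v z‖ ^ 2 * ‖wirt I (fun x => (ψ x : ℂ)) (e n j) z‖ ^ 2) := by
      rw [dbar_eq_wirt, wirt_mul hψd.cexp hvd, wirt_cexp hψd, mul_assoc, ← mul_add, norm_mul,
        mul_pow, hn, dbar_eq_wirt]
      refine mul_le_mul_of_nonneg_left ?_ (Real.exp_pos _).le
      have h1 := norm_add_le (wirt I v (e n j) z) (wirt I (fun x => (ψ x : ℂ)) (e n j) z * v z)
      rw [norm_mul] at h1
      have h2 := pow_le_pow_left₀ (norm_nonneg _) h1 2
      nlinarith [sq_nonneg (‖wirt I v (e n j) z‖ -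
        ‖wirt I (fun x => (ψ x : ℂ)) (e n j) z‖ * ‖v z‖)]
    calc _ ≤ (Real.exp (2 * ψ z) * (2 * formNormSq (dbar v) z + 2 * ‖v z‖ ^ 2 * b)) *
          Real.exp (-(φ z + ψ z)) := by
          refine mul_le_mul_of_nonneg_right ?_ (Real.exp_pos _).le
          refine (Finset.sum_le_sum fun j _ => hj j).trans ?_
          rw [← Finset.mul_sum, Finset.sum_add_distrib, ← Finset.mul_sum, ← Finset.mul_sum]
          refine mul_le_mul_of_nonneg_left ?_ (Real.exp_pos _).le
          exact add_le_add le_rfl (mul_le_mul_of_nonneg_left (hb z hz)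
            (mul_nonneg zero_le_two (sq_nonneg _)))
      _ = _ := by
          rw [← hexp z]
          ring
  have hri : IntegrableOn (fun z => 2 * (formNormSq (dbar v) z * Real.exp (ψ z - φ z)) +
      2 * b * (‖v z‖ ^ 2 * Real.exp (ψ z - φ z))) Ω := (hvi.const_mul 2).add (hvA.const_mul (2 * b))
  have hvi' : IntegrableOn (fun z => formNormSq (dbar fun z => cexp (ψ z : ℂ) * v z) z *
      Real.exp (-(φ z + ψ z))) Ω := by
    have hmeas : ContinuousOn (fun z => formNormSq (dbar fun z => cexp (ψ z : ℂ) * v z) z *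
        Real.exp (-(φ z + ψ z))) Ω :=
      (continuousOn_finsetSum _ fun j _ => (continuousOn_wirt hΩ hvC I (e n j)).norm.pow 2).mul
        (hφ.continuousOn.add hψ.continuousOn).neg.rexp
    refine Integrable.mono' hri (hmeas.aestronglyMeasurable hm)
      ((ae_restrict_iff' hm).2 (ae_of_all _ fun z hz => ?_))
    rw [Real.norm_of_nonneg (mul_nonneg (formNormSq_nonneg _ _) (Real.exp_pos _).le)]
    exact hbd z hz
  have hH := hormander hΩ hpsc (hφ.add hψ) hc hL hvC hM hO hvi'
  simp only [hsq] at hH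
  have hI := setIntegral_mono_on hvi' hri hm hbd
  rw [integral_add (hvi.const_mul 2) (hvA.const_mul (2 * b)), integral_const_mul,
    integral_const_mul] at hI
  have hA0 : 0 ≤ ∫ z in Ω, ‖v z‖ ^ 2 * Real.exp (ψ z - φ z) :=
    integral_nonneg fun _ => mul_nonneg (sq_nonneg _) (Real.exp_pos _).le
  nlinarith [mul_le_mul_of_nonneg_right hbc hA0]

end TwistedEstimate

section LogWeight

open Filter Topology

/-- The auxiliary weight `-(n+1) log (1 + κ|x-a|²)`. -/
def logWeight (κ : ℝ) (a x : Cn n) : ℝ := -((n + 1 : ℕ) : ℝ) * Real.log (1 + κ * ‖x - a‖ ^ 2)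

variable {κ : ℝ}

theorem one_le_one_add_mul_sq (hκ : 0 < κ) (a x : Cn n) : 1 ≤ 1 + κ * ‖x - a‖ ^ 2 :=
  le_add_of_nonneg_right (mul_nonneg hκ.le (sq_nonneg _))

theorem logWeight_nonpos (hκ : 0 < κ) (a x : Cn n) : logWeight κ a x ≤ 0 := by
  rw [logWeight, neg_mul, neg_nonpos]
  exact mul_nonneg (Nat.cast_nonneg _) (Real.log_nonneg (one_le_one_add_mul_sq hκ a x))

theorem contDiff_logWeight (hκ : 0 < κ) (a : Cn n) : ContDiff ℝ 2 (logWeight κ a) :=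
  contDiff_const.mul ((contDiff_const.add (contDiff_const.mul (contDiff_norm_sub_sq a))).log
    fun x => (zero_lt_one.trans_le (one_le_one_add_mul_sq hκ a x)).ne')

theorem hasDerivAt_log_profile (m : ℝ) {s : ℝ} (hs : 0 < 1 + κ * s) :
    HasDerivAt (fun s => -m * Real.log (1 + κ * s)) (-m * (κ / (1 + κ * s))) s := by
  have h := (((hasDerivAt_id s).const_mul κ).const_add 1).log hs.ne'
  simpa using h.const_mul (-m)

theorem deriv_deriv_log_profile (m : ℝ) {s : ℝ} (hs : 0 < 1 + κ * s) :
    deriv (deriv fun s => -m * Real.log (1 + κ * s)) s = m * (κ / (1 + κ * s)) ^ 2 := by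
  have h1 : deriv (fun s => -m * Real.log (1 + κ * s)) =ᶠ[𝓝 s] fun s => -m * (κ / (1 + κ * s)) := by
    have hc : Continuous fun s : ℝ => 1 + κ * s := by fun_prop
    filter_upwards [hc.continuousAt.eventually (lt_mem_nhds hs)] with t ht
    exact (hasDerivAt_log_profile m ht).deriv
  rw [h1.deriv_eq]
  have h2 := ((hasDerivAt_const s κ).div (((hasDerivAt_id s).const_mul κ).const_add 1)
    hs.ne').const_mul (-m)
  refine h2.deriv.trans ?_
  simp only [id, zero_mul, mul_one, zero_sub]
  rw [div_pow]
  ring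

theorem contDiffAt_log_profile (m : ℝ) {s : ℝ} (hs : 0 < 1 + κ * s) :
    ContDiffAt ℝ 2 (fun s => -m * Real.log (1 + κ * s)) s :=
  contDiffAt_const.mul ((contDiffAt_const.add (contDiffAt_const.mul contDiffAt_id)).log hs.ne')

theorem leviForm_logWeight (hκ : 0 < κ) (a z w : Cn n) :
    -((n + 1 : ℕ) * κ) * ‖w‖ ^ 2 ≤ LeviForm (logWeight κ a) z w := by
  have hs : 0 < 1 + κ * ‖z - a‖ ^ 2 := zero_lt_one.trans_le (one_le_one_add_mul_sq hκ a z)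
  have h := leviForm_comp (contDiffAt_log_profile ((n + 1 : ℕ) : ℝ) hs)
    (contDiff_norm_sub_sq a).contDiffAt w
  rw [leviForm_norm_sub_sq, deriv_deriv_log_profile _ hs, (hasDerivAt_log_profile _ hs).deriv] at h
  refine le_of_le_of_eq ?_ h.symm
  have h1 : κ / (1 + κ * ‖z - a‖ ^ 2) ≤ κ := div_le_self hκ.le (one_le_one_add_mul_sq hκ a z)
  have h2 : ((n + 1 : ℕ) : ℝ) * (κ / (1 + κ * ‖z - a‖ ^ 2)) ≤ (n + 1 : ℕ) * κ :=
    mul_le_mul_of_nonneg_left h1 (Nat.cast_nonneg _)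
  have h3 := mul_le_mul_of_nonneg_right h2 (sq_nonneg ‖w‖)
  have h4 : 0 ≤ ((n + 1 : ℕ) : ℝ) * (κ / (1 + κ * ‖z - a‖ ^ 2)) ^ 2 *
      (1 / 4 * (fderiv ℝ (fun x => ‖x - a‖ ^ 2) z w ^ 2 +
        fderiv ℝ (fun x => ‖x - a‖ ^ 2) z (I • w) ^ 2)) := by positivity
  linarith

theorem norm_wirt_norm_sub_sq_le (a z : Cn n) (j : Fin n) :
    ‖wirt I (fun x => ((‖x - a‖ ^ 2 : ℝ) : ℂ)) (e n j) z‖ ≤ 2 * ‖z - a‖ := by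
  have he : ‖e n j‖ = 1 := by simp [e]
  have hf (w : Cn n) (hw : ‖w‖ = 1) :
      ‖fderiv ℝ (fun x => ((‖x - a‖ ^ 2 : ℝ) : ℂ)) z w‖ ≤ 2 * ‖z - a‖ := by
    rw [fderiv_ofReal_comp ((contDiff_norm_sub_sq a (m := 1)).differentiable
      (by norm_num)).differentiableAt, fderiv_norm_sub_sq, norm_real]
    have := norm_inner_le_norm (𝕜 := ℝ) (z - a) w
    rw [hw, mul_one] at this
    rw [two_nsmul, add_apply, innerSL_apply_apply]
    exact (norm_add_le _ _).trans (by linarith)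
  rw [wirt, norm_mul]
  have h1 := hf _ he
  have h2 := hf _ ((norm_I_smul _).trans he)
  have h3 := norm_add_le (fderiv ℝ (fun x => ((‖x - a‖ ^ 2 : ℝ) : ℂ)) z (e n j))
    (I * fderiv ℝ (fun x => ((‖x - a‖ ^ 2 : ℝ) : ℂ)) z (I • e n j))
  rw [norm_mul, norm_I, one_mul] at h3
  rw [norm_div, norm_one, Complex.norm_two]
  linarith

theorem sum_norm_sq_wirt_logWeight_le (hκ : 0 < κ) (a z : Cn n) :
    ∑ j, ‖wirt I (fun x => (logWeight κ a x : ℂ)) (e n j) z‖ ^ 2 ≤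
      4 * n * ((n + 1 : ℕ) : ℝ) ^ 2 * κ := by
  have hs1 := one_le_one_add_mul_sq hκ a z
  have hs : 0 < 1 + κ * ‖z - a‖ ^ 2 := zero_lt_one.trans_le hs1
  have hj (j : Fin n) : ‖wirt I (fun x => (logWeight κ a x : ℂ)) (e n j) z‖ ^ 2 ≤
      4 * ((n + 1 : ℕ) : ℝ) ^ 2 * κ := by
    have h := wirt_comp I (e n j)
      ((contDiffAt_log_profile ((n + 1 : ℕ) : ℝ) hs).differentiableAt (by norm_num))
      ((contDiff_norm_sub_sq a (m := 1)).differentiable (by norm_num)).differentiableAt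
    rw [(hasDerivAt_log_profile _ hs).deriv] at h
    have h0 : wirt I (fun x => (logWeight κ a x : ℂ)) (e n j) z = _ := h
    rw [h0, norm_mul, norm_real, mul_pow, Real.norm_eq_abs, sq_abs]
    have h1 := pow_le_pow_left₀ (norm_nonneg _) (norm_wirt_norm_sub_sq_le a z j) 2
    refine (mul_le_mul_of_nonneg_left h1 (sq_nonneg _)).trans ?_
    have h2 : κ * ‖z - a‖ ^ 2 / (1 + κ * ‖z - a‖ ^ 2) ^ 2 ≤ 1 := by
      rw [div_le_one (by positivity)]
      nlinarith
    calc _ = 4 * ((n + 1 : ℕ) : ℝ) ^ 2 * κ *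
          (κ * ‖z - a‖ ^ 2 / (1 + κ * ‖z - a‖ ^ 2) ^ 2) := by
          field_simp
          ring
      _ ≤ _ := mul_le_of_le_one_right (by positivity) h2
  refine (Finset.sum_le_sum fun j _ => hj j).trans_eq ?_
  rw [Finset.sum_const, Finset.card_univ, Fintype.card_fin, nsmul_eq_mul]
  ring

/-- The model integrand `(1 + |x|²)^{-(n+1)}`. -/
def modelWeight (x : Cn n) : ℝ := (1 + ‖x‖ ^ 2) ^ (-(2 * (n + 1 : ℕ) : ℝ) / 2)

theorem finrank_real_Cn : Module.finrank ℝ (Cn n) = 2 * n := by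
  rw [finrank_real_of_complex, finrank_euclideanSpace_fin]

theorem integrable_modelWeight : Integrable (modelWeight : Cn n → ℝ) := by
  refine integrable_rpow_neg_one_add_norm_sq ?_
  rw [finrank_real_Cn]
  push_cast
  linarith

theorem exp_logWeight (hκ : 0 < κ) (a x : Cn n) :
    Real.exp (logWeight κ a x) = modelWeight (Real.sqrt κ • (x - a)) := by
  have hs : 0 < 1 + κ * ‖x - a‖ ^ 2 := zero_lt_one.trans_le (one_le_one_add_mul_sq hκ a x)
  rw [modelWeight, norm_smul, mul_pow, Real.norm_eq_abs, sq_abs, Real.sq_sqrt hκ.le,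
    Real.rpow_def_of_pos hs, logWeight]
  congr 1
  ring

theorem integrable_exp_logWeight (hκ : 0 < κ) (a : Cn n) :
    Integrable fun x => Real.exp (logWeight κ a x) := by
  simp only [exp_logWeight hκ]
  exact ((integrable_comp_smul_iff volume modelWeight (Real.sqrt_pos.2 hκ).ne').2
    integrable_modelWeight).comp_sub_right a

theorem integral_exp_logWeight (hκ : 0 < κ) (a : Cn n) :
    ∫ x, Real.exp (logWeight κ a x) = (κ ^ n)⁻¹ * ∫ x : Cn n, modelWeight x := by
  simp only [exp_logWeight hκ]
  rw [integral_sub_right_eq_self (fun x => modelWeight (Real.sqrt κ • x)) a,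
    Measure.integral_comp_smul, finrank_real_Cn, pow_mul, Real.sq_sqrt hκ.le, smul_eq_mul,
    abs_of_pos (by positivity)]

theorem modelWeight_nonneg (x : Cn n) : 0 ≤ modelWeight x :=
  Real.rpow_nonneg (by positivity) _

theorem exists_weighted_bound {Ω : Set (Cn n)} {φ : Cn n → ℝ} {δ : ℝ} (hΩ : IsOpen Ω)
    (hpsc : Pseudoconvex Ω) (hφ : ContDiffOn ℝ 2 φ Ω) (hφ0 : ∀ z ∈ Ω, 0 ≤ φ z) (hδ : 0 < δ)
    (hL : ∀ z ∈ Ω, ∀ w, δ * ‖w‖ ^ 2 ≤ LeviForm φ z w) {M : ℝ} (hM : 0 ≤ M) :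
    ∃ ε > 0, ∃ C, 0 ≤ C ∧ ∀ k, 1 ≤ k → ∀ (a : Cn n) (v : Cn n → ℂ), ContDiffOn ℝ 2 v Ω →
      MemL2 Ω (fun z => k * φ z) v → OrthToHolo Ω (fun z => k * φ z) v →
      (∀ z ∈ Ω, formNormSq (dbar v) z ≤ M) →
      IntegrableOn (fun z => ‖v z‖ ^ 2 * Real.exp (logWeight (ε * k) a z - k * φ z)) Ω ∧
      ∫ z in Ω, ‖v z‖ ^ 2 * Real.exp (logWeight (ε * k) a z - k * φ z) ≤ C / k ^ (n + 1) := by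
  set N : ℝ := ((n + 1 : ℕ) : ℝ) with hN
  have hN1 : 1 ≤ N := by
    rw [hN]
    exact_mod_cast Nat.le_add_left 1 n
  have hnN : (n : ℝ) ≤ N := by
    rw [hN]
    exact_mod_cast Nat.le_succ n
  have hN0 : 0 < N := by linarith
  set ε : ℝ := δ / (64 * N ^ 3) with hε
  have hε0 : 0 < ε := by positivity
  have hεN : 64 * N ^ 3 * ε = δ := by
    rw [hε]
    field_simp
  have hJ : 0 ≤ ∫ x : Cn n, modelWeight x := integral_nonneg modelWeight_nonneg
  refine ⟨ε, hε0, 16 * M * (∫ x : Cn n, modelWeight x) / (δ * ε ^ n), by positivity,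
    fun k hk a v hv hvm hvo hvM => ?_⟩
  have hk0 : 0 < k := by linarith
  have hκ : 0 < ε * k := mul_pos hε0 hk0
  have hm : MeasurableSet Ω := hΩ.measurableSet
  have hφk : ContDiffOn ℝ 2 (fun z => k * φ z) Ω := contDiffOn_const.mul hφ
  have hψ := contDiff_logWeight hκ a
  have hexp : ∀ z ∈ Ω, Real.exp (logWeight (ε * k) a z - k * φ z) ≤
      Real.exp (logWeight (ε * k) a z) := fun z hz =>
    Real.exp_le_exp.2 (sub_le_self _ (mul_nonneg hk0.le (hφ0 z hz)))
  have hcont : ContinuousOn (fun z => Real.exp (logWeight (ε * k) a z - k * φ z)) Ω :=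
    (hψ.continuous.continuousOn.sub hφk.continuousOn).rexp
  have hE : IntegrableOn (fun z => M * Real.exp (logWeight (ε * k) a z)) Ω :=
    ((integrable_exp_logWeight hκ a).const_mul M).integrableOn
  have hle : ∀ z ∈ Ω, formNormSq (dbar v) z * Real.exp (logWeight (ε * k) a z - k * φ z) ≤
      M * Real.exp (logWeight (ε * k) a z) := fun z hz =>
    mul_le_mul (hvM z hz) (hexp z hz) (Real.exp_pos _).le hM
  have hvi : IntegrableOn (fun z => formNormSq (dbar v) z *
      Real.exp (logWeight (ε * k) a z - k * φ z)) Ω := by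
    have hmeas : ContinuousOn (fun z => formNormSq (dbar v) z *
        Real.exp (logWeight (ε * k) a z - k * φ z)) Ω :=
      (continuousOn_finsetSum _ fun j _ => (continuousOn_wirt hΩ hv I (e n j)).norm.pow 2).mul hcont
    refine Integrable.mono' hE (hmeas.aestronglyMeasurable hm)
      ((ae_restrict_iff' hm).2 (ae_of_all _ fun z hz => ?_))
    rw [Real.norm_of_nonneg (mul_nonneg (formNormSq_nonneg _ _) (Real.exp_pos _).le)]
    exact hle z hz
  have hvA : IntegrableOn (fun z => ‖v z‖ ^ 2 *
      Real.exp (logWeight (ε * k) a z - k * φ z)) Ω := by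
    refine Integrable.mono' hvm.2 (((hv.continuousOn.norm.pow 2).mul hcont).aestronglyMeasurable hm)
      ((ae_restrict_iff' hm).2 (ae_of_all _ fun z hz => ?_))
    rw [Real.norm_of_nonneg (mul_nonneg (sq_nonneg _) (Real.exp_pos _).le)]
    exact mul_le_mul_of_nonneg_left
      (Real.exp_le_exp.2 (by linarith [logWeight_nonpos hκ a z])) (sq_nonneg _)
  have hLevi : ∀ z ∈ Ω, ∀ w, k * δ / 2 * ‖w‖ ^ 2 ≤
      LeviForm (fun z => k * φ z + logWeight (ε * k) a z) z w := by
    intro z hz w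
    have hφz : ContDiffAt ℝ 2 φ z := hφ.contDiffAt (hΩ.mem_nhds hz)
    rw [leviForm_add (contDiffAt_const.mul hφz) hψ.contDiffAt, leviForm_const_mul hφz]
    have h1 := mul_le_mul_of_nonneg_left (hL z hz w) hk0.le
    have h2 := leviForm_logWeight hκ a z w
    have h3 : N * (ε * k) ≤ k * δ / 2 := by
      have : N * ε ≤ δ / 2 := by
        rw [← hεN]
        nlinarith [mul_pos hN0 hε0, mul_le_mul_of_nonneg_left (one_le_pow₀ hN1 (n := 2))
          (mul_pos hN0 hε0).le]
      nlinarith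
    have h4 := mul_le_mul_of_nonneg_right h3 (sq_nonneg ‖w‖)
    rw [← hN] at h2
    nlinarith
  have hb : 8 * (4 * n * N ^ 2 * (ε * k)) ≤ k * δ / 2 := by
    rw [← hεN]
    have : (n : ℝ) * (N ^ 2 * ε * k) ≤ N * (N ^ 2 * ε * k) :=
      mul_le_mul_of_nonneg_right hnN (by positivity)
    nlinarith
  refine ⟨hvA, ?_⟩
  have h := twisted_estimate hΩ hpsc hφk hψ.contDiffOn (fun z _ => logWeight_nonpos hκ a z)
    (by positivity) hLevi (fun z _ => sum_norm_sq_wirt_logWeight_le hκ a z) hb hv hvm hvo hvi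
  have h1 := setIntegral_mono_on hvi hE hm hle
  have h2 : ∫ z in Ω, M * Real.exp (logWeight (ε * k) a z) ≤
      M * (((ε * k) ^ n)⁻¹ * ∫ x : Cn n, modelWeight x) := by
    rw [integral_const_mul, ← integral_exp_logWeight hκ a]
    exact mul_le_mul_of_nonneg_left (setIntegral_le_integral (integrable_exp_logWeight hκ a)
      (ae_of_all _ fun _ => (Real.exp_pos _).le)) hM
  have h3 := h.trans (mul_le_mul_of_nonneg_left (h1.trans h2) (by norm_num : (0 : ℝ) ≤ 8))
  rw [← le_div_iff₀' (by positivity)] at h3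
  refine h3.trans_eq ?_
  rw [mul_pow, pow_succ]
  field_simp
  ring

end LogWeight

section PointwiseEstimate

open Filter Topology

theorem integral_radialBump {ρ : ℝ} (hρ : 0 < ρ) :
    ∫ y : Cn n, radialBump ρ y = ρ ^ (2 * n) * ∫ y : Cn n, radialBump 1 y := by
  have h (y : Cn n) : radialBump ρ y = radialBump 1 (ρ⁻¹ • y) := by
    rw [radialBump, radialBump, norm_smul, mul_pow, one_pow, div_one, Real.norm_eq_abs, sq_abs,
      inv_pow, div_eq_inv_mul]
  simp only [h]
  rw [Measure.integral_comp_inv_smul_of_nonneg _ _ hρ.le, finrank_real_Cn, smul_eq_mul]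

theorem mollifier_le {ρ : ℝ} (hρ : 0 < ρ) (x : Cn n) :
    mollifier ρ x ≤ (∫ y : Cn n, radialBump ρ y)⁻¹ :=
  mul_le_of_le_one_right (inv_nonneg.2 (integral_radialBump_pos hρ).le)
    (Real.smoothTransition.le_one _)

theorem norm_sub_le_of_holomorphic {Ω : Set (Cn n)} (hΩ : IsOpen Ω) {u P : Cn n → ℂ}
    (hu : Continuous u) (hP : DifferentiableOn ℂ P Ω) {a : Cn n} {ρ R D B : ℝ} (hρ : 0 < ρ)
    (hρR : ρ < R) (hR : closedBall a R ⊆ Ω) (hD : ∀ t ∈ closedBall a ρ, ‖u a - u t‖ ≤ D)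
    (hB : ∫ t in closedBall a ρ, ‖u t - P t‖ ^ 2 ≤ B) :
    ‖u a - P a‖ ≤ D + Real.sqrt (B * (∫ y : Cn n, radialBump ρ y)⁻¹) := by
  obtain ⟨F, hF, hFP⟩ := exists_continuous_eqOn_closedBall hΩ hP.continuousOn hR
  have hFd : DifferentiableOn ℂ F (ball a R) :=
    (hP.mono (ball_subset_closedBall.trans hR)).congr (hFP.mono ball_subset_closedBall)
  have hreg := regularize_eq_self hF hFd hρ hρR
  have hFP' : ∀ t ∈ closedBall a ρ, F t = P t := fun t ht =>
    hFP (closedBall_subset_closedBall hρR.le ht)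
  have hm : Continuous fun t : Cn n => mollifier ρ (a - t) :=
    (continuous_mollifier ρ).comp (continuous_const.sub continuous_id)
  have hm0 : ∀ t ∉ closedBall a ρ, mollifier ρ (a - t) = 0 := fun t ht => by
    refine mollifier_eq_zero hρ ?_
    rw [mem_closedBall', not_le, dist_eq_norm] at ht
    exact ht.le
  have hcm : Continuous fun t : Cn n => cmollifier ρ (a - t) := continuous_ofReal.comp hm
  have hcm0 : ∀ t ∉ closedBall a ρ, cmollifier ρ (a - t) = 0 := fun t ht => by
    rw [cmollifier, hm0 t ht, ofReal_zero]
  have hint {g : Cn n → ℂ} (hg : Continuous g) :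
      Integrable fun t => g t * cmollifier ρ (a - t) := by
    refine (hg.mul hcm).integrable_of_hasCompactSupport
      (HasCompactSupport.intro (isCompact_closedBall a ρ) fun t ht => ?_)
    rw [Pi.mul_apply, hcm0 t ht, mul_zero]
  have hmi : Integrable fun t : Cn n => mollifier ρ (a - t) :=
    (integrable_mollifier hρ).comp_sub_left a
  have hm1 : ∫ t : Cn n, mollifier ρ (a - t) = 1 := by
    rw [integral_sub_left_eq_self (mollifier ρ) volume a, integral_mollifier hρ]
  have hone : ∫ t : Cn n, cmollifier ρ (a - t) = 1 := by
    simp only [cmollifier]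
    rw [integral_complex_ofReal, hm1, ofReal_one]
  have hsplit : u a - P a = (∫ t, (u a - u t) * cmollifier ρ (a - t)) +
      ∫ t, (u t - F t) * cmollifier ρ (a - t) := by
    rw [← integral_add (hint (g := fun t => u a - u t) (continuous_const.sub hu))
      (hint (g := fun t => u t - F t) (hu.sub hF)), ← hFP' a (mem_closedBall_self hρ.le), ← hreg]
    have h1 : u a = ∫ t, u a * cmollifier ρ (a - t) := by
      rw [integral_const_mul, hone, mul_one]
    rw [regularize]
    nth_rewrite 1 [h1]
    rw [← integral_sub (hint (g := fun _ => u a) continuous_const) (hint hF)]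
    refine integral_congr_ae (ae_of_all _ fun t => ?_)
    dsimp only
    ring
  have hn (t : Cn n) : ‖cmollifier ρ (a - t)‖ = mollifier ρ (a - t) := by
    rw [cmollifier, norm_real, Real.norm_of_nonneg (mollifier_nonneg hρ _)]
  have h1 : ‖∫ t, (u a - u t) * cmollifier ρ (a - t)‖ ≤ D := by
    have : ∫ t, D * mollifier ρ (a - t) = D := by rw [integral_const_mul, hm1, mul_one]
    rw [← this]
    refine norm_integral_le_of_norm_le (hmi.const_mul D) (ae_of_all _ fun t => ?_)
    rw [norm_mul, hn]
    by_cases ht : t ∈ closedBall a ρ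
    · exact mul_le_mul_of_nonneg_right (hD t ht) (mollifier_nonneg hρ _)
    · rw [hm0 t ht, mul_zero, mul_zero]
  have hL {g : Cn n → ℂ} (hg : Continuous g) : MemLp g 2 (volume.restrict (closedBall a ρ)) := by
    rw [memLp_two_iff_integrable_sq_norm hg.aestronglyMeasurable]
    exact (hg.norm.pow 2).continuousOn.integrableOn_compact (isCompact_closedBall a ρ)
  have h2 : ‖∫ t, (u t - F t) * cmollifier ρ (a - t)‖ ≤
      Real.sqrt (B * (∫ y : Cn n, radialBump ρ y)⁻¹) := by
    refine Real.le_sqrt_of_sq_le ?_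
    rw [← setIntegral_eq_integral_of_forall_compl_eq_zero (s := closedBall a ρ)
      fun t ht => by rw [hcm0 t ht, mul_zero]]
    refine (norm_sq_integral_mul_le (hL (g := fun t => u t - F t) (hu.sub hF)) (hL hcm)).trans ?_
    have h3 : ∫ t in closedBall a ρ, ‖u t - F t‖ ^ 2 ≤ B := by
      refine le_of_eq_of_le (setIntegral_congr_fun measurableSet_closedBall fun t ht => ?_) hB
      rw [hFP' t ht]
    have h4 : ∫ t in closedBall a ρ, ‖cmollifier ρ (a - t)‖ ^ 2 ≤
        (∫ y : Cn n, radialBump ρ y)⁻¹ := by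
      have h5 : ∫ t, (∫ y : Cn n, radialBump ρ y)⁻¹ * mollifier ρ (a - t) =
          (∫ y : Cn n, radialBump ρ y)⁻¹ := by rw [integral_const_mul, hm1, mul_one]
      have h6 : ∀ t : Cn n, 0 ≤ (∫ y : Cn n, radialBump ρ y)⁻¹ * mollifier ρ (a - t) := fun t =>
        mul_nonneg (inv_nonneg.2 (integral_radialBump_pos hρ).le) (mollifier_nonneg hρ _)
      refine le_trans ?_ ((setIntegral_le_integral (s := closedBall a ρ)
        (hmi.const_mul _) (ae_of_all _ h6)).trans_eq h5)
      refine integral_mono ((hL hcm).integrable_norm_pow (by norm_num))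
        (hmi.const_mul _).integrableOn fun t => ?_
      dsimp only
      rw [hn, sq]
      exact mul_le_mul_of_nonneg_right (mollifier_le hρ _) (mollifier_nonneg hρ _)
    exact mul_le_mul h3 h4 (integral_nonneg fun _ => sq_nonneg _)
      ((integral_nonneg fun _ => sq_nonneg _).trans hB)
  rw [hsplit]
  exact (norm_add_le _ _).trans (add_le_add h1 h2)

theorem exists_quadratic_bound {Ω K : Set (Cn n)} {φ : Cn n → ℝ} (hΩ : IsOpen Ω)
    (hφ : ContDiffOn ℝ 2 φ Ω) (hφ0 : ∀ z ∈ Ω, 0 ≤ φ z) (hK : IsCompact K) (hKΩ : K ⊆ Ω) :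
    ∃ R > 0, ∃ Λ, 0 ≤ Λ ∧ ∀ a ∈ K, φ a = 0 → closedBall a R ⊆ Ω ∧
      ∀ x ∈ closedBall a R, φ x ≤ Λ * ‖x - a‖ ^ 2 := by
  obtain ⟨R, hR, hRΩ⟩ := hK.exists_cthickening_subset_open hΩ hKΩ
  have hd1 : ContDiffOn ℝ 1 (fderiv ℝ φ) Ω := hφ.fderiv_of_isOpen hΩ (by norm_num)
  obtain ⟨M, hM⟩ := (hK.cthickening (r := R)).exists_bound_of_continuousOn
    ((hd1.continuousOn_fderiv_of_isOpen hΩ le_rfl).mono hRΩ)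
  refine ⟨R, hR, max M 0, le_max_right _ _, fun a ha ha0 => ?_⟩
  have hball : closedBall a R ⊆ cthickening R K := closedBall_subset_cthickening ha R
  have hballΩ := hball.trans hRΩ
  refine ⟨hballΩ, fun x hx => ?_⟩
  have hmin : IsLocalMin φ a := by
    filter_upwards [hΩ.mem_nhds (hKΩ ha)] with z hz
    rw [ha0]
    exact hφ0 z hz
  have hgrad : ∀ y ∈ closedBall a R, ‖fderiv ℝ φ y‖ ≤ max M 0 * ‖y - a‖ := by
    intro y hy
    have h := (convex_closedBall a R).norm_image_sub_le_of_norm_fderiv_le (𝕜 := ℝ)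
      (f := fderiv ℝ φ) (C := max M 0)
      (fun z hz => (hd1.contDiffAt (hΩ.mem_nhds (hballΩ hz))).differentiableAt (by norm_num))
      (fun z hz => (hM z (hball hz)).trans (le_max_left _ _)) (mem_closedBall_self hR.le) hy
    rwa [hmin.fderiv_eq_zero, sub_zero] at h
  have hxR : ‖x - a‖ ≤ R := by rwa [← dist_eq_norm]
  have h := (convex_closedBall a ‖x - a‖).norm_image_sub_le_of_norm_fderiv_le (𝕜 := ℝ)
    (f := φ) (C := max M 0 * ‖x - a‖)
    (fun z hz => (hφ.contDiffAt (hΩ.mem_nhds (hballΩ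
      (closedBall_subset_closedBall hxR hz)))).differentiableAt (by norm_num))
    (fun z hz => (hgrad z (closedBall_subset_closedBall hxR hz)).trans
      (mul_le_mul_of_nonneg_left (by rwa [← dist_eq_norm]) (le_max_right _ _)))
    (mem_closedBall_self (norm_nonneg _)) (show x ∈ closedBall a ‖x - a‖ by
      rw [mem_closedBall, dist_eq_norm])
  rw [ha0, sub_zero, mul_assoc, ← sq] at h
  exact (le_abs_self _).trans h

theorem memL2_of_compact {Ω : Set (Cn n)} {φ : Cn n → ℝ} (hΩ : IsOpen Ω)
    (hφ : ContinuousOn φ Ω) {u : Cn n → ℂ} (hu : Continuous u) (huc : HasCompactSupport u)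
    (hus : tsupport u ⊆ Ω) : MemL2 Ω φ u := by
  refine ⟨hu.aestronglyMeasurable, ?_⟩
  have h : IntegrableOn (fun z => ‖u z‖ ^ 2 * Real.exp (-φ z)) (tsupport u) :=
    ContinuousOn.integrableOn_compact huc
      ((hu.norm.pow 2).continuousOn.mul (hφ.mono hus).neg.rexp)
  refine h.of_forall_sdiff_eq_zero hΩ.measurableSet fun z hz => ?_
  rw [image_eq_zero_of_notMem_tsupport hz.2, norm_zero, sq, mul_zero, zero_mul]

theorem MemL2.sub {Ω : Set (Cn n)} {φ : Cn n → ℝ} (hΩ : IsOpen Ω) (hφ : ContinuousOn φ Ω)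
    {u v : Cn n → ℂ} (hu : MemL2 Ω φ u) (hv : MemL2 Ω φ v) : MemL2 Ω φ fun z => u z - v z := by
  refine ⟨hu.1.sub hv.1, ?_⟩
  refine Integrable.mono' ((hu.2.add hv.2).const_mul 2) (((hu.1.sub hv.1).norm.pow 2).mul
    (hφ.neg.rexp.aestronglyMeasurable hΩ.measurableSet)) (ae_of_all _ fun z => ?_)
  rw [Real.norm_of_nonneg (mul_nonneg (sq_nonneg _) (Real.exp_pos _).le), Pi.add_apply, ← add_mul,
    ← mul_assoc]
  refine mul_le_mul_of_nonneg_right ?_ (Real.exp_pos _).le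
  have h := pow_le_pow_left₀ (norm_nonneg _) (norm_sub_le (u z) (v z)) 2
  nlinarith [sq_nonneg (‖u z‖ - ‖v z‖)]

end PointwiseEstimate

/-- **Theorem 1.1.** Let `Ω ⊆ ℂⁿ` be pseudoconvex open, `φ` a `C²`, nonnegative,
plurisubharmonic function on `Ω` with `i∂∂̄φ ≥ δβ`, `δ > 0`, and `E = {φ = 0}`.
If `u` is smooth with compact support in `Ω` and `K ⊆ Ω` is compact, then there is `C > 0`
such that for every `k ≥ 1`, `sup_{E ∩ K} |u - P_k(u)| ≤ C / √k`, where `P_k(u)` is the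
orthogonal projection of `u` onto the Bergman space `A²(Ω, e^{-kφ})`, i.e. any holomorphic
`Pu ∈ L²(Ω, e^{-kφ})` with `u - Pu` orthogonal to all holomorphic functions in
`L²(Ω, e^{-kφ})`. -/
theorem approximation_on_totally_real_sets
    (Ω : Set (Cn n)) (hΩ : IsOpen Ω) (hpsc : Pseudoconvex Ω)
    (φ : Cn n → ℝ) (hφC2 : ContDiffOn ℝ 2 φ Ω)
    (hφ0 : ∀ z ∈ Ω, 0 ≤ φ z)
    (hpsh : ∀ z ∈ Ω, ∀ w : Cn n, 0 ≤ LeviForm φ z w)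
    (δ : ℝ) (hδ : 0 < δ)
    (hLevi : ∀ z ∈ Ω, ∀ w : Cn n, δ * ‖w‖ ^ 2 ≤ LeviForm φ z w)
    (E : Set (Cn n)) (hE : E = {z ∈ Ω | φ z = 0})
    (u : Cn n → ℂ) (hu : ContDiff ℝ (⊤ : ℕ∞) u) (huc : HasCompactSupport u)
    (husupp : tsupport u ⊆ Ω)
    (K : Set (Cn n)) (hK : IsCompact K) (hKΩ : K ⊆ Ω) :
    ∃ C > 0, ∀ k : ℝ, 1 ≤ k → ∀ Pu : Cn n → ℂ,
      DifferentiableOn ℂ Pu Ω →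
      MemL2 Ω (fun z => k * φ z) Pu →
      OrthToHolo Ω (fun z => k * φ z) (fun z => u z - Pu z) →
      ∀ z ∈ E ∩ K, ‖u z - Pu z‖ ≤ C / Real.sqrt k := by
  have hu2 : ContDiff ℝ 2 u := contDiff_infty.1 hu 2
  obtain ⟨L, hLip⟩ := hu.lipschitzWith_of_hasCompactSupport huc (by simp)
  obtain ⟨M, hM⟩ : ∃ M, ∀ z, formNormSq (dbar u) z ≤ M := by
    have hj (j : Fin n) : ∃ m, ∀ z, ‖dbar u z j‖ ≤ m :=
      (hu2.continuous_wirt (by norm_num)).bounded_above_of_compact_support huc.wirt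
    choose m hm using hj
    exact ⟨∑ j, m j ^ 2, fun z =>
      Finset.sum_le_sum fun j _ => pow_le_pow_left₀ (norm_nonneg _) (hm j z) 2⟩
  have hM0 : 0 ≤ M := (formNormSq_nonneg _ _).trans (hM 0)
  obtain ⟨ε, hε, C₀, hC₀, hbound⟩ := exists_weighted_bound hΩ hpsc hφC2 hφ0 hδ hLevi hM0
  obtain ⟨R, hR, Λ, hΛ, hquad⟩ := exists_quadratic_bound hΩ hφC2 hφ0 hK hKΩ
  set r : ℝ := R / 2 with hr
  have hr0 : 0 < r := half_pos hR
  set J : ℝ := ∫ y : Cn n, radialBump 1 y with hJ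
  have hJ0 : 0 < J := integral_radialBump_pos one_pos
  set w : ℝ := Real.exp (-((n + 1 : ℕ) : ℝ) * Real.log (1 + ε * r ^ 2) - Λ * r ^ 2) with hw
  have hw0 : 0 < w := Real.exp_pos _
  set C₁ : ℝ := C₀ / w * (r ^ (2 * n) * J)⁻¹ with hC₁
  refine ⟨L * r + Real.sqrt C₁ + 1, by positivity, fun k hk P hP hPm hPo a ha => ?_⟩
  have hk0 : 0 < k := by linarith
  obtain ⟨haE, haK⟩ := ha
  rw [hE] at haE
  obtain ⟨hRΩ, hq⟩ := hquad a haK haE.2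
  have hφk : ContinuousOn (fun z => k * φ z) Ω := continuousOn_const.mul hφC2.continuousOn
  have hPC : ContDiffOn ℝ 2 P Ω := contDiffOn_of_holomorphic hΩ hP
  have hvC : ContDiffOn ℝ 2 (fun z => u z - P z) Ω := hu2.contDiffOn.sub hPC
  have hvm : MemL2 Ω (fun z => k * φ z) fun z => u z - P z :=
    (memL2_of_compact hΩ hφk hu.continuous huc husupp).sub hΩ hφk hPm
  have hdbar : ∀ z ∈ Ω, formNormSq (dbar fun z => u z - P z) z ≤ M := by
    intro z hz
    refine le_of_eq_of_le ?_ (hM z)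
    refine Finset.sum_congr rfl fun j _ => ?_
    have hPz : DifferentiableAt ℂ P z := hP.differentiableAt (hΩ.mem_nhds hz)
    rw [dbar_eq_wirt, wirt_sub (hu2.differentiable (by norm_num)).differentiableAt
      (hPz.restrictScalars ℝ), wirt_I_eq_zero hPz, sub_zero, dbar_eq_wirt]
  obtain ⟨hAi, hA⟩ := hbound k hk a _ hvC hvm hPo hdbar
  have hsk : 0 < Real.sqrt k := Real.sqrt_pos.2 hk0
  have hsk1 : 1 ≤ Real.sqrt k := Real.one_le_sqrt.2 hk
  set ρ : ℝ := r / Real.sqrt k with hρ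
  have hρ0 : 0 < ρ := div_pos hr0 hsk
  have hρr : ρ ≤ r := div_le_self hr0.le hsk1
  have hρR : ρ < R := by linarith
  have hkρ : k * ρ ^ 2 = r ^ 2 := by
    rw [hρ, div_pow, Real.sq_sqrt hk0.le]
    field_simp
  have hsub : closedBall a ρ ⊆ Ω := (closedBall_subset_closedBall hρR.le).trans hRΩ
  have hweight : ∀ z ∈ closedBall a ρ, w ≤ Real.exp (logWeight (ε * k) a z - k * φ z) := by
    intro z hz
    have hza : ‖z - a‖ ≤ ρ := by rwa [← dist_eq_norm]
    have hza2 : k * ‖z - a‖ ^ 2 ≤ r ^ 2 := by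
      rw [← hkρ]
      exact mul_le_mul_of_nonneg_left (pow_le_pow_left₀ (norm_nonneg _) hza 2) hk0.le
    have h1 : k * φ z ≤ Λ * r ^ 2 := by
      have := mul_le_mul_of_nonneg_left (hq z (closedBall_subset_closedBall hρR.le hz)) hk0.le
      nlinarith [mul_le_mul_of_nonneg_left hza2 hΛ]
    have h2 : Real.log (1 + ε * k * ‖z - a‖ ^ 2) ≤ Real.log (1 + ε * r ^ 2) := by
      refine Real.log_le_log (by positivity) ?_
      nlinarith [mul_le_mul_of_nonneg_left hza2 hε.le]
    refine Real.exp_le_exp.2 ?_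
    rw [logWeight]
    have := mul_le_mul_of_nonneg_left h2 (Nat.cast_nonneg (α := ℝ) (n + 1))
    linarith
  have hB : ∫ t in closedBall a ρ, ‖u t - P t‖ ^ 2 ≤ C₀ / k ^ (n + 1) / w := by
    rw [le_div_iff₀ hw0, ← integral_mul_const]
    have hvi : IntegrableOn (fun t => ‖u t - P t‖ ^ 2 * w) (closedBall a ρ) :=
      (((hvC.continuousOn.mono hsub).norm.pow 2).mul continuousOn_const).integrableOn_compact
        (isCompact_closedBall a ρ)
    refine (setIntegral_mono_on hvi (hAi.mono_set hsub) measurableSet_closedBall fun t ht =>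
      mul_le_mul_of_nonneg_left (hweight t ht) (sq_nonneg _)).trans (le_trans ?_ hA)
    exact setIntegral_mono_set hAi (ae_of_all _ fun t => mul_nonneg (sq_nonneg _)
      (Real.exp_pos _).le) hsub.eventuallyLE
  have hD : ∀ t ∈ closedBall a ρ, ‖u a - u t‖ ≤ L * ρ := by
    intro t ht
    rw [← dist_eq_norm]
    exact (hLip.dist_le_mul a t).trans (mul_le_mul_of_nonneg_left (mem_closedBall'.1 ht) L.2)
  have h := norm_sub_le_of_holomorphic hΩ hu.continuous hP hρ0 hρR hRΩ hD hB
  have hC : C₀ / k ^ (n + 1) / w * (∫ y : Cn n, radialBump ρ y)⁻¹ = C₁ / k := by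
    rw [integral_radialBump hρ0, ← hJ, hC₁, hρ, div_pow, pow_mul (Real.sqrt k),
      Real.sq_sqrt hk0.le, pow_succ]
    field_simp
  rw [hC, Real.sqrt_div' _ hk0.le] at h
  refine h.trans ?_
  rw [hρ, ← mul_div_assoc, ← add_div]
  exact div_le_div_of_nonneg_right (by linarith) hsk.le
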